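/- Let g ≥ 2, n ≥ 1, and let d_1,…,d_n ≥ 1 be integers with Σ_{j=1}^n (d_j−1) = g. Then (2g−3+n)!/(2^{2g+1}(2g−3)! Π_{j=1}^n (2d_j−1)!!) = ⟨τ_{2g−2} Π_{j=1}^n τ_{d_j}⟩_g − Σ_{j=1}^{n} ⟨τ_{d_j+2g−3} Π_{i≠j} τ_{d_i}⟩_g + (1/2) Σ_{g'=0}^{g} Σ_{{1,…,n}=I⊔J} Σ_{j=0}^{2g−4} (−1)^j ⟨τ_{j} Π_{i∈I} τ_{d_i}⟩_{g'} ⟨τ_{2g−4−j} Π_{i∈J} τ_{d_i}⟩_{g−g'}, where the sum over I⊔J runs over ordered pairs of disjoint, possibly empty, sets with union {1,…,n}. -/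

import Mathlib

open MvPolynomial Finset

noncomputable section

/-- The polynomial ring `ℚ[x_1,…,x_n]`. -/
abbrev R (n : ℕ) : Type := MvPolynomial (Fin n) ℚ

/-- The field of rational functions `ℚ(x_1,…,x_n)`. -/
abbrev K (n : ℕ) : Type := FractionRing (R n)

/-- `x_1 + ⋯ + x_n` as an element of `K n`. -/
def SX (n : ℕ) : K n := algebraMap (R n) (K n) (∑ j, X j)

/-- `x_1^3 + ⋯ + x_n^3` as an element of `K n`. -/
def SX3 (n : ℕ) : K n := algebraMap (R n) (K n) (∑ j, (X j)^3)

/-- `Δ(x_1,…,x_n) = ((Σ x_j)^3 − Σ x_j^3)/3`. -/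
def Dlt (n : ℕ) : K n := ((SX n)^3 - SX3 n) / 3

/-- The ring homomorphism `ℚ[x_1,…,x_{|I|}] → ℚ(x_1,…,x_n)` substituting the variables
of the subset `I` (in increasing order). -/
def embRH {n : ℕ} (I : Finset (Fin n)) : R I.card →+* K n :=
  (algebraMap (R n) (K n)).comp
    (MvPolynomial.rename (fun i : Fin I.card => ((I.orderIsoOfFin rfl) i : Fin n))).toRingHom

lemma embRH_inj {n : ℕ} (I : Finset (Fin n)) : Function.Injective (embRH I) := by
  have h1 : Function.Injective (fun i : Fin I.card => ((I.orderIsoOfFin rfl) i : Fin n)) := by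
    intro i j hij
    exact (I.orderIsoOfFin rfl).injective (Subtype.val_injective hij)
  have h2 := (IsFractionRing.injective (R n) (K n)).comp (MvPolynomial.rename_injective _ h1)
  simpa [embRH, RingHom.coe_comp] using h2

/-- The field embedding `ℚ(x_1,…,x_{|I|}) → ℚ(x_1,…,x_n)` substituting the variables
of the subset `I` (in increasing order).  Used for expressions like `G_{r'}(x_I)`. -/
def emb {n : ℕ} (I : Finset (Fin n)) : K I.card →+* K n :=
  IsFractionRing.lift (embRH_inj I)

/-- The normalized `n`-point functions `G_g(x_1,…,x_n)`, defined with a fuel parameter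
(first argument) for structural recursion; for `fuel ≥ n` this computes the recursively
defined normalized `n`-point function:  `G_0(x) = x^{-2}`, `G_g(x) = 0` for `g ≥ 1`, and
for `n ≥ 2`,
`G_g = Σ_{r+s=g} ((2r+n−3)!!/(4^s(2r+2s+n−1)!!)) P_r Δ^s` where
`P_r = (1/(2Σx_j)) Σ_{I⊔J={1..n}, I,J≠∅} (Σ_I x)²(Σ_J x)² Σ_{r'≤r} G_{r'}(x_I)G_{r−r'}(x_J)`. -/
def Gf : (fuel : ℕ) → (n : ℕ) → ℕ → K n
  | _, 0, _ => 0
  | _, 1, 0 => (algebraMap (R 1) (K 1) (X 0)) ^ (-2 : ℤ)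
  | _, 1, _+1 => 0
  | 0, _+2, _ => 0
  | fuel+1, n+2, g =>
      ∑ s ∈ Finset.range (g+1),
        (((Nat.doubleFactorial (2*(g-s)+(n+2)-3) : ℚ) /
          (4^s * (Nat.doubleFactorial (2*g+(n+2)-1) : ℚ))) : K (n+2)) *
        ((2 * SX (n+2))⁻¹ *
          ∑ I : Finset (Fin (n+2)),
            if I ≠ ∅ ∧ I ≠ univ then
              (algebraMap (R (n+2)) (K (n+2)) (∑ i ∈ I, X i))^2 *
              (algebraMap (R (n+2)) (K (n+2)) (∑ i ∈ Iᶜ, X i))^2 *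
              ∑ r' ∈ Finset.range ((g-s)+1),
                emb I (Gf fuel I.card r') * emb Iᶜ (Gf fuel Iᶜ.card ((g-s) - r'))
            else 0) *
        (Dlt (n+2))^s

/-- The normalized `n`-point function `G_g(x_1,…,x_n)` as an element of `ℚ(x_1,…,x_n)`. -/
def Gnpt (n g : ℕ) : K n := Gf n n g

/-- `P_r(x_1,…,x_n)`. -/
def Ppoly (n r : ℕ) : K n :=
  (2 * SX n)⁻¹ *
    ∑ I : Finset (Fin n),
      if I ≠ ∅ ∧ I ≠ univ then
        (algebraMap (R n) (K n) (∑ i ∈ I, X i))^2 *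
        (algebraMap (R n) (K n) (∑ i ∈ Iᶜ, X i))^2 *
        ∑ r' ∈ Finset.range (r+1), emb I (Gnpt I.card r') * emb Iᶜ (Gnpt Iᶜ.card (r - r'))
      else 0

/-- The `n`-point function `F_g(x_1,…,x_n) = Σ_{h+d=g} (1/d!)((Σx_j^3)/24)^d G_h(x_1,…,x_n)`. -/
def Fnpt (n g : ℕ) : K n :=
  ∑ d ∈ Finset.range (g+1),
    ((1 / (Nat.factorial d : ℚ)) : K n) * (SX3 n / 24)^d * Gnpt n (g-d)

open Classical in
/-- The coefficient of the monomial `Π x_j^{d_j}` of an element of `ℚ(x_1,…,x_n)` which is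
a polynomial (junk value `0` otherwise). -/
def coeffK {n : ℕ} (f : K n) (d : Fin n → ℕ) : ℚ :=
  if h : ∃ p : R n, algebraMap (R n) (K n) p = f then
    MvPolynomial.coeff (Finsupp.equivFunOnFinite.symm d) h.choose
  else 0

/-- The intersection index `⟨τ_{d_1} ⋯ τ_{d_n}⟩_g`, i.e. the coefficient of `Π x_j^{d_j}`
in `F_g(x_1,…,x_n)`.  For `(g,n) = (0,1), (0,2)` and nonnegative `d_j` the value is `0`
(the conventional values `⟨τ_{-2}⟩_0 = 1`, `⟨τ_k τ_{-1-k}⟩_0 = (-1)^k` have a negative index). -/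
def bracket (g : ℕ) {n : ℕ} (d : Fin n → ℕ) : ℚ :=
  if g = 0 ∧ n ≤ 2 then 0 else coeffK (Fnpt n g) d

/-- `⟨τ_j Π_{i ∈ I} τ_{d_i}⟩_g` for a subset `I ⊆ {1,…,n}`. -/
def bracketI (g : ℕ) {n : ℕ} (j : ℕ) (I : Finset (Fin n)) (d : Fin n → ℕ) : ℚ :=
  bracket g (Fin.cons j (fun i : Fin I.card => d ((I.orderIsoOfFin rfl) i)))


/-! ### Laurent expansions in `y` (formal series in `ℚ[x_1,…,x_n][[y,y⁻¹]]` of bounded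
`y`-degree, realized as Hahn/Laurent series in the variable `t = y⁻¹`, so that the
coefficient of `y^k` is the Hahn coefficient at `-k`). -/

/-- Laurent series in `t = y⁻¹` with coefficients in `ℚ[x_1,…,x_n]`. -/
abbrev Lau (n : ℕ) : Type := LaurentSeries (R n)

/-- The generalized binomial coefficient `C(p,k) = p(p−1)⋯(p−k+1)/k!` for `p : ℤ`, `k : ℕ`. -/
def binomZ (p : ℤ) (k : ℕ) : ℚ := (∏ i ∈ Finset.range k, ((p : ℚ) - i)) / (Nat.factorial k)

/-- The expansion of `(y + c)^m = Σ_{k≥0} C(m,k) c^k y^{m−k}` as a Laurent series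
in `t = y⁻¹` (for `m ≥ 0` this is the usual binomial expansion of the polynomial). -/
def yExpAdd {n : ℕ} (c : R n) (m : ℤ) : Lau n :=
  (HahnSeries.single (-m) (1 : R n)) *
    HahnSeries.ofPowerSeries ℤ (R n)
      (PowerSeries.mk fun k => MvPolynomial.C (binomZ m k) * c^k)

/-- The expansion of `(±y + c)^m`, where the sign is `+` if `σ = true` and `−` otherwise;
it is computed as `(±1)^m (y ± c)^m`. -/
def LExp {n : ℕ} (σ : Bool) (c : R n) (m : ℤ) : Lau n :=
  (if σ then 1 else if Even m then 1 else -1 : Lau n) *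
    yExpAdd ((if σ then 1 else -1 : R n) * c) m

open Classical in
/-- The polynomial representing an element of `ℚ(x_1,…,x_n)` lying in `ℚ[x_1,…,x_n]`
(junk value `0` otherwise). -/
def polyOf {n : ℕ} (f : K n) : R n :=
  if h : ∃ p : R n, algebraMap (R n) (K n) p = f then h.choose else 0

/-- `±y` as a Laurent series in `t = y⁻¹`. -/
def yLau (n : ℕ) (σ : Bool) : Lau n :=
  (if σ then 1 else -1 : Lau n) * HahnSeries.single (-1 : ℤ) (1 : R n)

/-- The expansion of `F_g(±y, x_I)` as a Laurent series in `t = y⁻¹` with coefficients in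
`ℚ[x_1,…,x_n]`: for `(g,|I|+1) = (0,1)` it is `(±y)^{-2} = y^{-2}`, for `(g,|I|+1) = (0,2)`
it is `1/(±y + x_i) = Σ_{k≥0} (−1)^k x_i^k (±y)^{−k−1}`, and otherwise it is obtained by
substituting `±y` and the variables of `I` into the polynomial `F_g`. -/
def FExp {n : ℕ} (σ : Bool) (g : ℕ) (I : Finset (Fin n)) : Lau n :=
  if g = 0 ∧ I.card = 0 then HahnSeries.single (2 : ℤ) (1 : R n)
  else if g = 0 ∧ I.card = 1 then LExp σ (∑ i ∈ I, X i) (-1)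
  else
    MvPolynomial.eval₂ ((HahnSeries.C).comp (algebraMap ℚ (R n)))
      (Fin.cons (yLau n σ)
        (fun i : Fin I.card => HahnSeries.C (X ((I.orderIsoOfFin rfl) i : Fin n))))
      (polyOf (Fnpt (I.card + 1) g))

/-- `L_g^{a,b}(y, x_1,…,x_n) = Σ_{g'=0}^{g} Σ_{I⊔J={1,…,n}} (y+Σ_I x)^a (−y+Σ_J x)^b
F_{g'}(y,x_I) F_{g−g'}(−y,x_J)` as a Laurent series in `t = y⁻¹`. -/
def LL (g n : ℕ) (a b : ℤ) : Lau n :=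
  ∑ gp ∈ Finset.range (g+1), ∑ I : Finset (Fin n),
    LExp true (∑ i ∈ I, X i) a * LExp false (∑ i ∈ Iᶜ, X i) b *
      FExp true gp I * FExp false (g - gp) Iᶜ

/-- The coefficient of `y^k Π_j x_j^{d_j}` in a Laurent series in `t = y⁻¹` with coefficients
in `ℚ[x_1,…,x_n]`. -/
def coeffL {n : ℕ} (f : Lau n) (k : ℤ) (d : Fin n → ℕ) : ℚ :=
  MvPolynomial.coeff (Finsupp.equivFunOnFinite.symm d) (f.coeff (-k))

/-- The index of the variable `z_i` among the `a + b + n` variables `z, w, x`. -/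
def zIdx (a b n : ℕ) (i : Fin a) : Fin (a+b+n) := ⟨i.1, by have := i.2; omega⟩

/-- The index of the variable `w_i` among the `a + b + n` variables `z, w, x`. -/
def wIdx (a b n : ℕ) (i : Fin b) : Fin (a+b+n) := ⟨a + i.1, by have := i.2; omega⟩

/-- The index of the variable `x_i` among the `a + b + n` variables `z, w, x`. -/
def xIdx (a b n : ℕ) (i : Fin n) : Fin (a+b+n) := ⟨a + b + i.1, by have := i.2; omega⟩

/-- `L_g(y; z_1,…,z_a; w_1,…,w_b; x_1,…,x_n)
 = Σ_{g'=0}^{g} Σ_{I⊔J={1,…,n}} F_{g'}(y, z, x_I) F_{g−g'}(−y, w, x_J)`,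
as a Laurent series in `t = y⁻¹` with coefficients in `ℚ[z,w,x]`. -/
def LLm (g n a b : ℕ) : Lau (a+b+n) :=
  ∑ gp ∈ Finset.range (g+1), ∑ I : Finset (Fin n),
    FExp true gp ((univ.image (zIdx a b n)) ∪ I.image (xIdx a b n)) *
    FExp false (g - gp) ((univ.image (wIdx a b n)) ∪ Iᶜ.image (xIdx a b n))

/-- The exponent vector of the monomial `Π z_j^{r_j} Π w_j^{s_j} Π x_j^{d_j}`. -/
def expVec (a b n : ℕ) (r : Fin a → ℕ) (s : Fin b → ℕ) (d : Fin n → ℕ) :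
    Fin (a+b+n) → ℕ :=
  fun v =>
    if h : v.1 < a then r ⟨v.1, h⟩
    else if h2 : v.1 < a + b then s ⟨v.1 - a, by omega⟩
    else d ⟨v.1 - (a+b), by have := v.2; omega⟩

section SubsetConvolution

variable {ι M : Type*} [DecidableEq ι] [AddCommMonoid M]

lemma sum_powerset_compl (A : Finset ι) (f : Finset ι → Finset ι → M) :
    ∑ I ∈ A.powerset, f I (A \ I) = ∑ I ∈ A.powerset, f (A \ I) I := by
  refine Finset.sum_nbij' (fun I => A \ I) (fun I => A \ I) ?_ ?_ ?_ ?_ ?_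
  · intro I _; simp
  · intro I _; simp
  · intro I hI; simpa using Finset.mem_powerset.1 hI
  · intro I hI; simpa using Finset.mem_powerset.1 hI
  · intro I hI
    rw [Finset.sdiff_sdiff_eq_self (Finset.mem_powerset.1 hI)]

lemma sum_powerset_assoc (A : Finset ι) (f : Finset ι → Finset ι → Finset ι → M) :
    ∑ I ∈ A.powerset, ∑ B ∈ I.powerset, f B (I \ B) (A \ I) =
      ∑ B ∈ A.powerset, ∑ I ∈ (A \ B).powerset, f B I ((A \ B) \ I) := by
  rw [Finset.sum_sigma', Finset.sum_sigma']
  refine Finset.sum_nbij' (fun p => ⟨p.2, p.1 \ p.2⟩) (fun p => ⟨p.1 ∪ p.2, p.1⟩) ?_ ?_ ?_ ?_ ?_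
  · rintro ⟨I, B⟩ h
    simp only [mem_sigma, mem_powerset] at h ⊢
    exact ⟨h.2.trans h.1, Finset.sdiff_subset_sdiff h.1 le_rfl⟩
  · rintro ⟨B, I⟩ h
    simp only [mem_sigma, mem_powerset] at h ⊢
    exact ⟨Finset.union_subset h.1 (h.2.trans Finset.sdiff_subset), Finset.subset_union_left⟩
  · rintro ⟨I, B⟩ h
    simp only [mem_sigma, mem_powerset] at h
    simp [Finset.union_sdiff_of_subset h.2]
  · rintro ⟨B, I⟩ h
    simp only [mem_sigma, mem_powerset, subset_sdiff] at h
    simp [Finset.union_sdiff_cancel_left h.2.2.symm]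
  · rintro ⟨I, B⟩ h
    simp only [mem_sigma, mem_powerset] at h
    congr 1
    ext i
    have := @h.2 i
    simp only [mem_sdiff]
    tauto

end SubsetConvolution

section VarSum

variable {ι C : Type*} [CommRing C]

/-- The partial sum of the variables in `A`. -/
def varSum (x : ι → C) (A : Finset ι) : C := ∑ i ∈ A, x i

lemma varSum_empty (x : ι → C) : varSum x ∅ = 0 := by simp [varSum]

lemma varSum_insert [DecidableEq ι] (x : ι → C) {i : ι} {A : Finset ι} (hi : i ∉ A) :
    varSum x (insert i A) = x i + varSum x A := by simp [varSum, hi]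

lemma varSum_add_sdiff [DecidableEq ι] (x : ι → C) {I A : Finset ι} (h : I ⊆ A) :
    varSum x I + varSum x (A \ I) = varSum x A := by
  rw [add_comm]; exact Finset.sum_sdiff h

end VarSum

section Recursion

variable {ι C : Type*} [DecidableEq ι] [CommRing C] [Algebra ℚ C]

/-- The polynomial `(∑ x_i)² F_g(x_A)`, computed by a division-free recursion. -/
def secondDer (x : ι → C) (g : ℕ) (A : Finset ι) : C :=
  if g = 0 ∧ A.card = 1 then 1 else
  algebraMap ℚ C (1 / (2 * g + A.card - 1)) *
    (algebraMap ℚ C (1 / 12) * varSum x A ^ 3 *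
        (if _h : g = 0 then 0 else secondDer x (g - 1) A) +
      algebraMap ℚ C (1 / 2) * varSum x A * ∑ I ∈ A.ssubsets.attach,
        if _h : I.1 = ∅ then 0 else
          ∑ p ∈ (antidiagonal g).attach,
            secondDer x p.1.1 I.1 * secondDer x p.1.2 (A \ I.1))
termination_by g + A.card
decreasing_by
  · omega
  · have h1 := Finset.card_lt_card (Finset.mem_ssubsets.1 I.2)
    have h2 := mem_antidiagonal.1 p.2
    omega
  · have h1 := Finset.mem_ssubsets.1 I.2
    have h2 := mem_antidiagonal.1 p.2
    have h3 : 0 < I.1.card := Finset.card_pos.2 (Finset.nonempty_iff_ne_empty.2 _h)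
    have h4 := Finset.card_sdiff_add_card_eq_card h1.1
    omega

lemma natCast_mul_cancel {m : ℕ} (hm : m ≠ 0) {a b : C} (h : (m : C) * a = m * b) : a = b := by
  have hu : IsUnit ((m : ℚ)) := isUnit_iff_ne_zero.2 (Nat.cast_ne_zero.2 hm)
  have := hu.map (algebraMap ℚ C)
  rw [map_natCast] at this
  exact this.mul_left_cancel h

lemma secondDer_empty (x : ι → C) (g : ℕ) : secondDer x g ∅ = 0 := by
  rw [secondDer]; simp [varSum_empty]

lemma secondDer_zero_singleton (x : ι → C) (i : ι) : secondDer x 0 {i} = 1 := by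
  rw [secondDer]; simp

lemma secondDer_rec (x : ι → C) (g : ℕ) (A : Finset ι) :
    (2 * g + A.card - 1 : C) * secondDer x g A =
      algebraMap ℚ C (1 / 12) * varSum x A ^ 3 * (if g = 0 then 0 else secondDer x (g - 1) A) +
      algebraMap ℚ C (1 / 2) * varSum x A * ∑ I ∈ A.powerset, ∑ p ∈ antidiagonal g,
            secondDer x p.1 I * secondDer x p.2 (A \ I) := by
  have hs : ∑ I ∈ A.powerset, ∑ p ∈ antidiagonal g,
      secondDer x p.1 I * secondDer x p.2 (A \ I) =
      ∑ I ∈ A.ssubsets.attach,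
        if _h : I.1 = ∅ then 0 else
          ∑ p ∈ (antidiagonal g).attach,
            secondDer x p.1.1 I.1 * secondDer x p.1.2 (A \ I.1) := by
    rw [Finset.sum_attach A.ssubsets (fun I => if _h : I = ∅ then 0 else
          ∑ p ∈ (antidiagonal g).attach,
            secondDer x p.1.1 I * secondDer x p.1.2 (A \ I))]
    symm
    apply Finset.sum_subset_zero_on_sdiff
    · exact fun I hI => Finset.mem_powerset.2 (Finset.mem_ssubsets.1 hI).1
    · intro I hI
      simp only [mem_sdiff, mem_powerset, mem_ssubsets, ssubset_iff_subset_ne] at hI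
      have : I = A := by tauto
      subst this
      simp [secondDer_empty]
    · intro I hI
      split_ifs with h
      · subst h; simp [secondDer_empty]
      · exact Finset.sum_attach (antidiagonal g) (fun p =>
            secondDer x p.1 I * secondDer x p.2 (A \ I))
  by_cases h1 : g = 0 ∧ A.card = 1
  · obtain ⟨h0, h1⟩ := h1
    obtain ⟨i, rfl⟩ := Finset.card_eq_one.1 h1
    subst h0
    have hz : ∑ I ∈ ({i} : Finset ι).powerset, ∑ p ∈ antidiagonal 0,
      secondDer x p.1 I * secondDer x p.2 ({i} \ I) = 0 := by
      apply Finset.sum_eq_zero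
      intro I hI
      rcases Finset.subset_singleton_iff.1 (Finset.mem_powerset.1 hI) with rfl | rfl <;>
        simp [secondDer_empty]
    rw [hz]; simp
  · rcases A.eq_empty_or_nonempty with rfl | hA
    · simp [secondDer_empty]
    have hc : (2 * g + A.card - 1 : ℚ) ≠ 0 := by
      have : 0 < A.card := Finset.card_pos.2 hA
      have h2 : 2 * g + A.card ≠ 1 := by omega
      intro h
      apply h2
      have : (2 * g + A.card : ℚ) = 1 := by linarith
      exact_mod_cast this
    have hcC : (2 * g + A.card - 1 : C) = algebraMap ℚ C (2 * g + A.card - 1) := by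
      simp only [map_sub, map_add, map_mul, map_natCast, map_one, map_ofNat]
    rw [hs]
    conv_lhs => rw [secondDer]
    rw [if_neg h1, hcC, ← mul_assoc, ← map_mul, mul_one_div_cancel hc, map_one, one_mul]
    simp only [dite_eq_ite]

/-- The generating series `∑_g λ^g (∑ x_i)² F_g(x_A)`. -/
def secondDerSeries (x : ι → C) (A : Finset ι) : PowerSeries C :=
  PowerSeries.mk fun g => secondDer x g A

/-- The operator multiplying the coefficient of `λ^g` by `2g`. -/
def genusOp : Derivation C (PowerSeries C) (PowerSeries C) :=
  (2 * PowerSeries.X : PowerSeries C) • PowerSeries.derivative C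

lemma coeff_genusOp (f : PowerSeries C) (g : ℕ) :
    PowerSeries.coeff g (genusOp f) = 2 * g * PowerSeries.coeff g f := by
  have : genusOp f = PowerSeries.C 2 * (PowerSeries.X * PowerSeries.derivative C f) := by
    rw [map_ofNat]; simp [genusOp, mul_assoc]
  rw [this, PowerSeries.coeff_C_mul]
  cases g with
  | zero => simp
  | succ g =>
    rw [PowerSeries.coeff_succ_X_mul, PowerSeries.coeff_derivative]
    push_cast; ring

lemma secondDerSeries_empty (x : ι → C) : secondDerSeries x ∅ = 0 := by
  ext g; simp [secondDerSeries, secondDer_empty]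

lemma secondDerSeries_rec (x : ι → C) (A : Finset ι) :
    genusOp (secondDerSeries x A) + (A.card - 1 : PowerSeries C) * secondDerSeries x A =
      PowerSeries.X * PowerSeries.C (algebraMap ℚ C (1 / 12) * varSum x A ^ 3) *
        secondDerSeries x A +
      PowerSeries.C (algebraMap ℚ C (1 / 2) * varSum x A) *
        ∑ I ∈ A.powerset, secondDerSeries x I * secondDerSeries x (A \ I) := by
  ext g
  have h := secondDer_rec x g A
  have e : (A.card - 1 : PowerSeries C) = PowerSeries.C (A.card - 1 : C) := by simp
  rw [e, map_add, coeff_genusOp, PowerSeries.coeff_C_mul, map_add, PowerSeries.coeff_C_mul,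
    map_sum, mul_assoc PowerSeries.X]
  have h3 : PowerSeries.coeff g (PowerSeries.X *
      (PowerSeries.C (algebraMap ℚ C (1 / 12) * varSum x A ^ 3) * secondDerSeries x A)) =
      algebraMap ℚ C (1 / 12) * varSum x A ^ 3 *
        (if g = 0 then 0 else secondDer x (g - 1) A) := by
    cases g with
    | zero => simp
    | succ g => rw [PowerSeries.coeff_succ_X_mul, PowerSeries.coeff_C_mul]; simp [secondDerSeries]
  rw [h3]
  simp only [PowerSeries.coeff_mul, secondDerSeries, PowerSeries.coeff_mk]
  rw [← h]; ring

end Recursion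

section Naturality

variable {ι ι' C C' : Type*} [DecidableEq ι] [DecidableEq ι'] [CommRing C] [Algebra ℚ C]
  [CommRing C'] [Algebra ℚ C']

lemma sum_powerset_map {M : Type*} [AddCommMonoid M] (e : ι ↪ ι') (A : Finset ι)
    (f : Finset ι' → Finset ι' → M) :
    ∑ I ∈ (A.map e).powerset, f I (A.map e \ I) =
      ∑ I ∈ A.powerset, f (I.map e) ((A \ I).map e) := by
  symm
  refine Finset.sum_bij (fun I _ => I.map e) ?_ ?_ ?_ ?_
  · intro I hI; simpa using hI
  · intro I _ J _ h; exact Finset.map_injective e h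
  · intro J hJ
    obtain ⟨I, hI, rfl⟩ := Finset.subset_map_iff.1 (Finset.mem_powerset.1 hJ)
    exact ⟨I, Finset.mem_powerset.2 hI, rfl⟩
  · intro I _; rw [Finset.map_sdiff]

lemma map_varSum (φ : C →+* C') (e : ι ↪ ι') {x : ι → C} {x' : ι' → C'} {A : Finset ι}
    (h : ∀ i ∈ A, φ (x i) = x' (e i)) : φ (varSum x A) = varSum x' (A.map e) := by
  simp only [varSum, map_sum, Finset.sum_map]
  exact Finset.sum_congr rfl h

lemma natCast_sub_one_mul_cancel {m : ℕ} (hm : m ≠ 1) {a b : C}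
    (h : ((m : C) - 1) * a = (m - 1) * b) : a = b := by
  rcases Nat.lt_or_gt_of_ne hm with h0 | h0
  · obtain rfl : m = 0 := by omega
    simpa using h
  · obtain ⟨k, rfl⟩ : ∃ k, m = k + 2 := ⟨m - 2, by omega⟩
    refine natCast_mul_cancel (m := k + 1) (by omega) ?_
    push_cast at h ⊢
    linear_combination h

lemma map_secondDer (φ : C →+* C') (e : ι ↪ ι') {x : ι → C} {x' : ι' → C'} (g : ℕ) :
    ∀ {A : Finset ι}, (∀ i ∈ A, φ (x i) = x' (e i)) →
      φ (secondDer x g A) = secondDer x' g (A.map e) := by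
  suffices H : ∀ (N g : ℕ) (A : Finset ι), g + A.card ≤ N → (∀ i ∈ A, φ (x i) = x' (e i)) →
      φ (secondDer x g A) = secondDer x' g (A.map e) from
    fun {A} h => H _ g A le_rfl h
  intro N
  induction N with
  | zero =>
    intro g A hN h
    obtain rfl : A = ∅ := Finset.card_eq_zero.1 (by omega)
    simp [secondDer_empty]
  | succ N ih =>
    intro g A hN h
    by_cases hA : g = 0 ∧ A.card = 1
    · obtain ⟨rfl, h1⟩ := hA
      obtain ⟨i, rfl⟩ := Finset.card_eq_one.1 h1
      simp [secondDer_zero_singleton]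
    have hm : 2 * g + A.card ≠ 1 := by omega
    refine natCast_sub_one_mul_cancel hm ?_
    have r1 := congrArg φ (secondDer_rec x g A)
    have r2 := secondDer_rec x' g (A.map e)
    simp only [Finset.card_map] at r2
    rw [sum_powerset_map e A (fun I J => ∑ p ∈ antidiagonal g,
            secondDer x' p.1 I * secondDer x' p.2 J)] at r2
    simp only [map_mul, map_add, map_sub, map_ofNat, map_natCast, map_one, map_pow,
      RingHom.map_rat_algebraMap, map_sum, map_varSum φ e h] at r1
    push_cast
    rw [r1, r2]
    congr 1
    · congr 1
      split_ifs with h0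
      · simp
      · exact ih _ _ (by omega) h
    · congr 1
      refine Finset.sum_congr rfl fun I hI => Finset.sum_congr rfl fun p hp => ?_
      have hI := Finset.mem_powerset.1 hI
      have hp := mem_antidiagonal.1 hp
      have hc := Finset.card_sdiff_add_card_eq_card hI
      rcases I.eq_empty_or_nonempty with rfl | hI0
      · simp [secondDer_empty]
      rcases (A \ I).eq_empty_or_nonempty with hI1 | hI1
      · simp [hI1, secondDer_empty]
      have := Finset.card_pos.2 hI0
      have := Finset.card_pos.2 hI1
      rw [ih _ _ (by omega) fun i hi => h i (hI hi),
        ih _ _ (by omega) fun i hi => h i (Finset.sdiff_subset hi)]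

end Naturality

section Conservation

variable {ι C : Type*} [DecidableEq ι] [CommRing C] [Algebra ℚ C]

lemma three_mul_sum_triple (x : ι → C) (u : Finset ι → PowerSeries C) (A : Finset ι) :
    3 * ∑ I ∈ A.powerset, PowerSeries.C (varSum x I) * (∑ B ∈ I.powerset, u B * u (I \ B)) * u (A \ I) =
      2 * (PowerSeries.C (varSum x A) *
        ∑ I ∈ A.powerset, (∑ B ∈ I.powerset, u B * u (I \ B)) * u (A \ I)) := by
  set T1 := ∑ I ∈ A.powerset, ∑ B ∈ I.powerset,
    PowerSeries.C (varSum x B) * u B * u (I \ B) * u (A \ I) with hT1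
  set T2 := ∑ I ∈ A.powerset, ∑ B ∈ I.powerset,
    PowerSeries.C (varSum x (I \ B)) * u B * u (I \ B) * u (A \ I) with hT2
  set T3 := ∑ I ∈ A.powerset, ∑ B ∈ I.powerset,
    PowerSeries.C (varSum x (A \ I)) * u B * u (I \ B) * u (A \ I) with hT3
  have h12 : T1 = T2 := by
    refine Finset.sum_congr rfl fun I _ => ?_
    rw [sum_powerset_compl I (fun B B' => PowerSeries.C (varSum x B) * u B * u B' * u (A \ I))]
    exact Finset.sum_congr rfl fun B _ => by ring
  have h13 : T1 = T3 := by
    rw [hT1, hT3, sum_powerset_assoc A (fun B B' J => PowerSeries.C (varSum x B) * u B * u B' * u J)]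
    simp only [← Finset.mul_sum, mul_assoc]
    rw [sum_powerset_compl A (fun I J => PowerSeries.C (varSum x I) * (u I * ∑ B ∈ J.powerset,
      u B * u (J \ B)))]
    refine Finset.sum_congr rfl fun I hI => ?_
    simp only [Finset.mul_sum]
    exact Finset.sum_congr rfl fun B _ => by ring
  have hL : ∑ I ∈ A.powerset, PowerSeries.C (varSum x I) * (∑ B ∈ I.powerset, u B * u (I \ B)) * u (A \ I)
      = T1 + T2 := by
    rw [hT1, hT2, ← Finset.sum_add_distrib]
    refine Finset.sum_congr rfl fun I hI => ?_
    rw [← Finset.sum_add_distrib, Finset.mul_sum, Finset.sum_mul]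
    refine Finset.sum_congr rfl fun B hB => ?_
    rw [← varSum_add_sdiff x (Finset.mem_powerset.1 hB), map_add]
    ring
  have hR : PowerSeries.C (varSum x A) *
        ∑ I ∈ A.powerset, (∑ B ∈ I.powerset, u B * u (I \ B)) * u (A \ I) = T1 + T2 + T3 := by
    rw [hT3, ← hL, ← Finset.sum_add_distrib, Finset.mul_sum]
    refine Finset.sum_congr rfl fun I hI => ?_
    rw [← varSum_add_sdiff x (Finset.mem_powerset.1 hI), map_add]
    simp only [Finset.mul_sum, Finset.sum_mul, ← Finset.sum_add_distrib]
    exact Finset.sum_congr rfl fun B _ => by ring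
  rw [hL, hR, ← h13, ← h12]; ring

lemma conservation (x : ι → C) (A : Finset ι) :
    ∃ V : PowerSeries C,
      genusOp (∑ I ∈ A.powerset, secondDerSeries x I * secondDerSeries x (A \ I)) +
        (A.card - 2 : PowerSeries C) *
          (∑ I ∈ A.powerset, secondDerSeries x I * secondDerSeries x (A \ I)) =
        PowerSeries.C (varSum x A) * V := by
  set u := secondDerSeries x with hu
  set Q : PowerSeries C := ∑ I ∈ A.powerset,
    PowerSeries.C (varSum x I ^ 2 - varSum x I * varSum x (A \ I) + varSum x (A \ I) ^ 2) * u I * u (A \ I)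
  set T := ∑ I ∈ A.powerset, (∑ B ∈ I.powerset, u B * u (I \ B)) * u (A \ I) with hT
  refine ⟨PowerSeries.X * PowerSeries.C (algebraMap ℚ C (1 / 12)) * Q + PowerSeries.C (algebraMap ℚ C (2 / 3)) * T, ?_⟩
  have h1 : genusOp (∑ I ∈ A.powerset, u I * u (A \ I)) +
        (A.card - 2 : PowerSeries C) * (∑ I ∈ A.powerset, u I * u (A \ I)) =
      ∑ I ∈ A.powerset, (genusOp (u I) + (I.card - 1 : PowerSeries C) * u I) * u (A \ I) +
      ∑ I ∈ A.powerset, u I *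
        (genusOp (u (A \ I)) + ((A \ I).card - 1 : PowerSeries C) * u (A \ I)) := by
    rw [map_sum, Finset.mul_sum, ← Finset.sum_add_distrib, ← Finset.sum_add_distrib]
    refine Finset.sum_congr rfl fun I hI => ?_
    rw [Derivation.leibniz, ← Finset.card_sdiff_add_card_eq_card (Finset.mem_powerset.1 hI)]
    push_cast
    simp only [smul_eq_mul]
    ring
  have h2 : ∑ I ∈ A.powerset, (genusOp (u I) + (I.card - 1 : PowerSeries C) * u I) * u (A \ I) =
      ∑ I ∈ A.powerset, u I *
        (genusOp (u (A \ I)) + ((A \ I).card - 1 : PowerSeries C) * u (A \ I)) := by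
    rw [sum_powerset_compl A (fun I J => (genusOp (u I) + (I.card - 1 : PowerSeries C) * u I) * u J)]
    exact Finset.sum_congr rfl fun I _ => by ring
  have h3 : ∑ I ∈ A.powerset, (genusOp (u I) + (I.card - 1 : PowerSeries C) * u I) * u (A \ I) =
      PowerSeries.X * PowerSeries.C (algebraMap ℚ C (1 / 12)) *
        ∑ I ∈ A.powerset, PowerSeries.C (varSum x I ^ 3) * u I * u (A \ I) +
      PowerSeries.C (algebraMap ℚ C (1 / 2)) * ∑ I ∈ A.powerset,
        PowerSeries.C (varSum x I) * (∑ B ∈ I.powerset, u B * u (I \ B)) * u (A \ I) := by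
    rw [Finset.mul_sum, Finset.mul_sum, ← Finset.sum_add_distrib]
    refine Finset.sum_congr rfl fun I _ => ?_
    rw [hu, secondDerSeries_rec, map_mul, map_mul]
    ring
  have h4 : 2 * ∑ I ∈ A.powerset, PowerSeries.C (varSum x I ^ 3) * u I * u (A \ I) =
      PowerSeries.C (varSum x A) * Q := by
    rw [two_mul]
    nth_rw 2 [sum_powerset_compl A (fun I J => PowerSeries.C (varSum x I ^ 3) * u I * u J)]
    rw [← Finset.sum_add_distrib, Finset.mul_sum]
    refine Finset.sum_congr rfl fun I hI => ?_
    rw [← varSum_add_sdiff x (Finset.mem_powerset.1 hI)]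
    simp only [map_add, map_sub, map_mul, map_pow]
    ring
  have h5 := three_mul_sum_triple x u A
  have h6 : (3 : PowerSeries C) * PowerSeries.C (algebraMap ℚ C (1 / 3)) = 1 := by
    rw [← map_ofNat PowerSeries.C 3, ← map_mul, ← map_ofNat (algebraMap ℚ C) 3, ← map_mul]
    norm_num
  have h7 : (2 : PowerSeries C) * PowerSeries.C (algebraMap ℚ C (1 / 2)) = 1 := by
    rw [← map_ofNat PowerSeries.C 2, ← map_mul, ← map_ofNat (algebraMap ℚ C) 2, ← map_mul]
    norm_num
  have h8 : PowerSeries.C (algebraMap ℚ C (2 / 3)) = (2 : PowerSeries C) * PowerSeries.C (algebraMap ℚ C (1 / 3)) := by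
    rw [← map_ofNat PowerSeries.C 2, ← map_mul, ← map_ofNat (algebraMap ℚ C) 2, ← map_mul]
    norm_num
  rw [h1, ← h2, h3, h8]
  set Z := ∑ I ∈ A.powerset, PowerSeries.C (varSum x I) * (∑ B ∈ I.powerset, u B * u (I \ B)) * u (A \ I)
  linear_combination (PowerSeries.X * PowerSeries.C (algebraMap ℚ C (1 / 12))) * h4 +
    PowerSeries.C (algebraMap ℚ C (1 / 3)) * h5 + Z * h7 - Z * h6

/-- Away from the unstable range `(∑ x_i)²` divides `secondDer`. -/
lemma exists_varSum_sq_mul (x : ι → C) {g : ℕ} {A : Finset ι} (hgA : 3 ≤ 2 * g + A.card) :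
    ∃ q : C, varSum x A ^ 2 * q = secondDer x g A := by
  obtain ⟨V, hV⟩ := conservation x A
  set W : PowerSeries C := ∑ I ∈ A.powerset, secondDerSeries x I * secondDerSeries x (A \ I)
    with hW
  obtain ⟨m, hm⟩ : ∃ m, 2 * g + A.card = m + 3 := ⟨2 * g + A.card - 3, by omega⟩
  have hmC : (2 * g + A.card : C) = m + 3 := by exact_mod_cast congrArg (Nat.cast (R := C)) hm
  have hWg : ((m + 1 : ℕ) : C) * PowerSeries.coeff g W =
      varSum x A * PowerSeries.coeff g V := by
    have := congrArg (PowerSeries.coeff g) hV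
    have e : (A.card - 2 : PowerSeries C) = PowerSeries.C (A.card - 2 : C) := by
      rw [map_sub, map_natCast, map_ofNat]
    rw [e, map_add, coeff_genusOp, PowerSeries.coeff_C_mul, PowerSeries.coeff_C_mul] at this
    rw [← this]
    push_cast
    linear_combination (-PowerSeries.coeff g W) * hmC
  have hq : ∀ k : ℕ, k ≠ 0 → (k : C) * algebraMap ℚ C (1 / k) = 1 := by
    intro k hk
    rw [← map_natCast (algebraMap ℚ C), ← map_mul, mul_one_div_cancel (by exact_mod_cast hk),
      map_one]
  have h1 := hq (m + 1) (by omega)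
  have h2 := hq (m + 2) (by omega)
  set c1 := algebraMap ℚ C (1 / (m + 1 : ℕ))
  set c2 := algebraMap ℚ C (1 / (m + 2 : ℕ))
  have hrec := secondDer_rec x g A
  have hWg' : PowerSeries.coeff g W = ∑ I ∈ A.powerset, ∑ p ∈ antidiagonal g,
            secondDer x p.1 I * secondDer x p.2 (A \ I) := by
    simp [hW, PowerSeries.coeff_mul, secondDerSeries]
  rw [← hWg'] at hrec
  have hW2 : PowerSeries.coeff g W = varSum x A * (c1 * PowerSeries.coeff g V) := by
    linear_combination c1 * hWg - PowerSeries.coeff g W * h1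
  refine ⟨c2 * (algebraMap ℚ C (1 / 12) * varSum x A *
    (if g = 0 then 0 else secondDer x (g - 1) A) +
    algebraMap ℚ C (1 / 2) * (c1 * PowerSeries.coeff g V)), ?_⟩
  rw [hW2] at hrec
  push_cast at h2
  linear_combination (-c2) * hrec + c2 * secondDer x g A * hmC + secondDer x g A * h2

end Conservation

section GenusZero

variable {ι C : Type*} [DecidableEq ι] [CommRing C] [Algebra ℚ C]

lemma sum_powerset_insert_compl {M : Type*} [AddCommMonoid M] {i : ι} {A : Finset ι}
    (hi : i ∉ A) (f : Finset ι → Finset ι → M) :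
    ∑ I ∈ (insert i A).powerset, f I (insert i A \ I) =
      ∑ I ∈ A.powerset, f I (insert i (A \ I)) + ∑ I ∈ A.powerset, f (insert i I) (A \ I) := by
  rw [Finset.sum_powerset_insert hi]
  congr 1 <;> refine Finset.sum_congr rfl fun I hI => ?_
  · rw [Finset.insert_sdiff_of_notMem _ (fun h => hi (Finset.mem_powerset.1 hI h))]
  · rw [Finset.insert_sdiff_insert, Finset.sdiff_insert_of_notMem hi]

lemma secondDer_zero_rec (x : ι → C) (A : Finset ι) :
    (A.card - 1 : C) * secondDer x 0 A =
      algebraMap ℚ C (1 / 2) * varSum x A * ∑ I ∈ A.powerset,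
            secondDer x 0 I * secondDer x 0 (A \ I) := by
  have := secondDer_rec x 0 A
  simpa using this

lemma algebraMap_half_mul_two : algebraMap ℚ C (1 / 2) * 2 = 1 := by
  rw [← map_ofNat (algebraMap ℚ C) 2, ← map_mul]
  norm_num

/-- The string equation in genus zero. -/
lemma secondDer_zero_insert (x : ι → C) {i : ι} (hx : x i = 0) (A : Finset ι) (hi : i ∉ A) :
    secondDer x 0 (insert i A) = if A = ∅ then 1 else varSum x A * secondDer x 0 A := by
  induction A using Finset.strongInduction with
  | H A ih =>
    rcases A.eq_empty_or_nonempty with rfl | hA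
    · simp [secondDer_zero_singleton]
    rw [if_neg hA.ne_empty]
    refine natCast_mul_cancel (m := A.card) hA.card_pos.ne' ?_
    have h1 := secondDer_zero_rec x (insert i A)
    rw [sum_powerset_insert_compl hi (fun I J => secondDer x 0 I * secondDer x 0 J),
      varSum_insert x hi, hx, zero_add, Finset.card_insert_of_notMem hi] at h1
    rw [sum_powerset_compl A (fun I J => secondDer x 0 I * secondDer x 0 (insert i J))] at h1
    have h2 : ∀ I ∈ A.powerset, secondDer x 0 (A \ I) * secondDer x 0 (insert i I) =
        varSum x I * secondDer x 0 I * secondDer x 0 (A \ I) +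
          if I = ∅ then secondDer x 0 A else 0 := by
      intro I hI
      rcases I.eq_empty_or_nonempty with rfl | hI0
      · simp [secondDer_empty, secondDer_zero_singleton]
      rcases (Finset.mem_powerset.1 hI).eq_or_ssubset with rfl | hIA
      · simp [secondDer_empty, hI0.ne_empty]
      rw [ih I hIA (fun h => hi (hIA.1 h)), if_neg hI0.ne_empty, if_neg hI0.ne_empty]
      ring
    have h3 : ∑ I ∈ A.powerset, secondDer x 0 (A \ I) * secondDer x 0 (insert i I) =
        ∑ I ∈ A.powerset, varSum x I * secondDer x 0 I * secondDer x 0 (A \ I) +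
          secondDer x 0 A := by
      rw [Finset.sum_congr rfl h2, Finset.sum_add_distrib, Finset.sum_ite_eq']
      simp
    have h4 : ∑ I ∈ A.powerset, secondDer x 0 (insert i I) * secondDer x 0 (A \ I) =
        ∑ I ∈ A.powerset, secondDer x 0 (A \ I) * secondDer x 0 (insert i I) :=
      Finset.sum_congr rfl fun I _ => mul_comm _ _
    have h5 : 2 * ∑ I ∈ A.powerset, varSum x I * secondDer x 0 I * secondDer x 0 (A \ I) =
        varSum x A * ∑ I ∈ A.powerset, secondDer x 0 I * secondDer x 0 (A \ I) := by
      rw [two_mul]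
      nth_rw 2 [sum_powerset_compl A
        (fun I J => varSum x I * secondDer x 0 I * secondDer x 0 J)]
      rw [← Finset.sum_add_distrib, Finset.mul_sum]
      refine Finset.sum_congr rfl fun I hI => ?_
      rw [← varSum_add_sdiff x (Finset.mem_powerset.1 hI)]
      ring
    have h6 := secondDer_zero_rec x A
    have h7 := algebraMap_half_mul_two (C := C)
    rw [h4, h3] at h1
    push_cast at h1
    set Q := ∑ I ∈ A.powerset, secondDer x 0 I * secondDer x 0 (A \ I)
    linear_combination h1 - varSum x A * h6 + algebraMap ℚ C (1 / 2) * varSum x A * h5 +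
      varSum x A * secondDer x 0 A * h7

end GenusZero

section Degree

variable {k : Type*} [Field k]

/-- Laurent series in `y⁻¹` of `y`-degree at most `m`. -/
def degLE (k : Type*) [Field k] (m : ℤ) : AddSubgroup (LaurentSeries k) where
  carrier := {f | ∀ j : ℤ, j < -m → f.coeff j = 0}
  add_mem' {f g} hf hg j hj := by simp [hf j hj, hg j hj]
  zero_mem' j _ := by simp
  neg_mem' {f} hf j hj := by simp [hf j hj]

/-- The variable `y`, where `y⁻¹` is the uniformizer. -/
def yVar (k : Type*) [Field k] : LaurentSeries k := HahnSeries.single (-1 : ℤ) (1 : k)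

lemma mem_degLE {m : ℤ} {f : LaurentSeries k} :
    f ∈ degLE k m ↔ ∀ j : ℤ, j < -m → f.coeff j = 0 := Iff.rfl

lemma mem_degLE_iff_orderTop {m : ℤ} {f : LaurentSeries k} :
    f ∈ degLE k m ↔ ((-m : ℤ) : WithTop ℤ) ≤ f.orderTop := by
  rw [HahnSeries.le_orderTop_iff_forall, mem_degLE]
  simp only [WithTop.coe_lt_coe]

lemma degLE_mono {m n : ℤ} (h : m ≤ n) : degLE k m ≤ degLE k n :=
  fun _ hf j hj => hf j (by omega)

lemma mul_mem_degLE {m n : ℤ} {f g : LaurentSeries k} (hf : f ∈ degLE k m)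
    (hg : g ∈ degLE k n) : f * g ∈ degLE k (m + n) := by
  rw [mem_degLE_iff_orderTop] at *
  refine le_trans ?_ HahnSeries.orderTop_add_le_mul
  refine le_trans ?_ (add_le_add hf hg)
  rw [← WithTop.coe_add, WithTop.coe_le_coe]
  omega

lemma C_mem_degLE (c : k) : (HahnSeries.C c : LaurentSeries k) ∈ degLE k 0 := by
  intro j hj
  rw [HahnSeries.C_apply, HahnSeries.coeff_single_of_ne (by omega)]

lemma C_mul_mem_degLE {m : ℤ} (c : k) {f : LaurentSeries k} (hf : f ∈ degLE k m) :
    HahnSeries.C c * f ∈ degLE k m := by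
  simpa using mul_mem_degLE (C_mem_degLE c) hf

lemma yVar_ne_zero : yVar k ≠ 0 := by simp [yVar]

lemma yVar_zpow (m : ℤ) : yVar k ^ m = HahnSeries.single (-m) 1 := by
  have h1 : yVar k = (HahnSeries.single (1 : ℤ) (1 : k))⁻¹ := by simp [yVar]
  rw [h1, inv_zpow', ← RatFunc.single_zpow]

lemma yVar_zpow_mem (m : ℤ) : yVar k ^ m ∈ degLE k m := by
  intro j hj
  rw [yVar_zpow, HahnSeries.coeff_single_of_ne (by omega)]

lemma exists_mem_degLE (f : LaurentSeries k) : ∃ m, f ∈ degLE k m :=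
  ⟨-f.order, fun j hj => HahnSeries.coeff_eq_zero_of_lt_order (by omega)⟩

lemma orderTop_yVar_add_C (s : k) : (yVar k + HahnSeries.C s).orderTop = ((-1 : ℤ) : WithTop ℤ) := by
  have h : (yVar k).orderTop = ((-1 : ℤ) : WithTop ℤ) := by
    rw [yVar, HahnSeries.orderTop_single one_ne_zero]
  rw [HahnSeries.orderTop_add_eq_left, h]
  rw [h]
  refine lt_of_lt_of_le (b := ((0 : ℤ) : WithTop ℤ)) (by rw [WithTop.coe_lt_coe]; omega) ?_
  simpa using mem_degLE_iff_orderTop.1 (C_mem_degLE s)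

lemma yVar_add_C_ne_zero (s : k) : yVar k + HahnSeries.C s ≠ 0 := by
  intro h
  have := orderTop_yVar_add_C s
  rw [h] at this
  rw [HahnSeries.orderTop_zero] at this
  exact WithTop.top_ne_coe this

lemma neg_yVar_add_C_ne_zero (s : k) : -yVar k + HahnSeries.C s ≠ 0 := by
  intro h
  apply yVar_add_C_ne_zero (-s)
  rw [map_neg]
  linear_combination -h

lemma yVar_add_C_mem (s : k) : yVar k + HahnSeries.C s ∈ degLE k 1 := by
  rw [mem_degLE_iff_orderTop, orderTop_yVar_add_C]

lemma yVar_add_C_inv_mem (s : k) : (yVar k + HahnSeries.C s)⁻¹ ∈ degLE k (-1) := by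
  rw [mem_degLE_iff_orderTop]
  have h := HahnSeries.orderTop_mul (yVar k + HahnSeries.C s) (yVar k + HahnSeries.C s)⁻¹
  rw [mul_inv_cancel₀ (yVar_add_C_ne_zero s), HahnSeries.orderTop_one, orderTop_yVar_add_C] at h
  cases ho : ((yVar k + HahnSeries.C s)⁻¹).orderTop with
  | top => exact le_top
  | coe a =>
    rw [ho, ← WithTop.coe_add, ← WithTop.coe_zero, WithTop.coe_inj] at h
    rw [WithTop.coe_le_coe]
    omega

lemma pow_mem_degLE {m : ℤ} {f : LaurentSeries k} (hf : f ∈ degLE k m) (n : ℕ) :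
    f ^ n ∈ degLE k (n * m) := by
  induction n with
  | zero => simpa using C_mem_degLE (1 : k)
  | succ n ih =>
    rw [pow_succ]
    convert mul_mem_degLE ih hf using 2
    push_cast; ring

lemma yVar_add_C_zpow_mem (s : k) (d : ℤ) : (yVar k + HahnSeries.C s) ^ d ∈ degLE k d := by
  obtain ⟨n, rfl | rfl⟩ := d.eq_nat_or_neg
  · rw [zpow_natCast]
    simpa using pow_mem_degLE (yVar_add_C_mem s) n
  · rw [zpow_neg, zpow_natCast, ← inv_pow]
    simpa using pow_mem_degLE (yVar_add_C_inv_mem s) n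

end Degree

section Asymptotics

variable {α k : Type*} [Field k]

/-- The sum `∑ (y + s_I)^d w_I` has leading term `ℓ(d) y^(e+d)` for every integer `d`. -/
def HasLeading (S : Finset α) (s : α → k) (w : α → LaurentSeries k) (e : ℤ) (ℓ : ℤ → k) : Prop :=
  ∀ d : ℤ, ∑ I ∈ S, (yVar k + HahnSeries.C (s I)) ^ d * w I -
    HahnSeries.C (ℓ d) * yVar k ^ (e + d) ∈ degLE k (e + d - 1)

variable {S : Finset α} {s : α → k} {w w' : α → LaurentSeries k} {e : ℤ} {ℓ ℓ' : ℤ → k}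

lemma HasLeading.add (h : HasLeading S s w e ℓ) (h' : HasLeading S s w' e ℓ') :
    HasLeading S s (fun I => w I + w' I) e (fun d => ℓ d + ℓ' d) := by
  intro d
  convert add_mem (h d) (h' d) using 1
  simp only [mul_add, Finset.sum_add_distrib, map_add]
  ring

lemma HasLeading.const_mul (c : k) (h : HasLeading S s w e ℓ) :
    HasLeading S s (fun I => HahnSeries.C c * w I) e (fun d => c * ℓ d) := by
  intro d
  convert C_mul_mem_degLE c (h d) using 1
  rw [mul_sub, Finset.mul_sum, map_mul]
  congr 1
  · exact Finset.sum_congr rfl fun I _ => by ring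
  · ring

lemma HasLeading.sub (h : HasLeading S s w e ℓ) (h' : HasLeading S s w' e ℓ') :
    HasLeading S s (fun I => w I - w' I) e (fun d => ℓ d - ℓ' d) := by
  intro d
  convert sub_mem (h d) (h' d) using 1
  simp only [mul_sub, Finset.sum_sub_distrib, map_sub]
  ring

lemma HasLeading.sum_mem (h : HasLeading S s w e ℓ) (d : ℤ) :
    ∑ I ∈ S, (yVar k + HahnSeries.C (s I)) ^ d * w I ∈ degLE k (e + d) := by
  have h1 := degLE_mono (show e + d - 1 ≤ e + d by omega) (h d)
  have h2 := C_mul_mem_degLE (ℓ d) (yVar_zpow_mem (k := k) (e + d))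
  simpa using add_mem h1 h2

lemma HasLeading.inv_mul (h : HasLeading S s w e ℓ) :
    HasLeading S s (fun I => (yVar k + HahnSeries.C (s I))⁻¹ * w I) e (fun _ => 0) := by
  intro d
  have := h.sum_mem (d - 1)
  rw [map_zero, zero_mul, sub_zero, add_sub_assoc]
  convert this using 1
  refine Finset.sum_congr rfl fun I _ => ?_
  rw [zpow_sub_one₀ (yVar_add_C_ne_zero _)]
  ring

lemma HasLeading.one_add_mul (β : k) (h : HasLeading S s w e ℓ) :
    HasLeading S s (fun I => (1 + HahnSeries.C β * (yVar k + HahnSeries.C (s I))⁻¹) * w I) e ℓ := by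
  convert h.add (h.inv_mul.const_mul β) using 1
  · funext I; ring
  · funext d; simp

lemma one_add_C_mul_inv_ne_zero (β t : k) :
    1 + HahnSeries.C β * (yVar k + HahnSeries.C t)⁻¹ ≠ 0 := by
  intro h
  have h1 := yVar_add_C_ne_zero t
  apply yVar_add_C_ne_zero (t + β)
  field_simp at h
  rw [map_add]
  linear_combination h

lemma HasLeading.one_add_inv_mul (β : k) (h : HasLeading S s w e ℓ) :
    HasLeading S s
      (fun I => (1 + HahnSeries.C β * (yVar k + HahnSeries.C (s I))⁻¹)⁻¹ * w I) e ℓ := by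
  set w' : α → LaurentSeries k :=
    fun I => (1 + HahnSeries.C β * (yVar k + HahnSeries.C (s I))⁻¹)⁻¹ * w I with hw'
  have hrel : ∀ d : ℤ, ∑ I ∈ S, (yVar k + HahnSeries.C (s I)) ^ d * w' I =
      ∑ I ∈ S, (yVar k + HahnSeries.C (s I)) ^ d * w I -
        HahnSeries.C β * ∑ I ∈ S, (yVar k + HahnSeries.C (s I)) ^ (d - 1) * w' I := by
    intro d
    rw [Finset.mul_sum, ← Finset.sum_sub_distrib]
    refine Finset.sum_congr rfl fun I _ => ?_
    have h1 := one_add_C_mul_inv_ne_zero β (s I)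
    have h2 : w I = (1 + HahnSeries.C β * (yVar k + HahnSeries.C (s I))⁻¹) * w' I := by
      rw [hw']; simp only; rw [mul_inv_cancel_left₀ h1]
    rw [h2, zpow_sub_one₀ (yVar_add_C_ne_zero _)]
    ring
  have hM : ∃ M : ℕ, ∀ d : ℤ,
      ∑ I ∈ S, (yVar k + HahnSeries.C (s I)) ^ d * w' I ∈ degLE k (e + d + M) := by
    choose m hm using fun I => exists_mem_degLE (w' I)
    refine ⟨(∑ I ∈ S, |m I - e|).toNat, fun d => AddSubgroup.sum_mem _ fun I hI => ?_⟩
    refine degLE_mono ?_ (mul_mem_degLE (yVar_add_C_zpow_mem (s I) d) (hm I))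
    have h1 : |m I - e| ≤ ∑ I ∈ S, |m I - e| :=
      Finset.single_le_sum (f := fun I => |m I - e|) (fun _ _ => abs_nonneg _) hI
    have h2 := le_abs_self (m I - e)
    have h3 := Int.self_le_toNat (∑ I ∈ S, |m I - e|)
    omega
  have h0 : ∀ d : ℤ, ∑ I ∈ S, (yVar k + HahnSeries.C (s I)) ^ d * w' I ∈ degLE k (e + d) := by
    obtain ⟨M, hM⟩ := hM
    induction M with
    | zero => simpa using hM
    | succ M ih =>
      apply ih
      intro d
      rw [hrel]
      refine sub_mem (degLE_mono (by omega) (h.sum_mem d)) ?_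
      refine degLE_mono ?_ (C_mul_mem_degLE β (hM (d - 1)))
      push_cast; omega
  intro d
  rw [hrel, sub_right_comm]
  exact sub_mem (h d) (degLE_mono (by omega) (C_mul_mem_degLE β (h0 (d - 1))))

lemma HasLeading.zpow_sub_one_mul (β : k) (h : HasLeading S s w e ℓ) (m : ℤ) :
    HasLeading S s (fun I => (yVar k + HahnSeries.C (s I)) *
      ((1 + HahnSeries.C β * (yVar k + HahnSeries.C (s I))⁻¹) ^ m - 1) * w I) e
      (fun d => m * β * ℓ d) := by
  induction m using Int.induction_on with
  | zero => intro d; simp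
  | succ m ih =>
    convert (h.const_mul β).add (ih.one_add_mul β) using 1
    · funext I
      have h1 := one_add_C_mul_inv_ne_zero β (s I)
      have h2 := yVar_add_C_ne_zero (s I)
      rw [zpow_add_one₀ h1]
      field_simp
      ring
    · funext d; push_cast; ring
  | pred m ih =>
    convert (ih.sub (h.const_mul β)).one_add_inv_mul β using 1
    · funext I
      have h1 := one_add_C_mul_inv_ne_zero β (s I)
      have h2 := yVar_add_C_ne_zero (s I)
      rw [zpow_sub_one₀ h1, eq_inv_mul_iff_mul_eq₀ h1]
      generalize (1 + HahnSeries.C β * (yVar k + HahnSeries.C (s I))⁻¹) ^ (-(m : ℤ)) = z at *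
      have h3 : (yVar k + HahnSeries.C (s I)) * (yVar k + HahnSeries.C (s I))⁻¹ = 1 :=
        mul_inv_cancel₀ h2
      have h4 := mul_inv_cancel₀ h1
      linear_combination (yVar k + HahnSeries.C (s I)) * z * w I * h4 -
        w I * HahnSeries.C β * h3
    · funext d; push_cast; ring

end Asymptotics

section InsertRecursion

variable {ι C : Type*} [DecidableEq ι] [CommRing C] [Algebra ℚ C]

lemma secondDerSeries_insert_rec (x : ι → C) {o : ι} {A : Finset ι} (ho : o ∉ A) :
    genusOp (secondDerSeries x (insert o A)) +
        (A.card : PowerSeries C) * secondDerSeries x (insert o A) =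
      PowerSeries.X * PowerSeries.C (algebraMap ℚ C (1 / 12) * varSum x (insert o A) ^ 3) *
        secondDerSeries x (insert o A) +
      PowerSeries.C (varSum x (insert o A)) *
        ∑ B ∈ A.powerset, secondDerSeries x B * secondDerSeries x (insert o (A \ B)) := by
  have h := secondDerSeries_rec x (insert o A)
  rw [sum_powerset_insert_compl ho (fun I J => secondDerSeries x I * secondDerSeries x J),
    sum_powerset_compl A (fun I J => secondDerSeries x (insert o I) * secondDerSeries x J),
    Finset.card_insert_of_notMem ho] at h
  have h2 : ∑ I ∈ A.powerset, secondDerSeries x (insert o (A \ I)) * secondDerSeries x I =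
      ∑ I ∈ A.powerset, secondDerSeries x I * secondDerSeries x (insert o (A \ I)) :=
    Finset.sum_congr rfl fun I _ => mul_comm _ _
  rw [h2] at h
  have h3 : PowerSeries.C (algebraMap ℚ C (1 / 2)) * 2 = 1 := by
    rw [← map_ofNat (PowerSeries.C (R := C)) 2, ← map_mul, algebraMap_half_mul_two, map_one]
  push_cast at h
  rw [map_mul (PowerSeries.C (R := C)) (algebraMap ℚ C (1 / 2))] at h
  linear_combination h + PowerSeries.C (varSum x (insert o A)) *
    (∑ I ∈ A.powerset, secondDerSeries x I * secondDerSeries x (insert o (A \ I))) * h3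

lemma secondDer_update (x : ι → C) {o : ι} {A : Finset ι} (ho : o ∉ A) (y : C) (g : ℕ) :
    secondDer (Function.update x o y) g A = secondDer x g A := by
  have := map_secondDer (RingHom.id C) (Function.Embedding.refl ι)
    (x := Function.update x o y) (x' := x) g (A := A) (by
      intro i hi
      simp [Function.update_of_ne (ne_of_mem_of_not_mem hi ho)])
  simpa using this

lemma varSum_update_insert (x : ι → C) {o : ι} {A : Finset ι} (ho : o ∉ A) (y : C) :
    varSum (Function.update x o y) (insert o A) = y + varSum x A := by
  rw [varSum_insert _ ho, Function.update_self]
  congr 1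
  exact Finset.sum_congr rfl fun i hi => Function.update_of_ne (ne_of_mem_of_not_mem hi ho) _ _

end InsertRecursion

section PairSum

variable {ι F : Type*} [DecidableEq ι] [Field F] [Algebra ℚ F]

/-- The sum over `g'` of `F_{g'}(y, x_I) F_{g-g'}(-y, x_{K \ I})`. -/
def pairWeight (x : ι → F) (o : ι) (y : F) (g : ℕ) (K I : Finset ι) : F :=
  (y + varSum x I) ^ (-2 : ℤ) * (-y + varSum x (K \ I)) ^ (-2 : ℤ) *
    ∑ p ∈ antidiagonal g, secondDer (Function.update x o y) p.1 (insert o I) *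
      secondDer (Function.update x o (-y)) p.2 (insert o (K \ I))

lemma coeff_pairSeries (x : ι → F) (o : ι) (y c : F) (g : ℕ) (K I : Finset ι)
    (hX : y + varSum x I ≠ 0) (hY : -y + varSum x (K \ I) ≠ 0) :
    PowerSeries.coeff g (PowerSeries.C c * (secondDerSeries (Function.update x o y) (insert o I) *
      secondDerSeries (Function.update x o (-y)) (insert o (K \ I)))) =
    c * (y + varSum x I) ^ 2 * (-y + varSum x (K \ I)) ^ 2 * pairWeight x o y g K I := by
  rw [PowerSeries.coeff_C_mul, PowerSeries.coeff_mul, pairWeight]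
  simp only [secondDerSeries, PowerSeries.coeff_mk]
  rw [zpow_neg, zpow_neg]
  field_simp

lemma pairSeries_rec (x : ι → F) {o : ι} (y : F) {K : Finset ι} (ho : o ∉ K)
    (c : Finset ι → Finset ι → F) :
    let a := fun I => secondDerSeries (Function.update x o y) (insert o I)
    let b := fun I => secondDerSeries (Function.update x o (-y)) (insert o I)
    let u := secondDerSeries x
    genusOp (∑ I ∈ K.powerset, PowerSeries.C (c I (K \ I)) * (a I * b (K \ I))) +
        (K.card : PowerSeries F) * ∑ I ∈ K.powerset, PowerSeries.C (c I (K \ I)) * (a I * b (K \ I)) =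
      PowerSeries.X * (∑ I ∈ K.powerset, PowerSeries.C (c I (K \ I) * (algebraMap ℚ F (1 / 12) *
        ((y + varSum x I) ^ 3 + (-y + varSum x (K \ I)) ^ 3))) * (a I * b (K \ I))) +
      ∑ B ∈ K.powerset, u B * ∑ I ∈ (K \ B).powerset,
        PowerSeries.C (c (B ∪ I) ((K \ B) \ I) * (y + varSum x (B ∪ I)) +
          c I (B ∪ ((K \ B) \ I)) * (-y + varSum x (B ∪ ((K \ B) \ I)))) * (a I * b ((K \ B) \ I)) := by
  intro a b u
  have ha : ∀ I ⊆ K, genusOp (a I) + (I.card : PowerSeries F) * a I =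
      PowerSeries.X * PowerSeries.C (algebraMap ℚ F (1 / 12) * (y + varSum x I) ^ 3) * a I +
      PowerSeries.C (y + varSum x I) * ∑ B ∈ I.powerset, u B * a (I \ B) := by
    intro I hI
    have hoI := fun h => ho (hI h)
    have := secondDerSeries_insert_rec (Function.update x o y) hoI
    rw [varSum_update_insert x hoI] at this
    refine this.trans ?_
    congr 2
    refine Finset.sum_congr rfl fun B hB => ?_
    congr 1
    ext g
    simp only [secondDerSeries, PowerSeries.coeff_mk, u]
    exact secondDer_update x (fun h => hoI (Finset.mem_powerset.1 hB h)) y g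
  have hb : ∀ I ⊆ K, genusOp (b I) + (I.card : PowerSeries F) * b I =
      PowerSeries.X * PowerSeries.C (algebraMap ℚ F (1 / 12) * (-y + varSum x I) ^ 3) * b I +
      PowerSeries.C (-y + varSum x I) * ∑ B ∈ I.powerset, u B * b (I \ B) := by
    intro I hI
    have hoI := fun h => ho (hI h)
    have := secondDerSeries_insert_rec (Function.update x o (-y)) hoI
    rw [varSum_update_insert x hoI] at this
    refine this.trans ?_
    congr 2
    refine Finset.sum_congr rfl fun B hB => ?_
    congr 1
    ext g
    simp only [secondDerSeries, PowerSeries.coeff_mk, u]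
    exact secondDer_update x (fun h => hoI (Finset.mem_powerset.1 hB h)) (-y) g
  have e1 : ∀ I ∈ K.powerset, genusOp (PowerSeries.C (c I (K \ I)) * (a I * b (K \ I))) +
      (K.card : PowerSeries F) * (PowerSeries.C (c I (K \ I)) * (a I * b (K \ I))) =
      PowerSeries.X * (PowerSeries.C (c I (K \ I) * (algebraMap ℚ F (1 / 12) *
        ((y + varSum x I) ^ 3 + (-y + varSum x (K \ I)) ^ 3))) * (a I * b (K \ I))) +
      ∑ B ∈ I.powerset, PowerSeries.C (c (B ∪ (I \ B)) (K \ I) * (y + varSum x (B ∪ (I \ B)))) *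
          (u B * (a (I \ B) * b (K \ I))) +
      ∑ B ∈ (K \ I).powerset, PowerSeries.C (c I (B ∪ ((K \ I) \ B)) *
        (-y + varSum x (B ∪ ((K \ I) \ B)))) * (u B * (a I * b ((K \ I) \ B))) := by
    intro I hI
    have hI := Finset.mem_powerset.1 hI
    have s1 : ∑ B ∈ I.powerset, PowerSeries.C (c (B ∪ (I \ B)) (K \ I) *
        (y + varSum x (B ∪ (I \ B)))) * (u B * (a (I \ B) * b (K \ I))) =
        PowerSeries.C (c I (K \ I)) * (PowerSeries.C (y + varSum x I) *
          ∑ B ∈ I.powerset, u B * a (I \ B)) * b (K \ I) := by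
      simp only [Finset.mul_sum, Finset.sum_mul]
      refine Finset.sum_congr rfl fun B hB => ?_
      rw [Finset.union_sdiff_of_subset (Finset.mem_powerset.1 hB), map_mul]
      ring
    have s2 : ∑ B ∈ (K \ I).powerset, PowerSeries.C (c I (B ∪ ((K \ I) \ B)) *
        (-y + varSum x (B ∪ ((K \ I) \ B)))) * (u B * (a I * b ((K \ I) \ B))) =
        PowerSeries.C (c I (K \ I)) * a I * (PowerSeries.C (-y + varSum x (K \ I)) *
          ∑ B ∈ (K \ I).powerset, u B * b ((K \ I) \ B)) := by
      simp only [Finset.mul_sum]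
      refine Finset.sum_congr rfl fun B hB => ?_
      rw [Finset.union_sdiff_of_subset (Finset.mem_powerset.1 hB), map_mul]
      ring
    have hc : (K.card : PowerSeries F) = I.card + (K \ I).card := by
      rw [← Finset.card_sdiff_add_card_eq_card hI]; push_cast; ring
    have hCC : genusOp (PowerSeries.C (c I (K \ I)) * (a I * b (K \ I))) =
        PowerSeries.C (c I (K \ I)) * (genusOp (a I) * b (K \ I) + a I * genusOp (b (K \ I))) := by
      rw [← PowerSeries.smul_eq_C_mul, ← PowerSeries.smul_eq_C_mul, Derivation.map_smul,
        Derivation.leibniz]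
      simp only [smul_eq_mul]
      ring
    have h1 := ha I hI
    have h2 := hb (K \ I) Finset.sdiff_subset
    rw [hCC, s1, s2, hc]
    simp only [map_mul, map_add, mul_add] at h1 h2 ⊢
    linear_combination PowerSeries.C (c I (K \ I)) * b (K \ I) * h1 +
      PowerSeries.C (c I (K \ I)) * a I * h2
  rw [map_sum, Finset.mul_sum, ← Finset.sum_add_distrib, Finset.sum_congr rfl e1,
    Finset.sum_add_distrib, Finset.sum_add_distrib, Finset.mul_sum, add_assoc]
  congr 1
  rw [sum_powerset_assoc K (fun B I J => PowerSeries.C (c (B ∪ I) J * (y + varSum x (B ∪ I))) *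
          (u B * (a I * b J)))]
  rw [sum_powerset_compl K (fun I J => ∑ B ∈ J.powerset, PowerSeries.C (c I (B ∪ (J \ B)) *
        (-y + varSum x (B ∪ (J \ B)))) * (u B * (a I * b (J \ B)))),
    sum_powerset_assoc K (fun B I J => PowerSeries.C (c J (B ∪ I) *
        (-y + varSum x (B ∪ I))) * (u B * (a J * b I))), ← Finset.sum_add_distrib]
  refine Finset.sum_congr rfl fun B _ => ?_
  rw [sum_powerset_compl (K \ B) (fun J I => PowerSeries.C (c I (B ∪ J) *
        (-y + varSum x (B ∪ J))) * (u B * (a I * b J))), ← Finset.sum_add_distrib, Finset.mul_sum]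
  refine Finset.sum_congr rfl fun I _ => ?_
  rw [map_add]; ring


lemma varSum_union_of_mem_sdiff (x : ι → F) {K B I : Finset ι} (hI : I ⊆ K \ B) :
    varSum x (B ∪ I) = varSum x B + varSum x I :=
  Finset.sum_union (Finset.disjoint_of_subset_right hI Finset.disjoint_sdiff)

lemma pairWeight_rec (x : ι → F) {o : ι} {y : F} {K : Finset ι} (ho : o ∉ K)
    (hX : ∀ I ⊆ K, y + varSum x I ≠ 0) (hY : ∀ I ⊆ K, -y + varSum x I ≠ 0) (g : ℕ) (d : ℤ) :
    (2 * g + K.card : F) * ∑ I ∈ K.powerset, (y + varSum x I) ^ d * pairWeight x o y g K I =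
      (if g = 0 then 0 else algebraMap ℚ F (1 / 12) *
        (3 * varSum x K * ∑ I ∈ K.powerset,
            (y + varSum x I) ^ (d + 2) * pairWeight x o y (g - 1) K I -
          3 * varSum x K ^ 2 * ∑ I ∈ K.powerset,
            (y + varSum x I) ^ (d + 1) * pairWeight x o y (g - 1) K I +
          varSum x K ^ 3 * ∑ I ∈ K.powerset,
            (y + varSum x I) ^ d * pairWeight x o y (g - 1) K I)) +
      ∑ B ∈ K.powerset, ∑ p ∈ antidiagonal g, secondDer x p.1 B * ∑ I ∈ (K \ B).powerset,
        (y + varSum x I) ^ d *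
          (((y + varSum x I) * (1 + varSum x B * (y + varSum x I)⁻¹) ^ (d - 1) +
            (-y + varSum x ((K \ B) \ I)) ^ 2 * (-y + varSum x K - varSum x I)⁻¹) *
            pairWeight x o y p.2 (K \ B) I) := by
  have h := congrArg (PowerSeries.coeff g) (pairSeries_rec x y ho
    (fun I J => (y + varSum x I) ^ (d - 2) * (-y + varSum x J) ^ (-2 : ℤ)))
  have hM : ∀ (g : ℕ) (A : Finset ι) (c : Finset ι → F), A ⊆ K → PowerSeries.coeff g
      (∑ I ∈ A.powerset, PowerSeries.C (c I) *
        (secondDerSeries (Function.update x o y) (insert o I) *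
          secondDerSeries (Function.update x o (-y)) (insert o (A \ I)))) =
      ∑ I ∈ A.powerset, c I * (y + varSum x I) ^ 2 * (-y + varSum x (A \ I)) ^ 2 *
        pairWeight x o y g A I := by
    intro g A c hA
    rw [map_sum]
    refine Finset.sum_congr rfl fun I hI => ?_
    exact coeff_pairSeries x o y _ g A I (hX I ((Finset.mem_powerset.1 hI).trans hA))
      (hY (A \ I) (Finset.sdiff_subset.trans hA))
  have hz : ∀ {z : F} (_ : z ≠ 0) (d : ℤ), z ^ (d - 2) * z ^ 2 = z ^ d := by
    intro z hz d
    rw [← zpow_natCast, ← zpow_add₀ hz]; simp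
  have hz' : ∀ {z : F} (_ : z ≠ 0), z ^ (-2 : ℤ) * z ^ 2 = 1 := fun hz0 => by
    simpa using hz hz0 0
  have hL : ∑ I ∈ K.powerset, (y + varSum x I) ^ d * pairWeight x o y g K I =
      ∑ I ∈ K.powerset, (y + varSum x I) ^ (d - 2) * (-y + varSum x (K \ I)) ^ (-2 : ℤ) *
        (y + varSum x I) ^ 2 * (-y + varSum x (K \ I)) ^ 2 * pairWeight x o y g K I := by
    refine Finset.sum_congr rfl fun I hI => ?_
    have hI := Finset.mem_powerset.1 hI
    have h2 := hz' (hY (K \ I) Finset.sdiff_subset)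
    rw [← hz (hX I hI) d]
    linear_combination -(y + varSum x I) ^ (d - 2) * (y + varSum x I) ^ 2 *
      pairWeight x o y g K I * h2
  rw [← map_natCast (PowerSeries.C (R := F)), map_add, coeff_genusOp, PowerSeries.coeff_C_mul,
    hM g K _ subset_rfl, ← hL, ← add_mul, map_add] at h
  rw [h]
  congr 1
  · cases g with
    | zero => simp
    | succ g =>
      rw [PowerSeries.coeff_succ_X_mul, hM g K _ subset_rfl, if_neg (by omega),
        Nat.add_sub_cancel]
      simp only [Finset.mul_sum]
      rw [← Finset.sum_sub_distrib, ← Finset.sum_add_distrib, Finset.mul_sum]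
      refine Finset.sum_congr rfl fun I hI => ?_
      have hI := Finset.mem_powerset.1 hI
      have h1 := hX I hI
      have h2 := hz' (hY (K \ I) Finset.sdiff_subset)
      have h3 : varSum x (K \ I) = varSum x K - varSum x I := by
        rw [← varSum_add_sdiff x hI]; ring
      have h4 := hz h1 d
      have h5 : (y + varSum x I) ^ (d + 2) = (y + varSum x I) ^ d * (y + varSum x I) ^ 2 := by
        rw [zpow_add₀ h1]; norm_cast
      rw [h5, zpow_add_one₀ h1, ← h4]
      rw [h3] at h2 ⊢
      linear_combination (y + varSum x I) ^ (d - 2) * (y + varSum x I) ^ 2 *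
        algebraMap ℚ F (1 / 12) * ((y + varSum x I) ^ 3 + (-y + (varSum x K - varSum x I)) ^ 3) *
        pairWeight x o y g K I * h2
  · rw [map_sum]
    refine Finset.sum_congr rfl fun B hB => ?_
    have hB := Finset.mem_powerset.1 hB
    rw [PowerSeries.coeff_mul]
    refine Finset.sum_congr rfl fun p _ => ?_
    rw [hM p.2 (K \ B) _ Finset.sdiff_subset, secondDerSeries, PowerSeries.coeff_mk]
    congr 1
    refine Finset.sum_congr rfl fun I hI => ?_
    have hI := Finset.mem_powerset.1 hI
    have hI' := hI.trans Finset.sdiff_subset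
    have h1 := hX I hI'
    have h2 := hY ((K \ B) \ I) (Finset.sdiff_subset.trans Finset.sdiff_subset)
    have h3 := hX (B ∪ I) (Finset.union_subset hB hI')
    have h4 := hY (B ∪ (K \ B) \ I)
      (Finset.union_subset hB (Finset.sdiff_subset.trans Finset.sdiff_subset))
    have e1 := varSum_union_of_mem_sdiff x hI
    have e2 := varSum_union_of_mem_sdiff x (Finset.sdiff_subset (s := K \ B) (t := I))
    have e3 : -y + varSum x K - varSum x I = -y + varSum x (B ∪ (K \ B) \ I) := by
      rw [e2, ← varSum_add_sdiff x hB, ← varSum_add_sdiff x hI]; ring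
    have e4 : 1 + varSum x B * (y + varSum x I)⁻¹ =
        (y + varSum x (B ∪ I)) * (y + varSum x I)⁻¹ := by
      rw [e1]; field_simp; ring
    rw [e3, e4, mul_zpow, inv_zpow']
    have h5 := hz h1 d
    have h6 := hz' h2
    have h7 : (-y + varSum x (B ∪ (K \ B) \ I)) ^ (-2 : ℤ) *
        (-y + varSum x (B ∪ (K \ B) \ I)) = (-y + varSum x (B ∪ (K \ B) \ I))⁻¹ := by
      rw [← zpow_add_one₀ h4]; simp
    have h8 : (y + varSum x (B ∪ I)) ^ (d - 2) * (y + varSum x (B ∪ I)) =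
        (y + varSum x (B ∪ I)) ^ (d - 1) := by
      rw [← zpow_add_one₀ h3]; congr 1; ring
    have h9 : (y + varSum x I) ^ d * (y + varSum x I) * (y + varSum x I) ^ (-(d - 1)) =
        (y + varSum x I) ^ 2 := by
      rw [← zpow_add_one₀ h1, ← zpow_add₀ h1, ← zpow_natCast]; congr 1; push_cast; ring
    generalize pairWeight x o y p.2 (K \ B) I = w at *
    generalize (y + varSum x (B ∪ I)) ^ (d - 2) = a1 at *
    generalize (y + varSum x (B ∪ I)) ^ (d - 1) = a2 at *
    generalize (y + varSum x I) ^ (d - 2) = a3 at *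
    generalize (y + varSum x I) ^ (-(d - 1)) = a4 at *
    generalize (y + varSum x I) ^ d = a5 at *
    generalize (-y + varSum x (B ∪ (K \ B) \ I)) ^ (-2 : ℤ) = b1 at *
    generalize (-y + varSum x (B ∪ (K \ B) \ I))⁻¹ = b2 at *
    generalize (-y + varSum x ((K \ B) \ I)) ^ (-2 : ℤ) = b3 at *
    generalize -y + varSum x ((K \ B) \ I) = Y at *
    generalize -y + varSum x (B ∪ (K \ B) \ I) = Y' at *
    generalize y + varSum x (B ∪ I) = X' at *
    generalize y + varSum x I = X at *
    linear_combination w * X ^ 2 * (b3 * Y ^ 2 * h8 + a2 * h6) + w * a3 * X ^ 2 * Y ^ 2 * h7 +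
      w * b2 * Y ^ 2 * h5 - a2 * w * h9

end PairSum

section PairLeading

variable {ι C : Type*} [DecidableEq ι] [CommRing C] [Algebra ℚ C]

/-- The leading coefficient of `∑ (y + ∑_I x)^(N+3-2g) F_{g'}(y, x_I) F_{g-g'}(-y, x_{K \ I})`
in `y`, computed recursively. -/
def pairLeading (x : ι → C) (N : ℤ) (g : ℕ) (K : Finset ι) : C :=
  if g = 0 ∧ K = ∅ then 1 else
  algebraMap ℚ C (1 / (2 * g + K.card)) *
    (algebraMap ℚ C (1 / 4) * varSum x K *
        (if _h : g = 0 then 0 else pairLeading x N (g - 1) K) +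
      ∑ J ∈ K.ssubsets.attach, secondDer x 0 (K \ J.1) *
        (((N : C) + 1 - 2 * g) * varSum x (K \ J.1) + varSum x J.1) * pairLeading x N g J.1)
termination_by g + K.card
decreasing_by
  · omega
  · have h1 := Finset.card_lt_card (Finset.mem_ssubsets.1 J.2)
    omega

lemma pairLeading_zero_empty (x : ι → C) (N : ℤ) : pairLeading x N 0 ∅ = 1 := by
  rw [pairLeading]; simp

lemma pairLeading_rec (x : ι → C) (N : ℤ) (g : ℕ) (K : Finset ι) :
    (2 * g + K.card : C) * pairLeading x N g K =
      algebraMap ℚ C (1 / 4) * varSum x K * (if g = 0 then 0 else pairLeading x N (g - 1) K) +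
      ∑ B ∈ K.powerset, secondDer x 0 B *
        (((N : C) + 1 - 2 * g) * varSum x B + varSum x (K \ B)) * pairLeading x N g (K \ B) := by
  rw [sum_powerset_compl K (fun B J => secondDer x 0 B *
        (((N : C) + 1 - 2 * g) * varSum x B + varSum x J) * pairLeading x N g J),
    ← Finset.sum_subset_zero_on_sdiff (s₁ := K.ssubsets) (f := fun J => secondDer x 0 (K \ J) *
        (((N : C) + 1 - 2 * g) * varSum x (K \ J) + varSum x J) * pairLeading x N g J)
      (fun I hI => Finset.mem_powerset.2 (Finset.mem_ssubsets.1 hI).1) ?_ (fun _ _ => rfl)]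
  · by_cases h1 : g = 0 ∧ K = ∅
    · obtain ⟨rfl, rfl⟩ := h1
      simp [Finset.ssubsets]
    · have hc : (2 * g + K.card : ℚ) ≠ 0 := by
        intro h
        have h2 : 2 * g + K.card = 0 := by exact_mod_cast h
        exact h1 ⟨by omega, Finset.card_eq_zero.1 (by omega)⟩
      have hcC : (2 * g + K.card : C) = algebraMap ℚ C (2 * g + K.card) := by
        simp only [map_add, map_mul, map_natCast, map_ofNat]
      conv_lhs => rw [pairLeading]
      rw [if_neg h1, hcC, ← mul_assoc, ← map_mul, mul_one_div_cancel hc, map_one, one_mul,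
        Finset.sum_attach K.ssubsets (fun J => secondDer x 0 (K \ J) *
        (((N : C) + 1 - 2 * g) * varSum x (K \ J) + varSum x J) * pairLeading x N g J)]
      simp only [dite_eq_ite]
  · intro I hI
    simp only [mem_sdiff, mem_powerset, mem_ssubsets, ssubset_iff_subset_ne] at hI
    have : I = K := by tauto
    subst this
    simp [secondDer_empty]

end PairLeading

section PairLeadingTerm

variable {ι k : Type*} [DecidableEq ι] [Field k] [Algebra ℚ k]

lemma hasLeading_pairFactor {S : Finset ι} {s : ι → k} {w : ι → LaurentSeries k} {e : ℤ}
    {ℓ : ℤ → k} (h : HasLeading S s w e ℓ) (β σ : k) (d : ℤ) :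
    HasLeading S s (fun I =>
      ((yVar k + HahnSeries.C (s I)) *
        (1 + HahnSeries.C β * (yVar k + HahnSeries.C (s I))⁻¹) ^ (d - 1) +
      (-yVar k + HahnSeries.C (σ - s I)) ^ 2 *
        (-yVar k + HahnSeries.C (σ + β) - HahnSeries.C (s I))⁻¹) * w I) e
      (fun d' => ((d - 2) * β + σ) * ℓ d') := by
  have h1 := h.zpow_sub_one_mul β (d - 1)
  have h2 := h.zpow_sub_one_mul (-σ) 2
  have h3 := ((h.zpow_sub_one_mul (-(σ + β)) (-1)).one_add_mul (-σ)).one_add_mul (-σ)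
  convert (h1.sub h3).sub h2 using 1
  · funext I
    have hX := yVar_add_C_ne_zero (s I)
    have h4 := one_add_C_mul_inv_ne_zero (-(σ + β)) (s I)
    have h5 := yVar_add_C_ne_zero (s I + (-(σ + β)))
    have h6 : -yVar k + HahnSeries.C (σ + β) - HahnSeries.C (s I) =
        -((yVar k + HahnSeries.C (s I)) *
          (1 + HahnSeries.C (-(σ + β)) * (yVar k + HahnSeries.C (s I))⁻¹)) := by
      field_simp
      simp only [map_neg]; ring
    have h7 : -yVar k + HahnSeries.C (σ - s I) = -((yVar k + HahnSeries.C (s I)) *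
          (1 + HahnSeries.C (-σ) * (yVar k + HahnSeries.C (s I))⁻¹)) := by
      field_simp
      simp only [map_neg, map_sub]; ring
    rw [h6, h7, inv_neg, mul_inv, zpow_neg_one]
    have h8 := mul_inv_cancel₀ hX
    generalize (1 + HahnSeries.C (-(σ + β)) * (yVar k + HahnSeries.C (s I))⁻¹)⁻¹ = r
    generalize (1 + HahnSeries.C β * (yVar k + HahnSeries.C (s I))⁻¹) ^ (d - 1) = q
    generalize (1 + HahnSeries.C (-σ) * (yVar k + HahnSeries.C (s I))⁻¹) = p
    rw [show (2 : ℤ) = ((2 : ℕ) : ℤ) from rfl, zpow_natCast]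
    generalize yVar k + HahnSeries.C (s I) = X at *
    linear_combination (-p ^ 2 * X * r * w I) * h8
  · funext d'; push_cast; ring

lemma mem_degLE_of_natCast_mul {m : ℕ} (hm : m ≠ 0) {f : LaurentSeries k} {r : ℤ}
    (h : (m : LaurentSeries k) * f ∈ degLE k r) : f ∈ degLE k r := by
  have hm' : (m : k) ≠ 0 := by
    rw [← map_natCast (algebraMap ℚ k)]
    exact (map_ne_zero _).2 (Nat.cast_ne_zero.2 hm)
  have := C_mul_mem_degLE (m : k)⁻¹ h
  rwa [← map_natCast (HahnSeries.C (Γ := ℤ)), ← mul_assoc, ← map_mul, inv_mul_cancel₀ hm', map_one, one_mul] at this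

lemma algebraMap_laurentSeries (q : ℚ) :
    algebraMap ℚ (LaurentSeries k) q = HahnSeries.C (algebraMap ℚ k q) := by
  exact DFunLike.congr_fun (Subsingleton.elim (algebraMap ℚ (LaurentSeries k))
    ((HahnSeries.C (Γ := ℤ)).comp (algebraMap ℚ k))) q

lemma map_C_varSum (x : ι → k) (A : Finset ι) :
    varSum (fun i => (HahnSeries.C (x i) : LaurentSeries k)) A = HahnSeries.C (varSum x A) := by
  simp [varSum]

lemma map_C_secondDer (x : ι → k) (g : ℕ) (A : Finset ι) :
    secondDer (fun i => (HahnSeries.C (x i) : LaurentSeries k)) g A =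
      HahnSeries.C (secondDer x g A) := by
  have := map_secondDer (HahnSeries.C (Γ := ℤ) (R := k)) (Function.Embedding.refl ι) (x := x)
    (x' := fun i => (HahnSeries.C (x i) : LaurentSeries k)) g (A := A) (fun i _ => rfl)
  simpa using this.symm

/-- The leading coefficient of `∑ (y + ∑_I x)^d F_{g'}(y, x_I) F_{g-g'}(-y, x_{K \ I})`. -/
theorem hasLeading_pairWeight (x : ι → k) {o : ι} (g : ℕ) (K : Finset ι) (ho : o ∉ K) :
    HasLeading K.powerset (varSum x)
      (pairWeight (fun i => (HahnSeries.C (x i) : LaurentSeries k)) o (yVar k) g K)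
      (2 * g - 4) (fun d => pairLeading x (2 * g - 3 + d) g K) := by
  induction hM : g + K.card using Nat.strong_induction_on generalizing g K with
  | _ M ih =>
  subst hM
  set xC := fun i => (HahnSeries.C (x i) : LaurentSeries k) with hxC
  intro d
  by_cases h0 : g = 0 ∧ K = ∅
  · obtain ⟨rfl, rfl⟩ := h0
    have hy := yVar_ne_zero (k := k)
    have hone : ∀ z, secondDer (Function.update xC o z) 0 (insert o ∅) = 1 := fun z =>
      secondDer_zero_singleton _ o
    simp only [powerset_empty, sum_singleton, pairWeight, varSum_empty, map_zero, add_zero,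
      sdiff_self, bot_eq_empty, Finset.Nat.antidiagonal_zero, hone, mul_one,
      pairLeading_zero_empty, map_one, one_mul]
    convert (degLE k _).zero_mem using 1
    rw [sub_eq_zero, (even_two.neg (α := ℤ)).neg_zpow, ← zpow_add₀ hy, ← zpow_add₀ hy]
    congr 1
    push_cast; ring
  have hc : 2 * g + K.card ≠ 0 := by
    intro h
    exact h0 ⟨by omega, Finset.card_eq_zero.1 (by omega)⟩
  apply mem_degLE_of_natCast_mul hc
  have hrec := pairWeight_rec xC (y := yVar k) ho
    (fun I _ => by rw [map_C_varSum]; exact yVar_add_C_ne_zero _)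
    (fun I _ => by rw [map_C_varSum]; exact neg_yVar_add_C_ne_zero _) g d
  have hlead := congrArg (HahnSeries.C (Γ := ℤ)) (pairLeading_rec x (2 * g - 3 + d) g K)
  rw [map_mul] at hlead
  have hcast : ((2 * g + K.card : ℕ) : LaurentSeries k) = 2 * g + K.card := by push_cast; ring
  have hcast' : HahnSeries.C (Γ := ℤ) (2 * g + K.card : k) = 2 * g + K.card := by
    rw [map_add, map_mul, map_ofNat, map_natCast, map_natCast]
  rw [hcast'] at hlead
  rw [hcast, mul_sub, ← mul_assoc, hlead]
  simp only [hxC, map_C_varSum] at hrec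
  rw [← hxC] at hrec
  rw [hrec, map_add, map_sum, add_mul, add_sub_add_comm, Finset.sum_mul,
    ← Finset.sum_sub_distrib]
  refine add_mem ?_ (AddSubgroup.sum_mem _ fun B hB => ?_)
  · rcases g with _ | g
    · simp
    rw [if_neg (by omega), if_neg (by omega), Nat.add_sub_cancel]
    have h := ih (g + K.card) (by omega) g K ho rfl
    have h2 := C_mul_mem_degLE (algebraMap ℚ k (1 / 4) * varSum x K) (h (d + 2))
    have h1 := C_mul_mem_degLE (algebraMap ℚ k (1 / 4) * varSum x K ^ 2) (h.sum_mem (d + 1))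
    have h0 := C_mul_mem_degLE (algebraMap ℚ k (1 / 12) * varSum x K ^ 3) (h.sum_mem d)
    have q : (3 : LaurentSeries k) * HahnSeries.C (algebraMap ℚ k (1 / 12)) =
        HahnSeries.C (algebraMap ℚ k (1 / 4)) := by
      rw [← map_ofNat (HahnSeries.C (Γ := ℤ) (R := k)), ← map_mul,
        ← map_ofNat (algebraMap ℚ k), ← map_mul]
      norm_num
    have i1 : (2 * ((g + 1 : ℕ) : ℤ) - 3 + d) = 2 * (g : ℤ) - 3 + (d + 2) := by push_cast; ring
    have i2 : (2 * ((g + 1 : ℕ) : ℤ) - 4 + d) = 2 * (g : ℤ) - 4 + (d + 2) := by push_cast; ring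
    rw [i1, i2, algebraMap_laurentSeries]
    convert add_mem (sub_mem h2 (degLE_mono (by omega) h1)) (degLE_mono (by omega) h0) using 1
    simp only [hxC, map_mul, map_pow]
    rw [← q]
    ring
  · rcases B.eq_empty_or_nonempty with rfl | hBne
    · simp [secondDer_empty]
    have hB := Finset.mem_powerset.1 hB
    have hcard := Finset.card_sdiff_add_card_eq_card hB
    have hpos := Finset.card_pos.2 hBne
    set β := varSum x B with hβ
    set σ := varSum x (K \ B) with hσ
    have hfac : ∀ p ∈ antidiagonal g, HasLeading (K \ B).powerset (varSum x) _ _ _ := fun p hp =>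
      hasLeading_pairFactor (ih (p.2 + (K \ B).card)
        (by have := mem_antidiagonal.1 hp; omega) p.2 (K \ B)
        (fun h => ho (Finset.sdiff_subset h)) rfl) β σ d
    have hlast : HahnSeries.C (secondDer x 0 B * ((((2 * g - 3 + d : ℤ) : k) + 1 - 2 * g) * β + σ) *
        pairLeading x (2 * g - 3 + d) g (K \ B)) * yVar k ^ (2 * (g : ℤ) - 4 + d) =
        ∑ p ∈ antidiagonal g, if p = (0, g) then HahnSeries.C (secondDer x p.1 B) *
          (HahnSeries.C (((d - 2) * β + σ) * pairLeading x (2 * p.2 - 3 + d) p.2 (K \ B)) *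
            yVar k ^ (2 * (p.2 : ℤ) - 4 + d)) else 0 := by
      rw [Finset.sum_ite_eq', if_pos (by simp), ← mul_assoc, ← map_mul]
      congr 2
      push_cast; ring
    rw [hlast, ← Finset.sum_sub_distrib]
    refine AddSubgroup.sum_mem _ fun p hp => ?_
    have hrw : ∀ I ∈ (K \ B).powerset, (yVar k + HahnSeries.C (varSum x I)) ^ d *
                (((yVar k + HahnSeries.C (varSum x I)) * (1 + HahnSeries.C (varSum x B) * (yVar k + HahnSeries.C (varSum x I))⁻¹) ^ (d - 1) +
                    (-yVar k + HahnSeries.C (varSum x ((K \ B) \ I))) ^ 2 * (-yVar k + HahnSeries.C (varSum x K) - HahnSeries.C (varSum x I))⁻¹) *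
                  pairWeight xC o (yVar k) p.2 (K \ B) I) =
        (yVar k + HahnSeries.C (varSum x I)) ^ d * (((yVar k + HahnSeries.C (varSum x I)) *
        (1 + HahnSeries.C β * (yVar k + HahnSeries.C (varSum x I))⁻¹) ^ (d - 1) +
      (-yVar k + HahnSeries.C (σ - varSum x I)) ^ 2 *
        (-yVar k + HahnSeries.C (σ + β) - HahnSeries.C (varSum x I))⁻¹) *
        pairWeight xC o (yVar k) p.2 (K \ B) I) := by
      intro I hI
      have e1 := varSum_add_sdiff x (Finset.mem_powerset.1 hI)
      have e2 := varSum_add_sdiff x hB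
      rw [show σ - varSum x I = varSum x ((K \ B) \ I) by rw [hσ, ← e1]; ring,
        show σ + β = varSum x K by rw [hσ, hβ, ← e2]; ring]
    rw [Finset.sum_congr rfl hrw, map_C_secondDer]
    split_ifs with hp0
    · rw [← mul_sub]
      refine C_mul_mem_degLE _ ?_
      have := hfac p hp d
      subst hp0
      exact this
    · rw [sub_zero]
      refine C_mul_mem_degLE _ (degLE_mono ?_ ((hfac p hp).sum_mem d))
      have h1 := mem_antidiagonal.1 hp
      have h2 : p.1 ≠ 0 := fun h => hp0 (Prod.ext h (by simp only; omega))
      omega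

end PairLeadingTerm

section Structure

variable {ι ι' C C' : Type*} [DecidableEq ι] [DecidableEq ι'] [CommRing C] [Algebra ℚ C]
  [CommRing C'] [Algebra ℚ C']

lemma map_pairLeading (φ : C →+* C') (e : ι ↪ ι') {x : ι → C} {x' : ι' → C'} (N : ℤ) (g : ℕ)
    {K : Finset ι} (h : ∀ i ∈ K, φ (x i) = x' (e i)) :
    φ (pairLeading x N g K) = pairLeading x' N g (K.map e) := by
  induction hM : g + K.card using Nat.strong_induction_on generalizing g K with
  | _ M ih =>
  subst hM
  by_cases h0 : g = 0 ∧ K = ∅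
  · obtain ⟨rfl, rfl⟩ := h0
    simp [pairLeading_zero_empty]
  have hc : 2 * g + K.card ≠ 0 := by
    intro h
    exact h0 ⟨by omega, Finset.card_eq_zero.1 (by omega)⟩
  refine natCast_mul_cancel hc ?_
  have r1 := congrArg φ (pairLeading_rec x N g K)
  have r2 := pairLeading_rec x' N g (K.map e)
  simp only [Finset.card_map] at r2
  rw [sum_powerset_map e K (fun B J => secondDer x' 0 B *
        (((N : C') + 1 - 2 * g) * varSum x' B + varSum x' J) * pairLeading x' N g J)] at r2
  simp only [map_mul, map_add, map_sub, map_ofNat, map_natCast, map_intCast, map_one,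
      RingHom.map_rat_algebraMap, map_sum, map_varSum φ e h] at r1
  push_cast
  rw [r1, r2]
  congr 1
  · congr 1
    split_ifs with hg
    · simp
    · exact ih _ (by omega) (g - 1) h rfl
  · refine Finset.sum_congr rfl fun B hB => ?_
    have hB := Finset.mem_powerset.1 hB
    rcases B.eq_empty_or_nonempty with rfl | hBne
    · simp [secondDer_empty]
    have hcard := Finset.card_sdiff_add_card_eq_card hB
    have hpos := Finset.card_pos.2 hBne
    have h1 : ∀ i ∈ B, φ (x i) = x' (e i) := fun i hi => h i (hB hi)
    have h2 : ∀ i ∈ K \ B, φ (x i) = x' (e i) := fun i hi => h i (Finset.sdiff_subset hi)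
    rw [ih _ (by omega) g h2 rfl, map_secondDer φ e 0 h1, map_varSum φ e h1, map_varSum φ e h2]

lemma exists_subalgebra_lift (𝒮 : Subalgebra ℚ C) {x : ι → C} {A : Finset ι}
    (h : ∀ i ∈ A, x i ∈ 𝒮) : ∃ z : ι → 𝒮, ∀ i ∈ A, 𝒮.val.toRingHom (z i) = x i := by
  classical
  exact ⟨fun i => if hi : x i ∈ 𝒮 then ⟨x i, hi⟩ else 0, fun i hi => by simp [h i hi]⟩

lemma varSum_mem (𝒮 : Subalgebra ℚ C) {x : ι → C} {A : Finset ι}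
    (h : ∀ i ∈ A, x i ∈ 𝒮) : varSum x A ∈ 𝒮 := sum_mem h

lemma secondDer_mem (𝒮 : Subalgebra ℚ C) {x : ι → C} {A : Finset ι}
    (h : ∀ i ∈ A, x i ∈ 𝒮) (g : ℕ) : secondDer x g A ∈ 𝒮 := by
  obtain ⟨z, hz⟩ := exists_subalgebra_lift 𝒮 h
  have := map_secondDer 𝒮.val.toRingHom (Function.Embedding.refl ι) (x := z) (x' := x) g hz
  rw [Finset.map_refl] at this
  exact this ▸ (secondDer z g A).2

lemma pairLeading_mem (𝒮 : Subalgebra ℚ C) {x : ι → C} {A : Finset ι}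
    (h : ∀ i ∈ A, x i ∈ 𝒮) (N : ℤ) (g : ℕ) : pairLeading x N g A ∈ 𝒮 := by
  obtain ⟨z, hz⟩ := exists_subalgebra_lift 𝒮 h
  have := map_pairLeading 𝒮.val.toRingHom (Function.Embedding.refl ι) (x := z) (x' := x) N g hz
  rw [Finset.map_refl] at this
  exact this ▸ (pairLeading z N g A).2

lemma pairLeading_insert (x : ι → C) {i : ι} (hx : x i = 0) (N : ℤ) (g : ℕ) (K : Finset ι)
    (hi : i ∉ K) :
    pairLeading x N g (insert i K) = varSum x K * pairLeading x N g K := by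
  induction hM : g + K.card using Nat.strong_induction_on generalizing g K with
  | _ M ih =>
  subst hM
  refine natCast_mul_cancel (m := 2 * g + K.card + 1) (by omega) ?_
  have r1 := pairLeading_rec x N g (insert i K)
  have r2 := pairLeading_rec x N g K
  rw [sum_powerset_insert_compl hi (fun B J => secondDer x 0 B *
        (((N : C) + 1 - 2 * g) * varSum x B + varSum x J) * pairLeading x N g J),
    varSum_insert x hi, hx, zero_add, Finset.card_insert_of_notMem hi] at r1
  have h1 : ∑ B ∈ K.powerset, secondDer x 0 B * (((N : C) + 1 - 2 * g) * varSum x B +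
        varSum x (insert i (K \ B))) * pairLeading x N g (insert i (K \ B)) =
      ∑ B ∈ K.powerset, secondDer x 0 B * (((N : C) + 1 - 2 * g) * varSum x B +
        varSum x (K \ B)) * (varSum x (K \ B) * pairLeading x N g (K \ B)) := by
    refine Finset.sum_congr rfl fun B hB => ?_
    have hB := Finset.mem_powerset.1 hB
    rcases B.eq_empty_or_nonempty with rfl | hBne
    · simp [secondDer_empty]
    have hcard := Finset.card_sdiff_add_card_eq_card hB
    have hpos := Finset.card_pos.2 hBne
    have hi' : i ∉ K \ B := fun h => hi (Finset.sdiff_subset h)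
    rw [ih _ (by omega) g (K \ B) hi' rfl, varSum_insert x hi', hx, zero_add]
  have h2 : ∑ B ∈ K.powerset, secondDer x 0 (insert i B) * (((N : C) + 1 - 2 * g) *
        varSum x (insert i B) + varSum x (K \ B)) * pairLeading x N g (K \ B) =
      ∑ B ∈ K.powerset, varSum x B * secondDer x 0 B * (((N : C) + 1 - 2 * g) *
        varSum x B + varSum x (K \ B)) * pairLeading x N g (K \ B) +
        varSum x K * pairLeading x N g K := by
    rw [show varSum x K * pairLeading x N g K = ∑ B ∈ K.powerset,
        if B = ∅ then varSum x K * pairLeading x N g K else 0 by simp, ← Finset.sum_add_distrib]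
    refine Finset.sum_congr rfl fun B hB => ?_
    have hi' : i ∉ B := fun h => hi (Finset.mem_powerset.1 hB h)
    rw [secondDer_zero_insert x hx B hi', varSum_insert x hi', hx]
    rcases B.eq_empty_or_nonempty with rfl | hBne
    · simp [varSum_empty, secondDer_empty]
    · rw [if_neg hBne.ne_empty, if_neg hBne.ne_empty]; ring
  have h3 : ∑ B ∈ K.powerset, secondDer x 0 B * (((N : C) + 1 - 2 * g) * varSum x B +
        varSum x (K \ B)) * (varSum x (K \ B) * pairLeading x N g (K \ B)) +
      ∑ B ∈ K.powerset, varSum x B * secondDer x 0 B * (((N : C) + 1 - 2 * g) *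
        varSum x B + varSum x (K \ B)) * pairLeading x N g (K \ B) =
      varSum x K * ∑ B ∈ K.powerset, secondDer x 0 B *
        (((N : C) + 1 - 2 * g) * varSum x B + varSum x (K \ B)) * pairLeading x N g (K \ B) := by
    rw [← Finset.sum_add_distrib, Finset.mul_sum]
    refine Finset.sum_congr rfl fun B hB => ?_
    rw [← varSum_add_sdiff x (Finset.mem_powerset.1 hB)]
    ring
  rw [h1, h2] at r1
  have h4 : (if g = 0 then 0 else pairLeading x N (g - 1) (insert i K)) =
      varSum x K * (if g = 0 then 0 else pairLeading x N (g - 1) K) := by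
    split_ifs with hg
    · simp
    · exact ih _ (by omega) (g - 1) K hi rfl
  rw [h4] at r1
  push_cast at r1 ⊢
  linear_combination r1 + h3 - varSum x K * r2

end Structure

section Coefficients

variable {ι : Type*} [DecidableEq ι]

lemma coeff_mul_of_supported {P Q : MvPolynomial ι ℚ} {B J : Finset ι} (hBJ : Disjoint B J)
    (hP : P ∈ supported ℚ (B : Set ι)) (hQ : Q ∈ supported ℚ (J : Set ι)) (d : ι →₀ ℕ) :
    coeff d (P * Q) = coeff (d.filter (· ∈ B)) P * coeff (d.filter (· ∉ B)) Q := by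
  rw [mem_supported] at hP hQ
  have hs : ∀ {P : MvPolynomial ι ℚ} {B : Finset ι}, (P.vars : Set ι) ⊆ B → ∀ a, coeff a P ≠ 0 →
      ∀ i ∉ B, a i = 0 := by
    intro P B hP a ha i hi
    by_contra h
    exact hi (hP ((mem_vars_iff_mem_support i).2 ⟨a, MvPolynomial.mem_support_iff.2 ha, Finsupp.mem_support_iff.2 h⟩))
  rw [coeff_mul]
  refine Finset.sum_eq_single (d.filter (· ∈ B), d.filter (· ∉ B)) ?_ ?_
  · rintro ⟨a, b⟩ hab hne
    by_contra h
    have h1 := hs hP a (left_ne_zero_of_mul h)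
    have h2 := hs hQ b (right_ne_zero_of_mul h)
    apply hne
    rw [HasAntidiagonal.mem_antidiagonal] at hab
    subst hab
    ext i
    · simp only [Finsupp.filter_apply, Finsupp.add_apply]
      split_ifs with hi
      · rw [h2 i (Finset.disjoint_left.1 hBJ hi), add_zero]
      · exact h1 i hi
    · simp only [Finsupp.filter_apply, Finsupp.add_apply]
      split_ifs with hi
      · exact h2 i (Finset.disjoint_left.1 hBJ hi)
      · rw [h1 i hi, zero_add]
  · intro h
    exact absurd (HasAntidiagonal.mem_antidiagonal.2 (Finsupp.filter_add_filter_not _ _)) h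

lemma coeff_aeval_update_zero (j : ι) (P : MvPolynomial ι ℚ) {d : ι →₀ ℕ} (hd : d j = 0) :
    coeff d (aeval (Function.update X j (0 : MvPolynomial ι ℚ)) P) = coeff d P := by
  induction P using MvPolynomial.induction_on' with
  | add p q hp hq => rw [map_add, coeff_add, coeff_add, hp, hq]
  | monomial s a =>
    rw [aeval_monomial, coeff_monomial]
    by_cases hs : s j = 0
    · rw [show (s.prod fun i k => Function.update X j (0 : MvPolynomial ι ℚ) i ^ k) =
        s.prod fun i k => X i ^ k from Finsupp.prod_congr fun i hi => by
          rw [Function.update_of_ne]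
          rintro rfl
          exact Finsupp.mem_support_iff.1 hi hs]
      rw [algebraMap_eq, ← monomial_eq, coeff_monomial]
    · rw [Finsupp.prod, Finset.prod_eq_zero (Finsupp.mem_support_iff.2 hs) (by simp [hs]),
        mul_zero, coeff_zero, if_neg]
      rintro rfl
      exact hs hd

lemma secondDer_zero_isHomogeneous (A : Finset ι) :
    (secondDer (X : ι → MvPolynomial ι ℚ) 0 A).IsHomogeneous (A.card - 1) := by
  induction A using Finset.strongInduction with
  | H A ih =>
  by_cases h1 : A.card = 1
  · obtain ⟨i, rfl⟩ := Finset.card_eq_one.1 h1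
    rw [secondDer_zero_singleton]
    simpa using isHomogeneous_one ι ℚ
  have hS : (varSum (X : ι → MvPolynomial ι ℚ) A).IsHomogeneous 1 :=
    IsHomogeneous.sum _ _ _ fun i _ => isHomogeneous_X _ _
  have hsum : (algebraMap ℚ (MvPolynomial ι ℚ) (1 / 2) * (varSum X A * ∑ I ∈ A.powerset,
      secondDer X 0 I * secondDer X 0 (A \ I))).IsHomogeneous (A.card - 1) := by
    rw [← Algebra.smul_def]
    rcases Nat.lt_or_ge A.card 2 with h2 | h2
    · obtain rfl : A = ∅ := Finset.card_eq_zero.1 (by omega)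
      simpa [varSum_empty] using isHomogeneous_zero ι ℚ 0
    refine (homogeneousSubmodule ι ℚ _).smul_mem _ ?_
    rw [show A.card - 1 = 1 + (A.card - 2) by omega]
    refine hS.mul (IsHomogeneous.sum _ _ _ fun I hI => ?_)
    have hI := Finset.mem_powerset.1 hI
    rcases I.eq_empty_or_nonempty with rfl | hI0
    · simpa [secondDer_empty] using isHomogeneous_zero ι ℚ _
    rcases (A \ I).eq_empty_or_nonempty with hI1 | hI1
    · simpa [hI1, secondDer_empty] using isHomogeneous_zero ι ℚ _
    have c0 := Finset.card_pos.2 hI0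
    have c1 := Finset.card_pos.2 hI1
    have c2 := Finset.card_sdiff_add_card_eq_card hI
    rw [show A.card - 2 = (I.card - 1) + ((A \ I).card - 1) by omega]
    refine (ih I (hI.ssubset_of_ne ?_)).mul (ih (A \ I) (Finset.sdiff_ssubset hI hI0))
    rintro rfl
    simp at hI1
  have hr := secondDer_zero_rec (X : ι → MvPolynomial ι ℚ) A
  rw [mul_assoc] at hr
  rw [← hr] at hsum
  have hc : (A.card - 1 : ℚ) ≠ 0 := by
    rw [sub_ne_zero]; exact_mod_cast h1
  have hcC : (A.card - 1 : MvPolynomial ι ℚ) = C (A.card - 1 : ℚ) := by simp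
  rw [hcC, ← smul_eq_C_mul] at hsum
  have := (homogeneousSubmodule ι ℚ _).smul_mem (A.card - 1 : ℚ)⁻¹ hsum
  rwa [smul_smul, inv_mul_cancel₀ hc, one_smul] at this

end Coefficients

section Coefficients

variable {ι : Type*} [DecidableEq ι]

lemma coeff_secondDer_insert {j : ι} {A : Finset ι} (hj : j ∉ A) {d : ι →₀ ℕ} (hd : d j = 0) :
    coeff d (secondDer (X : ι → MvPolynomial ι ℚ) 0 (insert j A)) =
      coeff d (if A = ∅ then 1 else varSum X A * secondDer X 0 A) := by
  set x' : ι → MvPolynomial ι ℚ := Function.update X j 0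
  have h : ∀ A : Finset ι, ∀ i ∈ A,
      (aeval x' : MvPolynomial ι ℚ →ₐ[ℚ] MvPolynomial ι ℚ).toRingHom (X i) =
        x' (Function.Embedding.refl ι i) := fun A i _ => aeval_X x' i
  rw [← coeff_aeval_update_zero j _ hd,
    ← coeff_aeval_update_zero j (if A = ∅ then 1 else varSum X A * secondDer X 0 A) hd]
  congr 1
  have h1 := map_secondDer _ _ 0 (h (insert j A))
  have h2 := map_secondDer _ _ 0 (h A)
  have h3 := map_varSum _ _ (h A)
  rw [Finset.map_refl] at h1 h2 h3
  simp only [AlgHom.toRingHom_eq_coe, RingHom.coe_coe] at h1 h2 h3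
  rw [h1, secondDer_zero_insert x' (by simp [x']) A hj]
  split_ifs with hA
  · simp
  · rw [map_mul, h2, h3]

lemma coeff_pairLeading_insert {j : ι} {A : Finset ι} (hj : j ∉ A) {d : ι →₀ ℕ} (hd : d j = 0)
    (N : ℤ) (g : ℕ) :
    coeff d (pairLeading (X : ι → MvPolynomial ι ℚ) N g (insert j A)) =
      coeff d (varSum X A * pairLeading X N g A) := by
  set x' : ι → MvPolynomial ι ℚ := Function.update X j 0
  have h : ∀ A : Finset ι, ∀ i ∈ A,
      (aeval x' : MvPolynomial ι ℚ →ₐ[ℚ] MvPolynomial ι ℚ).toRingHom (X i) =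
        x' (Function.Embedding.refl ι i) := fun A i _ => aeval_X x' i
  rw [← coeff_aeval_update_zero j _ hd,
    ← coeff_aeval_update_zero j (varSum X A * pairLeading X N g A) hd]
  congr 1
  have h1 := map_pairLeading _ _ N g (h (insert j A))
  have h2 := map_pairLeading _ _ N g (h A)
  have h3 := map_varSum _ _ (h A)
  rw [Finset.map_refl] at h1 h2 h3
  simp only [AlgHom.toRingHom_eq_coe, RingHom.coe_coe] at h1 h2 h3
  rw [h1, pairLeading_insert x' (by simp [x']) N g A hj, map_mul, h2, h3]

lemma coeff_varSum_mul {d : ι →₀ ℕ} {A : Finset ι} (hA : A ⊆ d.support)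
    (P : MvPolynomial ι ℚ) :
    coeff d (varSum X A * P) = ∑ j ∈ A, coeff (d - Finsupp.single j 1) P := by
  rw [varSum, Finset.sum_mul, coeff_sum]
  exact Finset.sum_congr rfl fun j hj => by rw [coeff_X_mul', if_pos (hA hj)]

lemma sub_single_eq_erase {d : ι →₀ ℕ} {j : ι} (hj : d j = 1) :
    d - Finsupp.single j 1 = d.erase j := by
  ext i
  rcases eq_or_ne i j with rfl | h
  · simp [hj]
  · simp [Finsupp.erase_ne h, Finsupp.single_eq_of_ne h]

lemma coeff_varSum_mul_secondDer_of_ones {d : ι →₀ ℕ} (hd : ∀ j ∈ d.support, d j = 1)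
    (h0 : d ≠ 0) :
    coeff d (varSum X d.support * secondDer X 0 d.support) = (d.support.card.factorial : ℚ) := by
  induction hn : d.support.card generalizing d with
  | zero => simp_all
  | succ n ih =>
  rw [coeff_varSum_mul subset_rfl]
  have key : ∀ j ∈ d.support, coeff (d - Finsupp.single j 1)
      (secondDer (X : ι → MvPolynomial ι ℚ) 0 d.support) = (n.factorial : ℚ) := by
    intro j hj
    have hs : (d.erase j).support = d.support.erase j := Finsupp.support_erase
    have hc : (d.erase j).support.card = n := by
      rw [hs, Finset.card_erase_of_mem hj, hn]; rfl
    rw [sub_single_eq_erase (hd j hj), ← Finset.insert_erase hj,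
      coeff_secondDer_insert (Finset.notMem_erase j _) Finsupp.erase_same, ← hs]
    split_ifs with he
    · rw [he] at hc
      rw [Finsupp.support_eq_empty.1 he]
      simp [← hc]
    · refine ih (fun i hi => ?_) (fun h => he (by simp [h])) hc
      rw [hs] at hi
      rw [Finsupp.erase_ne (Finset.ne_of_mem_erase hi)]
      exact hd i (Finset.mem_of_mem_erase hi)
  rw [Finset.sum_congr rfl key, Finset.sum_const, hn, Nat.factorial_succ]
  simp

lemma card_le_degree (d : ι →₀ ℕ) : d.support.card ≤ d.degree := by
  rw [Finset.card_eq_sum_ones, Finsupp.degree_apply]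
  exact Finset.sum_le_sum fun i hi => Nat.one_le_iff_ne_zero.2 (Finsupp.mem_support_iff.1 hi)

lemma coeff_secondDer_support (d : ι →₀ ℕ) :
    coeff d (secondDer (X : ι → MvPolynomial ι ℚ) 0 d.support) = 0 := by
  rcases eq_or_ne d 0 with rfl | h
  · simp [secondDer_empty]
  · have h1 := card_le_degree d
    have h2 : 0 < d.support.card := by simpa [Finset.card_pos, Finset.nonempty_iff_ne_empty]
    exact (secondDer_zero_isHomogeneous d.support).coeff_eq_zero (by omega)

lemma coeff_varSum_mul_secondDer (d : ι →₀ ℕ) :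
    coeff d (varSum X d.support * secondDer X 0 d.support) =
      if d ≠ 0 ∧ ∀ j ∈ d.support, d j = 1 then (d.support.card.factorial : ℚ) else 0 := by
  split_ifs with h
  · exact coeff_varSum_mul_secondDer_of_ones h.2 h.1
  rcases eq_or_ne d 0 with rfl | h0
  · simp [secondDer_empty]
  have hne : ¬ ∀ j ∈ d.support, d j = 1 := fun h' => h ⟨h0, h'⟩
  have h2 : 0 < d.support.card := by simpa [Finset.card_pos, Finset.nonempty_iff_ne_empty]
  have hlt : d.support.card < d.degree := by
    refine lt_of_le_of_ne (card_le_degree d) fun he => hne fun j hj => ?_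
    rw [Finset.card_eq_sum_ones, Finsupp.degree_apply] at he
    exact ((Finset.sum_eq_sum_iff_of_le fun i hi =>
      Nat.one_le_iff_ne_zero.2 (Finsupp.mem_support_iff.1 hi)).1 he j hj).symm
  have hS : (varSum (X : ι → MvPolynomial ι ℚ) d.support).IsHomogeneous 1 :=
    IsHomogeneous.sum _ _ _ fun i _ => isHomogeneous_X _ _
  exact (hS.mul (secondDer_zero_isHomogeneous d.support)).coeff_eq_zero (by omega)

/-- The sum of `d j - 1` over the support of `d`. -/
def excess (d : ι →₀ ℕ) : ℕ := d.sum fun _ k => k - 1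

/-- The product of the double factorials `(2 d j - 1)‼`. -/
def oddFactorialProd (d : ι →₀ ℕ) : ℚ := d.prod fun _ k => ((2 * k - 1).doubleFactorial : ℚ)

lemma oddFactorialProd_ne_zero (d : ι →₀ ℕ) : oddFactorialProd d ≠ 0 :=
  Finset.prod_ne_zero_iff.2 fun _ _ => Nat.cast_ne_zero.2 (Nat.doubleFactorial_pos _).ne'

lemma excess_sub_single {d : ι →₀ ℕ} {j : ι} (hj : 2 ≤ d j) :
    excess (d - Finsupp.single j 1) + 1 = excess d ∧
    oddFactorialProd d = (2 * d j - 1) * oddFactorialProd (d - Finsupp.single j 1) ∧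
    (d - Finsupp.single j 1).support = d.support := by
  have hs : (d - Finsupp.single j 1).support = d.support := by
    ext i
    rcases eq_or_ne i j with rfl | h
    · simp; omega
    · simp [Finsupp.single_eq_of_ne h]
  have hm : j ∈ d.support := Finsupp.mem_support_iff.2 (by omega)
  have hne : ∀ i ∈ d.support.erase j, (d - Finsupp.single j 1 : ι →₀ ℕ) i = d i := fun i hi => by
    simp [Finsupp.single_eq_of_ne (Finset.ne_of_mem_erase hi)]
  have hjj : (d - Finsupp.single j 1 : ι →₀ ℕ) j = d j - 1 := by simp
  refine ⟨?_, ?_, hs⟩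
  · rw [excess, excess, Finsupp.sum, Finsupp.sum, hs, ← Finset.add_sum_erase _ _ hm,
      ← Finset.add_sum_erase d.support _ hm, Finset.sum_congr rfl fun i hi => by rw [hne i hi], hjj]
    omega
  · rw [oddFactorialProd, oddFactorialProd, Finsupp.prod, Finsupp.prod, hs,
      ← Finset.mul_prod_erase _ _ hm, ← Finset.mul_prod_erase d.support _ hm,
      Finset.prod_congr (f := fun i => ((2 * (d - Finsupp.single j 1 : ι →₀ ℕ) i - 1).doubleFactorial : ℚ))
        rfl fun i hi => by rw [hne i hi], hjj]
    obtain ⟨k, hk⟩ := Nat.exists_eq_add_of_le hj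
    rw [hk, show 2 * (2 + k) - 1 = (2 * (2 + k - 1) - 1) + 2 by omega,
      Nat.doubleFactorial_add_two, show 2 * (2 + k - 1) - 1 + 2 = 2 * k + 3 by omega]
    push_cast
    ring

lemma excess_filter {d : ι →₀ ℕ} {B : Finset ι} (hB : ∀ j ∈ B, d j = 1) :
    excess (d.filter (· ∉ B)) = excess d ∧
    oddFactorialProd (d.filter (· ∉ B)) = oddFactorialProd d ∧
    (d.filter (· ∉ B)).support = d.support \ B := by
  have hs : (d.filter (· ∉ B)).support = d.support \ B := by
    ext i; simp [and_comm]
  refine ⟨?_, ?_, hs⟩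
  · rw [excess, excess, Finsupp.sum, Finsupp.sum, hs]
    rw [← Finset.sum_subset (Finset.sdiff_subset (s := d.support) (t := B))
      fun i hi hi' => by
        rw [hB i (by simpa [Finsupp.mem_support_iff.1 hi] using hi')]; rfl]
    refine Finset.sum_congr rfl fun i hi => ?_
    rw [Finsupp.filter_apply_pos (· ∉ B) _ (Finset.mem_sdiff.1 hi).2]
  · rw [oddFactorialProd, oddFactorialProd, Finsupp.prod, Finsupp.prod, hs]
    rw [← Finset.prod_subset (Finset.sdiff_subset (s := d.support) (t := B))
      fun i hi hi' => by
        rw [hB i (by simpa [Finsupp.mem_support_iff.1 hi] using hi')]; simp]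
    refine Finset.prod_congr rfl fun i hi => ?_
    rw [Finsupp.filter_apply_pos (· ∉ B) _ (Finset.mem_sdiff.1 hi).2]

/-- The statement of the coefficient formula at genus `g`. -/
def CoeffFormula (ι : Type*) [DecidableEq ι] (N g : ℕ) : Prop :=
  ∀ d : ι →₀ ℕ, excess d = g → 4 ^ g * oddFactorialProd d *
    coeff d (pairLeading (X : ι → MvPolynomial ι ℚ) N g d.support) =
      ((N + 1).ascFactorial d.support.card : ℚ)

lemma CoeffFormula.varSum_mul {N g : ℕ} (h : CoeffFormula ι N g) {d : ι →₀ ℕ}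
    (hd : excess d = g + 1) {q m : ℕ} (hq : (d.support.filter (d · ≠ 1)).card = q)
    (hm : (d.support.filter (d · = 1)).card = m) :
    4 ^ g * oddFactorialProd d *
      coeff d (varSum X d.support * pairLeading (X : ι → MvPolynomial ι ℚ) N g d.support) *
        (N + q + 1) =
      (2 * (g + 1) + q) * ((N + 1).ascFactorial d.support.card : ℚ) *
        (N + d.support.card + 1) := by
  induction m using Nat.strong_induction_on generalizing d with
  | _ m ih =>
  rw [coeff_varSum_mul subset_rfl, ← Finset.sum_filter_not_add_sum_filter d.support (d · = 1)]
  set n := d.support.card with hn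
  set W : ℚ := 4 ^ g * oddFactorialProd d with hW
  set f : ι → ℚ := fun j => coeff (d - Finsupp.single j 1)
    (pairLeading (X : ι → MvPolynomial ι ℚ) N g d.support)
  have h1 : ∀ j ∈ d.support.filter (¬ d · = 1), W * f j =
      (2 * (d j - 1 : ℕ) + 1) * ((N + 1).ascFactorial n : ℚ) := by
    intro j hj
    rw [Finset.mem_filter, Finsupp.mem_support_iff] at hj
    obtain ⟨e1, e2, e3⟩ := excess_sub_single (d := d) (j := j) (by omega)
    have := h (d - Finsupp.single j 1) (by omega)
    rw [e3, ← hn] at this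
    rw [← this, hW, e2, Nat.cast_sub (by omega)]
    push_cast
    ring
  have h2 : ∀ j ∈ d.support.filter (d · = 1), W * f j * (N + q + 1) =
      (2 * (g + 1) + q) * ((N + 1).ascFactorial n : ℚ) := by
    intro j hj
    have hjm := Finset.card_pos.2 ⟨j, hj⟩
    obtain ⟨hjs, hj1⟩ := Finset.mem_filter.1 hj
    have hs : (d.erase j).support = d.support.erase j := Finsupp.support_erase
    have hd' : ∀ i ∈ d.support.erase j, d.erase j i = d i := fun i hi =>
      Finsupp.erase_ne (Finset.ne_of_mem_erase hi)
    have hef : d.erase j = d.filter (· ∉ ({j} : Finset ι)) := by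
      ext i; rcases eq_or_ne i j with rfl | h
      · simp
      · simp [Finsupp.erase_ne h, h]
    obtain ⟨e1, e2, e3⟩ := excess_filter (d := d) (B := {j}) (by simpa using hj1)
    rw [← hef] at e1 e2 e3
    have hc : (d.erase j).support.card + 1 = n := by
      rw [hs, Finset.card_erase_add_one hjs]
    have hfil : ∀ p : ℕ → Prop, ∀ [DecidablePred p],
        (d.erase j).support.filter (fun i => p (d.erase j i)) =
        (d.support.filter fun i => p (d i)).erase j := by
      intro p _
      rw [hs, ← Finset.filter_erase]
      exact Finset.filter_congr fun i hi => by rw [hd' i hi]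
    have := ih (m - 1) (by omega) (d := d.erase j) (by omega)
      (by rw [hfil (· ≠ 1), Finset.erase_eq_of_notMem (by simp [hj1]), hq])
      (by rw [hfil (· = 1), Finset.card_erase_of_mem hj, hm])
    rw [e2, ← hW] at this
    simp only [f]
    rw [sub_single_eq_erase hj1]
    nth_rewrite 1 [← Finset.insert_erase hjs]
    rw [coeff_pairLeading_insert (Finset.notMem_erase j _) Finsupp.erase_same, ← hs, this, ← hc,
      Nat.ascFactorial_succ]
    push_cast
    ring
  have hq' : ∑ j ∈ d.support.filter (¬ d · = 1), ((2 * (d j - 1 : ℕ) + 1 : ℚ)) =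
      2 * (g + 1) + q := by
    rw [Finset.sum_add_distrib, ← Finset.mul_sum, Finset.sum_const, hq]
    have : ∑ j ∈ d.support.filter (¬ d · = 1), (d j - 1) = g + 1 := by
      rw [← hd, excess, Finsupp.sum]
      refine Finset.sum_subset (Finset.filter_subset _ _) fun i hi hi' => ?_
      simp only [Finset.mem_filter, hi, true_and, not_not] at hi'
      simp [hi']
    rw [← Nat.cast_sum, this]
    simp
  have hnqm : n = q + m := by
    rw [hn, ← hq, ← hm, add_comm, Finset.card_filter_add_card_filter_not]
  have s1 : W * ∑ j ∈ d.support.filter (¬ d · = 1), f j =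
      (2 * (g + 1) + q) * ((N + 1).ascFactorial n : ℚ) := by
    rw [Finset.mul_sum, Finset.sum_congr rfl h1, ← Finset.sum_mul, hq']
  have s2 : W * (∑ j ∈ d.support.filter (d · = 1), f j) * (N + q + 1) =
      m * ((2 * (g + 1) + q) * ((N + 1).ascFactorial n : ℚ)) := by
    rw [Finset.mul_sum, Finset.sum_mul, Finset.sum_congr rfl h2, Finset.sum_const, hm,
      nsmul_eq_mul]
  have : (n : ℚ) = q + m := by exact_mod_cast hnqm
  rw [this]
  linear_combination (N + q + 1 : ℚ) * s1 + s2

lemma sum_factorial_mul_ascFactorial (N q m : ℕ) :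
    (∑ k ∈ Finset.range (m + 1), m.choose k * (k.factorial * (N + 1).ascFactorial (q + m - k))) *
      (N + q + 1) = (N + 1).ascFactorial (q + m + 1) := by
  induction m with
  | zero => simp [Nat.ascFactorial_succ]; ring
  | succ m ih =>
    have h : ∀ k ∈ Finset.range (m + 1), (m + 1).choose (k + 1) *
        ((k + 1).factorial * (N + 1).ascFactorial (q + (m + 1) - (k + 1))) =
        (m + 1) * (m.choose k * (k.factorial * (N + 1).ascFactorial (q + m - k))) := by
      intro k _
      rw [Nat.factorial_succ, show q + (m + 1) - (k + 1) = q + m - k by omega]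
      have := Nat.add_one_mul_choose_eq m k
      calc _ = ((m + 1).choose (k + 1) * (k + 1)) *
            (k.factorial * (N + 1).ascFactorial (q + m - k)) := by ring
        _ = _ := by rw [← this]; ring
    rw [Finset.sum_range_succ', Finset.sum_congr rfl h, ← Finset.mul_sum, add_mul, mul_assoc, ih,
      Nat.ascFactorial_succ (k := q + (m + 1))]
    simp
    ring

lemma coeff_boundary_term (N : ℤ) (g : ℕ) (d : ι →₀ ℕ) {B : Finset ι} (hB : B ⊆ d.support) :
    coeff d (secondDer (X : ι → MvPolynomial ι ℚ) 0 B *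
        (((N : MvPolynomial ι ℚ) + 1 - 2 * (g : MvPolynomial ι ℚ)) * varSum X B + varSum X (d.support \ B)) *
          pairLeading X N g (d.support \ B)) =
      if B ≠ ∅ ∧ ∀ j ∈ B, d j = 1 then (N + 1 - 2 * g) * (B.card.factorial : ℚ) *
        coeff (d.filter (· ∉ B)) (pairLeading (X : ι → MvPolynomial ι ℚ) N g (d.support \ B))
      else 0 := by
  have hX : ∀ A : Finset ι, ∀ i ∈ A, (X i : MvPolynomial ι ℚ) ∈ supported ℚ (A : Set ι) :=
    fun A i hi => X_mem_supported.2 hi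
  have hdisj : Disjoint B (d.support \ B) := Finset.disjoint_sdiff
  have hs : (d.filter (· ∈ B)).support = B := by
    ext i
    simp only [Finsupp.support_filter, Finset.mem_filter]
    exact ⟨fun h => h.2, fun h => ⟨hB h, h⟩⟩
  rw [show secondDer (X : ι → MvPolynomial ι ℚ) 0 B *
        (((N : MvPolynomial ι ℚ) + 1 - 2 * (g : MvPolynomial ι ℚ)) * varSum X B + varSum X (d.support \ B)) *
          pairLeading X N g (d.support \ B) =
      C ((N : ℚ) + 1 - 2 * g) * ((varSum X B * secondDer X 0 B) *
        pairLeading X N g (d.support \ B)) +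
      secondDer X 0 B * (varSum X (d.support \ B) * pairLeading X N g (d.support \ B)) by
    simp only [map_sub, map_add, map_mul, map_one, map_intCast, map_natCast, map_ofNat]
    ring, coeff_add, coeff_C_mul,
    coeff_mul_of_supported hdisj (mul_mem (varSum_mem _ (hX B)) (secondDer_mem _ (hX B) 0))
      (pairLeading_mem _ (hX _) N g),
    coeff_mul_of_supported hdisj (secondDer_mem _ (hX B) 0)
      (mul_mem (varSum_mem _ (hX _)) (pairLeading_mem _ (hX _) N g))]
  have e1 := coeff_secondDer_support (d.filter (· ∈ B))
  have e2 := coeff_varSum_mul_secondDer (d.filter (· ∈ B))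
  rw [hs] at e1 e2
  rw [e1, e2, zero_mul, add_zero]
  have hiff : (d.filter (· ∈ B) ≠ 0 ∧ ∀ j ∈ B, d.filter (· ∈ B) j = 1) ↔
      (B ≠ ∅ ∧ ∀ j ∈ B, d j = 1) := by
    refine and_congr ?_ (forall₂_congr fun j hj => by rw [Finsupp.filter_apply_pos _ _ hj])
    rw [Ne, ← Finsupp.support_eq_empty, hs]
  rw [if_congr hiff rfl rfl]
  split_ifs
  · ring
  · ring

theorem coeffFormula (N g : ℕ) : CoeffFormula ι N g := by
  induction g using Nat.strong_induction_on with
  | _ g ihg =>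
  intro d hd
  induction hn : d.support.card using Nat.strong_induction_on generalizing d with
  | _ n ih =>
  by_cases h0 : g = 0 ∧ n = 0
  · obtain ⟨rfl, rfl⟩ := h0
    rw [Finset.card_eq_zero, Finsupp.support_eq_empty] at hn
    subst hn
    simp [pairLeading_zero_empty, oddFactorialProd]
  obtain ⟨q, hq⟩ : ∃ q, (d.support.filter (d · ≠ 1)).card = q := ⟨_, rfl⟩
  obtain ⟨m, hm⟩ : ∃ m, (d.support.filter (d · = 1)).card = m := ⟨_, rfl⟩
  have hnqm : n = q + m := by
    rw [← hn, ← hq, ← hm, add_comm, Finset.card_filter_add_card_filter_not]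
  set W : ℚ := 4 ^ g * oddFactorialProd d with hW
  set A : ℚ := ((N + 1).ascFactorial n : ℚ) with hA
  set t : ℚ := coeff d (varSum X d.support *
    if g = 0 then 0 else pairLeading (X : ι → MvPolynomial ι ℚ) N (g - 1) d.support) with ht
  have h1 : W * t * (N + q + 1) = 4 * ((2 * g + q) * A * (N + n + 1)) := by
    rcases g with _ | g
    · have hq0 : q = 0 := by
        rw [← hq, Finset.card_eq_zero, Finset.filter_eq_empty_iff]
        intro j hj
        have : d j - 1 = 0 := (Finset.sum_eq_zero_iff.1 hd) j hj
        have := Finsupp.mem_support_iff.1 hj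
        simp only [not_not]
        omega
      simp [ht, hq0]
    · have := (ihg g (by omega)).varSum_mul hd hq hm
      rw [hn, ← hA] at this
      rw [ht, hW, if_neg (Nat.succ_ne_zero g), Nat.add_sub_cancel, pow_succ]
      push_cast
      linear_combination 4 * this
  have h2 : ∀ B ∈ d.support.powerset, W * coeff d (secondDer (X : ι → MvPolynomial ι ℚ) 0 B *
        ((((N : ℤ) : MvPolynomial ι ℚ) + 1 - 2 * (g : MvPolynomial ι ℚ)) * varSum X B + varSum X (d.support \ B)) *
          pairLeading X N g (d.support \ B)) =
      if B ≠ ∅ ∧ ∀ j ∈ B, d j = 1 then (N + 1 - 2 * g) * (B.card.factorial : ℚ) *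
        ((N + 1).ascFactorial (n - B.card) : ℚ) else 0 := by
    intro B hB
    have hB := Finset.mem_powerset.1 hB
    rw [coeff_boundary_term N g d hB]
    split_ifs with h
    · obtain ⟨e1, e2, e3⟩ := excess_filter h.2
      have hc : (d.support \ B).card = n - B.card := by rw [Finset.card_sdiff_of_subset hB, hn]
      have hpos := Finset.card_pos.2 (Finset.nonempty_iff_ne_empty.2 h.1)
      have hle := Finset.card_le_card hB
      have := ih (n - B.card) (by omega) (d.filter (· ∉ B)) (by rw [e1, hd]) (by rw [e3, hc])
      rw [e2, e3] at this
      rw [← this, hW]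
      push_cast
      ring
    · simp
  have h3 : ∑ B ∈ d.support.powerset, (if B ≠ ∅ ∧ ∀ j ∈ B, d j = 1 then
      (N + 1 - 2 * g) * (B.card.factorial : ℚ) * ((N + 1).ascFactorial (n - B.card) : ℚ) else 0) *
        (N + q + 1) = (N + 1 - 2 * g) * (A * (N + n + 1) - A * (N + q + 1)) := by
    have hsub : (d.support.filter (d · = 1)).powerset ⊆ d.support.powerset :=
      Finset.powerset_mono.2 (Finset.filter_subset _ _)
    rw [← Finset.sum_subset hsub fun B hB hB' => by
      rw [if_neg, zero_mul]
      rintro ⟨-, h⟩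
      exact hB' (Finset.mem_powerset.2 fun i hi =>
        Finset.mem_filter.2 ⟨Finset.mem_powerset.1 hB hi, h i hi⟩)]
    have h4 : ∀ B ∈ (d.support.filter (d · = 1)).powerset,
        (if B ≠ ∅ ∧ ∀ j ∈ B, d j = 1 then (N + 1 - 2 * g) * (B.card.factorial : ℚ) *
          ((N + 1).ascFactorial (n - B.card) : ℚ) else 0) * (N + q + 1) =
        (N + 1 - 2 * g) * ((B.card.factorial * (N + 1).ascFactorial (n - B.card) : ℕ) *
          (N + q + 1) - if B = ∅ then A * (N + q + 1) else 0) := by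
      intro B hB
      have hB1 : ∀ j ∈ B, d j = 1 := fun j hj =>
        (Finset.mem_filter.1 (Finset.mem_powerset.1 hB hj)).2
      rcases eq_or_ne B ∅ with rfl | hne
      · simp [hA]
      · rw [if_pos ⟨hne, hB1⟩, if_neg hne]
        push_cast
        ring
    have h5 := sum_factorial_mul_ascFactorial N q m
    rw [← hnqm] at h5
    rw [Finset.sum_congr rfl h4, ← Finset.mul_sum, Finset.sum_sub_distrib, ← Finset.sum_mul,
      ← Nat.cast_sum, Finset.sum_powerset_apply_card
        (fun k => k.factorial * (N + 1).ascFactorial (n - k)), hm,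
      Finset.sum_ite_eq' , if_pos (Finset.empty_mem_powerset _)]
    have h6 := congrArg (Nat.cast (R := ℚ)) h5
    rw [Nat.ascFactorial_succ] at h6
    simp only [smul_eq_mul]
    push_cast at h6 ⊢
    rw [h6]
    ring
  have r := congrArg (coeff d) (pairLeading_rec (X : ι → MvPolynomial ι ℚ) N g d.support)
  rw [show (2 * (g : MvPolynomial ι ℚ) + (d.support.card : MvPolynomial ι ℚ)) =
      C (2 * g + n : ℚ) by rw [hn, map_add, map_mul, map_natCast, map_natCast, map_ofNat],
    coeff_C_mul, coeff_add, mul_assoc (algebraMap _ _ _), algebraMap_eq, coeff_C_mul, coeff_sum,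
    ← ht] at r
  have r' := congrArg (W * ·) r
  beta_reduce at r'
  rw [mul_add W, Finset.mul_sum, Finset.sum_congr rfl h2] at r'
  rw [← Finset.sum_mul] at h3
  have hne1 : (N + q + 1 : ℚ) ≠ 0 := by positivity
  have hne2 : (2 * g + n : ℚ) ≠ 0 := by
    have : 0 < 2 * g + n := by omega
    exact_mod_cast this.ne'
  apply mul_left_cancel₀ hne1
  apply mul_left_cancel₀ hne2
  have hnq : (n : ℚ) = q + m := by exact_mod_cast hnqm
  rw [hnq] at h1 h3 r' ⊢
  linear_combination (N + q + 1 : ℚ) * r' + h1 / 4 + h3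

end Coefficients

lemma card_lt_of_ne_univ {n : ℕ} {I : Finset (Fin n)} (h : I ≠ univ) : I.card < n := by
  simpa using Finset.card_lt_card (Finset.ssubset_univ_iff.2 h)

lemma card_compl_lt_of_ne_empty {n : ℕ} {I : Finset (Fin n)} (h : I ≠ ∅) : Iᶜ.card < n :=
  card_lt_of_ne_univ (by simpa using h)

lemma Gf_fuel_irrel (f f' n g : ℕ) (h : n ≤ f) (h' : n ≤ f') : Gf f n g = Gf f' n g := by
  induction f generalizing f' n g with
  | zero =>
    obtain rfl : n = 0 := by omega
    cases f' <;> simp [Gf]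
  | succ f ih =>
    rcases n with _ | _ | n
    · simp [Gf]
    · cases g <;> simp [Gf]
    rcases f' with _ | f'
    · omega
    rw [Gf, Gf]
    refine Finset.sum_congr rfl fun s _ => ?_
    congr 3
    refine Finset.sum_congr rfl fun I _ => ?_
    split_ifs with hI
    · have h1 := card_lt_of_ne_univ hI.2
      have h2 := card_compl_lt_of_ne_empty hI.1
      congr 1
      refine Finset.sum_congr rfl fun r _ => ?_
      rw [ih f' _ _ (by omega) (by omega), ih f' _ _ (by omega) (by omega)]
    · rfl

lemma Gnpt_add_two (n g : ℕ) : Gnpt (n + 2) g = ∑ s ∈ Finset.range (g + 1),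
    (((Nat.doubleFactorial (2 * (g - s) + (n + 2) - 3) : ℚ) /
      (4 ^ s * (Nat.doubleFactorial (2 * g + (n + 2) - 1) : ℚ))) : K (n + 2)) *
    Ppoly (n + 2) (g - s) * Dlt (n + 2) ^ s := by
  rw [Gnpt, Gf]
  refine Finset.sum_congr rfl fun s _ => ?_
  refine congrArg (· * _) (congrArg (_ * ·) (congrArg (_ * ·) (Finset.sum_congr rfl fun I _ => ?_)))
  split_ifs with hI
  · have h1 := card_lt_of_ne_univ hI.2
    have h2 := card_compl_lt_of_ne_empty hI.1
    refine congrArg (_ * ·) (Finset.sum_congr rfl fun r _ => ?_)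
    rw [Gnpt, Gnpt, Gf_fuel_irrel (n + 1) I.card _ _ (by omega) le_rfl,
      Gf_fuel_irrel (n + 1) Iᶜ.card _ _ (by omega) le_rfl]
  · rfl

lemma doubleFactorial_eq_mul_sub_two {k : ℕ} (hk : 1 ≤ k) :
    k.doubleFactorial = k * (k - 2).doubleFactorial := by
  rcases k with _ | _ | k
  · omega
  · rfl
  · rw [Nat.doubleFactorial_add_two]; rfl

lemma Gnpt_rec {n : ℕ} (hn : 1 ≤ n) (g : ℕ) :
    (2 * g + n - 1 : K n) * Gnpt n g =
      Ppoly n g + Dlt n / 4 * (if g = 0 then 0 else Gnpt n (g - 1)) := by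
  rcases n with _ | _ | n
  · omega
  · have hP : Ppoly 1 g = 0 := by
      rw [Ppoly, Finset.sum_eq_zero, mul_zero]
      intro I _
      rw [if_neg]
      rintro ⟨h0, h1⟩
      rcases I.eq_empty_or_nonempty with h | ⟨i, hi⟩
      · exact h0 h
      · exact h1 (Finset.eq_univ_iff_forall.2 fun j => by rwa [Subsingleton.elim j i])
    have hD : Dlt 1 = 0 := by simp [Dlt, SX, SX3]
    rw [hP, hD]
    rcases g with _ | g
    · simp
    · simp [Gnpt, Gf]
  have hdf : ∀ k, ((Nat.doubleFactorial k : ℚ) : K (n + 2)) ≠ 0 := fun k => by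
    simpa using (Nat.doubleFactorial_pos k).ne'
  have hrec : ((Nat.doubleFactorial (2 * g + (n + 2) - 1) : ℚ) : K (n + 2)) =
      (2 * g + (n + 2 : ℕ) - 1 : K (n + 2)) *
        (Nat.doubleFactorial (2 * g + (n + 2) - 3) : ℚ) := by
    rw [doubleFactorial_eq_mul_sub_two (by omega),
      show 2 * g + (n + 2) - 1 = 2 * g + n + 1 by omega,
      show 2 * g + n + 1 - 2 = 2 * g + (n + 2) - 3 by omega]
    push_cast
    ring
  have hk : (2 * g + (n + 2 : ℕ) - 1 : K (n + 2)) ≠ 0 := fun h => by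
    rw [h, zero_mul] at hrec
    exact hdf _ hrec
  have hd1 := hdf (2 * g + (n + 2) - 3)
  rw [Gnpt_add_two, Finset.sum_range_succ', mul_add, add_comm (Ppoly _ _)]
  congr 1
  · rcases g with _ | g
    · simp
    rw [if_neg (Nat.succ_ne_zero g), Nat.add_sub_cancel, Gnpt_add_two, Finset.mul_sum,
      Finset.mul_sum]
    refine Finset.sum_congr rfl fun s hs => ?_
    rw [hrec, Nat.add_sub_add_right,
      show 2 * (g + 1) + (n + 2) - 3 = 2 * g + (n + 2) - 1 by omega] at *
    field_simp
    ring
  · rw [hrec, Nat.sub_zero]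
    field_simp

/-- The variables as elements of the field of rational functions. -/
def fracX (n : ℕ) (j : Fin n) : K n := algebraMap (R n) (K n) (X j)

lemma varSum_fracX {n : ℕ} (I : Finset (Fin n)) :
    varSum (fracX n) I = algebraMap (R n) (K n) (∑ i ∈ I, X i) := by
  rw [map_sum]; rfl

lemma SX_eq (n : ℕ) : SX n = varSum (fracX n) univ := by
  rw [varSum_fracX]; rfl

lemma SX3_eq (n : ℕ) : SX3 n = ∑ i, fracX n i ^ 3 := by
  simp [SX3, fracX]

lemma SX_ne_zero {n : ℕ} (hn : 1 ≤ n) : SX n ≠ 0 := by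
  intro h
  rw [SX, map_eq_zero_iff _ (IsFractionRing.injective (R n) (K n))] at h
  have := congrArg (eval fun j => if j = ⟨0, hn⟩ then (1 : ℚ) else 0) h
  simp at this

lemma emb_fracX {n : ℕ} (I : Finset (Fin n)) (i : Fin I.card) :
    emb I (fracX I.card i) = fracX n (I.orderEmbOfFin rfl i) := by
  rw [emb, fracX, IsFractionRing.lift_algebraMap]
  simp [embRH, fracX]

lemma emb_varSum {n : ℕ} (I : Finset (Fin n)) :
    emb I (SX I.card) = varSum (fracX n) I := by
  rw [SX_eq, map_varSum (emb I) (I.orderEmbOfFin rfl).toEmbedding (fun i _ => emb_fracX I i),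
    Finset.map_orderEmbOfFin_univ]

lemma emb_cubeSum {n : ℕ} (I : Finset (Fin n)) :
    emb I (SX3 I.card) = ∑ i ∈ I, fracX n i ^ 3 := by
  rw [SX3_eq, map_sum]
  conv_rhs => rw [← Finset.map_orderEmbOfFin_univ I rfl, Finset.sum_map]
  exact Finset.sum_congr rfl fun i _ => by rw [map_pow, emb_fracX]; rfl

lemma emb_secondDer {n : ℕ} (I : Finset (Fin n)) (g : ℕ) :
    emb I (secondDer (fracX I.card) g univ) = secondDer (fracX n) g I := by
  rw [map_secondDer (emb I) (I.orderEmbOfFin rfl).toEmbedding g (fun i _ => emb_fracX I i),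
    Finset.map_orderEmbOfFin_univ]

section Series

open PowerSeries (rescale exp)

/-- The power series `exp(c λ)`. -/
def expSeries {F : Type*} [Field F] [Algebra ℚ F] (c : F) : PowerSeries F := rescale c (exp F)

lemma expSeries_add {F : Type*} [Field F] [Algebra ℚ F] (a b : F) :
    expSeries (a + b) = expSeries a * expSeries b :=
  (PowerSeries.exp_mul_exp_eq_exp_add a b).symm

lemma genusOp_expSeries {F : Type*} [Field F] [Algebra ℚ F] (c : F) :
    genusOp (expSeries c) = 2 * PowerSeries.C c * PowerSeries.X * expSeries c := by
  ext g
  rw [coeff_genusOp, show (2 : PowerSeries F) * PowerSeries.C c * PowerSeries.X * expSeries c =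
    PowerSeries.X * (PowerSeries.C (2 * c) * expSeries c) by
    rw [map_mul, map_ofNat]; ring]
  rcases g with _ | g
  · simp
  · rw [PowerSeries.coeff_succ_X_mul, PowerSeries.coeff_C_mul, expSeries, PowerSeries.coeff_rescale,
      PowerSeries.coeff_rescale, PowerSeries.coeff_exp, PowerSeries.coeff_exp, Nat.factorial_succ]
    have : (g + 1 : F) ≠ 0 := by
      have : CharZero F := algebraRat.charZero F
      exact_mod_cast g.succ_ne_zero
    have : (g.factorial : F) ≠ 0 := by
      have : CharZero F := algebraRat.charZero F
      exact_mod_cast g.factorial_ne_zero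
    simp only [one_div, map_inv₀, map_natCast]
    push_cast
    field_simp
    ring

lemma mk_emb_Fnpt {n : ℕ} (I : Finset (Fin n)) :
    (PowerSeries.mk fun g => emb I (Fnpt I.card g)) =
      expSeries ((∑ i ∈ I, fracX n i ^ 3) / 24) *
        PowerSeries.mk fun g => emb I (Gnpt I.card g) := by
  ext g
  rw [PowerSeries.coeff_mk, PowerSeries.coeff_mul,
    Finset.Nat.sum_antidiagonal_eq_sum_range_succ (fun a b =>
      PowerSeries.coeff a (expSeries ((∑ i ∈ I, fracX n i ^ 3) / 24)) *
      PowerSeries.coeff b (PowerSeries.mk fun g => emb I (Gnpt I.card g))), Fnpt, map_sum]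
  refine Finset.sum_congr rfl fun d _ => ?_
  rw [PowerSeries.coeff_mk, expSeries, PowerSeries.coeff_rescale, PowerSeries.coeff_exp,
    ← emb_cubeSum]
  simp only [map_mul, map_pow, map_div₀, map_one, map_ofNat, map_natCast,
    Rat.cast_natCast]
  ring

lemma mk_Fnpt (n : ℕ) :
    PowerSeries.mk (Fnpt n) = expSeries (SX3 n / 24) * PowerSeries.mk (Gnpt n) := by
  ext g
  rw [PowerSeries.coeff_mk, PowerSeries.coeff_mul,
    Finset.Nat.sum_antidiagonal_eq_sum_range_succ (fun a b =>
      PowerSeries.coeff a (expSeries (SX3 n / 24)) *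
      PowerSeries.coeff b (PowerSeries.mk (Gnpt n))), Fnpt]
  refine Finset.sum_congr rfl fun d _ => ?_
  rw [PowerSeries.coeff_mk, expSeries, PowerSeries.coeff_rescale, PowerSeries.coeff_exp]
  simp only [map_div₀, map_one, map_natCast, Rat.cast_natCast]
  ring

lemma mk_Ppoly (n : ℕ) :
    PowerSeries.mk (Ppoly n) = PowerSeries.C (2 * SX n)⁻¹ * ∑ I : Finset (Fin n),
      if I ≠ ∅ ∧ I ≠ univ then
        PowerSeries.C (varSum (fracX n) I ^ 2) * PowerSeries.C (varSum (fracX n) Iᶜ ^ 2) *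
          ((PowerSeries.mk fun g => emb I (Gnpt I.card g)) *
            PowerSeries.mk fun g => emb Iᶜ (Gnpt Iᶜ.card g))
      else 0 := by
  ext g
  rw [PowerSeries.coeff_mk, PowerSeries.coeff_C_mul, map_sum, Ppoly]
  congr 1
  refine Finset.sum_congr rfl fun I _ => ?_
  split_ifs
  · rw [← map_mul, PowerSeries.coeff_C_mul, PowerSeries.coeff_mul,
      Finset.Nat.sum_antidiagonal_eq_sum_range_succ (fun a b =>
        PowerSeries.coeff a (PowerSeries.mk fun g => emb I (Gnpt I.card g)) *
        PowerSeries.coeff b (PowerSeries.mk fun g => emb Iᶜ (Gnpt Iᶜ.card g)))]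
    simp only [PowerSeries.coeff_mk, varSum_fracX]
  · simp

lemma mk_Gnpt_rec {n : ℕ} (hn : 1 ≤ n) :
    genusOp (PowerSeries.mk (Gnpt n)) + (n - 1 : PowerSeries (K n)) * PowerSeries.mk (Gnpt n) =
      PowerSeries.mk (Ppoly n) +
        PowerSeries.X * (PowerSeries.C (Dlt n / 4) * PowerSeries.mk (Gnpt n)) := by
  ext g
  have e : (n - 1 : PowerSeries (K n)) = PowerSeries.C (n - 1 : K n) := by simp
  have h := Gnpt_rec hn g
  rw [e, map_add, map_add, coeff_genusOp, PowerSeries.coeff_C_mul]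
  rcases g with _ | g
  · simp at h ⊢
    linear_combination h
  · rw [PowerSeries.coeff_succ_X_mul, PowerSeries.coeff_C_mul]
    simp at h ⊢
    linear_combination h

theorem SX_sq_mul_Fnpt (n g : ℕ) : SX n ^ 2 * Fnpt n g = secondDer (fracX n) g univ := by
  induction n using Nat.strong_induction_on generalizing g with
  | _ n ih =>
  rcases Nat.eq_zero_or_pos n with rfl | hn
  · rw [Finset.univ_eq_empty, secondDer_empty, SX_eq, Finset.univ_eq_empty, varSum_empty]
    simp
  set S := SX n with hS
  have hS0 : S ≠ 0 := SX_ne_zero hn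
  set F := PowerSeries.mk (Fnpt n) with hF
  have hI : ∀ I : Finset (Fin n), I ≠ univ → PowerSeries.C (varSum (fracX n) I ^ 2) *
      (expSeries ((∑ i ∈ I, fracX n i ^ 3) / 24) *
        PowerSeries.mk fun g => emb I (Gnpt I.card g)) = secondDerSeries (fracX n) I := by
    intro I hI
    rw [← mk_emb_Fnpt]
    ext g
    rw [PowerSeries.coeff_C_mul, PowerSeries.coeff_mk, secondDerSeries, PowerSeries.coeff_mk,
      ← emb_varSum, ← emb_secondDer, ← ih _ (card_lt_of_ne_univ hI), map_mul, map_pow]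
  have h1 : genusOp F + (n - 1 : PowerSeries (K n)) * F =
      PowerSeries.X * PowerSeries.C (S ^ 3 / 12) * F +
        expSeries (SX3 n / 24) * PowerSeries.mk (Ppoly n) := by
    have e : PowerSeries.C (Dlt n / 4) + 2 * PowerSeries.C (SX3 n / 24) =
        PowerSeries.C (S ^ 3 / 12) := by
      rw [← map_ofNat (PowerSeries.C (R := K n)) 2, ← map_mul, ← map_add, Dlt, hS]
      congr 1
      ring
    rw [hF, mk_Fnpt, Derivation.leibniz, genusOp_expSeries, smul_eq_mul, smul_eq_mul, ← e]
    linear_combination expSeries (SX3 n / 24) * mk_Gnpt_rec hn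
  have h2 : PowerSeries.C (S ^ 2) * (expSeries (SX3 n / 24) * PowerSeries.mk (Ppoly n)) =
      PowerSeries.C (algebraMap ℚ (K n) (1 / 2) * S) * ∑ I ∈ (univ : Finset (Fin n)).powerset,
        secondDerSeries (fracX n) I * secondDerSeries (fracX n) (univ \ I) := by
    rw [mk_Ppoly, mul_left_comm (expSeries _), ← mul_assoc, ← map_mul, Finset.mul_sum,
      Finset.powerset_univ]
    congr 1
    · congr 1
      rw [map_div₀, map_one, map_ofNat, ← hS]
      field_simp
    refine Finset.sum_congr rfl fun I _ => ?_
    rw [← Finset.compl_eq_univ_sdiff]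
    split_ifs with h
    · rw [← hI I h.2, ← hI Iᶜ (by simpa using h.1), SX3_eq, ← Finset.sum_add_sum_compl I, add_div,
        expSeries_add]
      ring
    · rw [mul_zero]
      rw [not_and_or, not_not, not_not] at h
      rcases h with rfl | rfl <;> simp [secondDerSeries_empty]
  set D := PowerSeries.C (S ^ 2) * F - secondDerSeries (fracX n) univ with hD
  have h3 : genusOp D + (n - 1 : PowerSeries (K n)) * D =
      PowerSeries.X * (PowerSeries.C (S ^ 3 / 12) * D) := by
    have r := secondDerSeries_rec (fracX n) (univ : Finset (Fin n))
    rw [← SX_eq, ← hS, Finset.card_univ, Fintype.card_fin, show algebraMap ℚ (K n) (1 / 12) * S ^ 3 =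
      S ^ 3 / 12 by rw [map_div₀, map_one, map_ofNat]; ring] at r
    have hsmul : genusOp (PowerSeries.C (S ^ 2) * F) = PowerSeries.C (S ^ 2) * genusOp F := by
      ext m
      rw [coeff_genusOp, PowerSeries.coeff_C_mul, PowerSeries.coeff_C_mul, coeff_genusOp]
      ring
    rw [hD, map_sub, hsmul]
    linear_combination PowerSeries.C (S ^ 2) * h1 + h2 - r
  have h4 : ∀ g, PowerSeries.coeff g D = 0 := by
    have e : (n - 1 : PowerSeries (K n)) = PowerSeries.C (n - 1 : K n) := by simp
    have h5 := fun m => congrArg (PowerSeries.coeff m) h3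
    simp only [e, map_add, coeff_genusOp, PowerSeries.coeff_C_mul, ← add_mul] at h5
    intro m
    induction m with
    | zero =>
      by_cases h : n = 1
      · subst h
        have hX : S = fracX 1 0 := by rw [hS, SX_eq]; simp [varSum]
        have hu : (univ : Finset (Fin 1)) = {0} := rfl
        rw [hD, map_sub, PowerSeries.coeff_C_mul, hF, secondDerSeries, PowerSeries.coeff_mk,
          PowerSeries.coeff_mk, hu, secondDer_zero_singleton, Fnpt, hX, sub_eq_zero]
        rw [hX] at hS0
        simp only [zero_add, Finset.range_one, Finset.sum_singleton, Gnpt, Gf, pow_zero,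
          Nat.factorial_zero, Nat.cast_one, div_one, Rat.cast_one, one_mul, tsub_self]
        change fracX 1 0 ^ 2 * fracX 1 0 ^ (-2 : ℤ) = 1
        rw [← zpow_natCast, ← zpow_add₀ hS0]
        rfl
      · have h6 := h5 0
        rw [PowerSeries.coeff_zero_X_mul] at h6
        refine (mul_eq_zero.1 h6).resolve_left ?_
        rw [Nat.cast_zero, mul_zero, zero_add, sub_eq_zero]
        exact_mod_cast h
    | succ m ihm =>
      have h6 := h5 (m + 1)
      rw [PowerSeries.coeff_succ_X_mul, PowerSeries.coeff_C_mul, ihm, mul_zero] at h6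
      refine (mul_eq_zero.1 h6).resolve_left ?_
      have : (2 * (m + 1 : ℕ) + (n - 1) : K n) = ((2 * m + 1 + n : ℕ) : K n) := by
        push_cast; ring
      rw [this, Nat.cast_eq_zero]
      omega
  have := h4 g
  rw [hD, map_sub, PowerSeries.coeff_C_mul, hF, secondDerSeries, PowerSeries.coeff_mk,
    PowerSeries.coeff_mk] at this
  exact sub_eq_zero.1 this

end Series

section NPoint

/-- The polynomial `F_g(x_1,…,x_n)` for `2g + n ≥ 3`, and `0` otherwise. -/
def nPoint (n g : ℕ) : R n :=
  if h : 3 ≤ 2 * g + n then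
    (exists_varSum_sq_mul (X : Fin n → R n) (A := univ) (by simpa using h)).choose
  else 0

lemma varSum_sq_mul_nPoint {n g : ℕ} (h : 3 ≤ 2 * g + n) :
    varSum (X : Fin n → R n) univ ^ 2 * nPoint n g = secondDer X g univ := by
  rw [nPoint, dif_pos h]
  exact (exists_varSum_sq_mul (X : Fin n → R n) (A := univ) (by simpa using h)).choose_spec

lemma algebraMap_nPoint {n g : ℕ} (hn : 1 ≤ n) (h : 3 ≤ 2 * g + n) :
    algebraMap (R n) (K n) (nPoint n g) = Fnpt n g := by
  have hφ : ∀ i ∈ (univ : Finset (Fin n)), algebraMap (R n) (K n) (X i) =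
      fracX n (Function.Embedding.refl _ i) := fun i _ => rfl
  have e := congrArg (algebraMap (R n) (K n)) (varSum_sq_mul_nPoint h)
  rw [map_mul, map_pow, map_varSum _ (Function.Embedding.refl _) hφ,
    map_secondDer _ (Function.Embedding.refl _) g hφ, Finset.map_refl, ← SX_sq_mul_Fnpt,
    ← SX_eq] at e
  exact mul_left_cancel₀ (pow_ne_zero 2 (SX_ne_zero hn)) e

lemma bracket_eq_coeff {n : ℕ} (g : ℕ) (hn : 1 ≤ n) (d : Fin n → ℕ) :
    bracket g d = coeff (Finsupp.equivFunOnFinite.symm d) (nPoint n g) := by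
  by_cases h : 3 ≤ 2 * g + n
  · have hex : ∃ p : R n, algebraMap (R n) (K n) p = Fnpt n g := ⟨_, algebraMap_nPoint hn h⟩
    rw [bracket, if_neg (by omega), coeffK, dif_pos hex]
    congr 1
    apply IsFractionRing.injective (R n) (K n)
    rw [hex.choose_spec, algebraMap_nPoint hn h]
  · rw [bracket, if_pos (by omega), nPoint, dif_neg h, coeff_zero]

lemma zpow_mul_secondDer {ι F : Type*} [DecidableEq ι] [Field F] [Algebra ℚ F] (x : ι → F)
    {m g : ℕ} (e : Fin m ↪ ι) (h : 3 ≤ 2 * g + m) (hx : varSum x (univ.map e) ≠ 0) :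
    varSum x (univ.map e) ^ (-2 : ℤ) * secondDer x g (univ.map e) =
      aeval (fun i => x (e i)) (nPoint m g) := by
  have hφ : ∀ i ∈ (univ : Finset (Fin m)),
      (aeval fun i => x (e i) : R m →ₐ[ℚ] F).toRingHom (X i) = x (e i) := fun i _ => by simp
  have h1 := congrArg (aeval fun i => x (e i) : R m →ₐ[ℚ] F).toRingHom (varSum_sq_mul_nPoint h)
  rw [map_mul, map_pow, map_varSum _ e hφ, map_secondDer _ e g hφ] at h1
  rw [← h1, ← mul_assoc, ← zpow_natCast, ← zpow_add₀ hx]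
  simp

lemma rename_nPoint {n : ℕ} (g : ℕ) (hn : 1 ≤ n) (σ : Equiv.Perm (Fin n)) :
    rename σ (nPoint n g) = nPoint n g := by
  by_cases h : 3 ≤ 2 * g + n
  · have hφ : ∀ i ∈ (univ : Finset (Fin n)),
        (rename σ : R n →ₐ[ℚ] R n).toRingHom (X i) = X (σ.toEmbedding i) := fun i _ => by simp
    have h1 := congrArg (rename σ : R n →ₐ[ℚ] R n).toRingHom (varSum_sq_mul_nPoint h)
    rw [map_mul, map_pow, map_varSum _ _ hφ, map_secondDer _ _ g hφ, Finset.map_univ_equiv,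
      ← varSum_sq_mul_nPoint h] at h1
    refine mul_left_cancel₀ (pow_ne_zero 2 fun h0 => SX_ne_zero hn ?_) h1
    rw [SX]
    exact (congrArg _ h0).trans (map_zero _)
  · rw [nPoint, dif_neg h, map_zero]

lemma bracket_comp_perm {n : ℕ} (g : ℕ) (hn : 1 ≤ n) (σ : Equiv.Perm (Fin n)) (d : Fin n → ℕ) :
    bracket g (d ∘ σ) = bracket g d := by
  rw [bracket_eq_coeff g hn, bracket_eq_coeff g hn, 
    ← coeff_rename_mapDomain σ σ.injective]
  congr 1
  · ext i
    rw [← Finsupp.equivMapDomain_eq_mapDomain]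
    simp
  · exact rename_nPoint g hn σ

end NPoint

section HasCoeff

variable {n : ℕ}

/-- The coefficient of `y^m` in `f` is a polynomial, in which `x^D` has coefficient `c`. -/
def HasCoeff (m : ℤ) (D : Fin n →₀ ℕ) (f : LaurentSeries (K n)) (c : ℚ) : Prop :=
  ∃ q : R n, f.coeff (-m) = algebraMap (R n) (K n) q ∧ coeff D q = c

lemma HasCoeff.unique {m : ℤ} {D : Fin n →₀ ℕ} {f : LaurentSeries (K n)} {c c' : ℚ}
    (h : HasCoeff m D f c) (h' : HasCoeff m D f c') : c = c' := by
  obtain ⟨q, hq, rfl⟩ := h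
  obtain ⟨q', hq', rfl⟩ := h'
  rw [IsFractionRing.injective (R n) (K n) (hq.symm.trans hq')]

lemma HasCoeff.sum {κ : Type*} {m : ℤ} {D : Fin n →₀ ℕ} {s : Finset κ}
    {f : κ → LaurentSeries (K n)} {c : κ → ℚ} (h : ∀ i ∈ s, HasCoeff m D (f i) (c i)) :
    HasCoeff m D (∑ i ∈ s, f i) (∑ i ∈ s, c i) := by
  classical
  induction s using Finset.induction_on with
  | empty => exact ⟨0, by simp⟩
  | insert a s ha ih =>
    obtain ⟨q, hq, hc⟩ := ih fun i hi => h i (mem_insert_of_mem hi)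
    obtain ⟨q', hq', hc'⟩ := h a (mem_insert_self _ _)
    refine ⟨q' + q, ?_, ?_⟩
    · rw [sum_insert ha, HahnSeries.coeff_add, hq, hq', map_add]
    · rw [coeff_add, sum_insert ha, hc, hc']

/-- Evaluation at `y` of a polynomial with coefficients in `ℚ[x_1,…,x_n]`. -/
def evalY (n : ℕ) : Polynomial (R n) →+* LaurentSeries (K n) :=
  Polynomial.eval₂RingHom (HahnSeries.C.comp (algebraMap (R n) (K n))) (yVar (K n))

lemma coeff_mul_yVar_pow (f : LaurentSeries (K n)) (b : ℕ) (m : ℤ) :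
    (f * yVar (K n) ^ b).coeff m = f.coeff (m + b) := by
  rw [← zpow_natCast, yVar_zpow]
  have := HahnSeries.coeff_mul_single_add (r := (1 : K n)) (x := f) (a := m + b) (b := -(b : ℤ))
  rwa [add_neg_cancel_right, mul_one] at this

lemma coeff_mul_evalY (f : LaurentSeries (K n)) (Q : Polynomial (R n)) {N : ℕ}
    (hN : Q.natDegree < N) (m : ℤ) :
    (f * evalY n Q).coeff m =
      ∑ b ∈ range N, algebraMap (R n) (K n) (Q.coeff b) * f.coeff (m + b) := by
  rw [evalY, Polynomial.coe_eval₂RingHom, Polynomial.eval₂_eq_sum_range' _ hN, Finset.mul_sum,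
    HahnSeries.coeff_sum]
  refine Finset.sum_congr rfl fun b _ => ?_
  rw [mul_left_comm, RingHom.comp_apply, HahnSeries.C_mul_eq_smul, HahnSeries.coeff_smul,
    coeff_mul_yVar_pow, smul_eq_mul]

lemma coeff_evalY (Q : Polynomial (R n)) (m : ℕ) :
    (evalY n Q).coeff (-m) = algebraMap (R n) (K n) (Q.coeff m) := by
  have := coeff_mul_evalY 1 Q (N := Q.natDegree + m + 1) (by omega) (-m)
  rw [one_mul] at this
  rw [this, Finset.sum_eq_single m]
  · simp
  · intro b _ hb
    rw [HahnSeries.coeff_one, if_neg (by omega), mul_zero]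
  · intro h
    exact absurd (mem_range.2 (by omega)) h

end HasCoeff

section NPointY

variable {n m : ℕ}

/-- The polynomial `F_g(ε y, x_{e 1}, …, x_{e m})` in `y`. -/
def nPointY (ε : ℤ) (e : Fin m ↪ Fin n) (g : ℕ) : Polynomial (R n) :=
  ((finSuccEquiv ℚ m (nPoint (m + 1) g)).map (rename e : R m →ₐ[ℚ] R n).toRingHom).comp
    (Polynomial.C (ε : R n) * Polynomial.X)

lemma nPointY_coeff (ε : ℤ) (e : Fin m ↪ Fin n) (g b : ℕ) :
    (nPointY ε e g).coeff b =
      rename e ((finSuccEquiv ℚ m (nPoint (m + 1) g)).coeff b) * (ε : R n) ^ b := by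
  rw [nPointY, Polynomial.comp_C_mul_X_coeff, Polynomial.coeff_map]
  rfl

lemma nPointY_coeff_mem_supported (ε : ℤ) (e : Fin m ↪ Fin n) (g b : ℕ) :
    (nPointY ε e g).coeff b ∈ supported ℚ ((univ.map e : Finset (Fin n)) : Set (Fin n)) := by
  rw [nPointY_coeff]
  refine mul_mem ?_ (pow_mem (intCast_mem _ _) _)
  rw [mem_supported]
  intro i hi
  have := vars_rename e _ hi
  simp only [Finset.mem_image] at this
  obtain ⟨a, -, rfl⟩ := this
  simp

lemma equivFunOnFinite_symm_cons (b : ℕ) (d : Fin m → ℕ) :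
    Finsupp.equivFunOnFinite.symm (Fin.cons b d : Fin (m + 1) → ℕ) =
      Finsupp.cons b (Finsupp.equivFunOnFinite.symm d) := by
  ext i
  refine Fin.cases ?_ (fun i => ?_) i <;> simp

lemma coeff_nPointY (ε : ℤ) (e : Fin m ↪ Fin n) (g b : ℕ) (D : Fin n →₀ ℕ) :
    coeff (D.filter (· ∈ univ.map e)) ((nPointY ε e g).coeff b) =
      (ε : ℚ) ^ b * bracket g (Fin.cons b fun i => D (e i) : Fin (m + 1) → ℕ) := by
  have hD : D.filter (· ∈ univ.map e) =
      Finsupp.mapDomain e (Finsupp.equivFunOnFinite.symm fun i => D (e i)) := by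
    ext i
    by_cases hi : i ∈ univ.map e
    · rw [Finsupp.filter_apply_pos _ _ hi]
      obtain ⟨a, -, rfl⟩ := Finset.mem_map.1 hi
      rw [Finsupp.mapDomain_apply e.injective]
      simp
    · rw [Finsupp.filter_apply_neg _ _ hi, Finsupp.mapDomain_of_notMem_range]
      simpa using hi
  rw [nPointY_coeff, show (ε : R n) ^ b = C ((ε : ℚ) ^ b) by simp, mul_comm, coeff_C_mul, hD,
    coeff_rename_mapDomain e e.injective, finSuccEquiv_coeff_coeff,
    bracket_eq_coeff g (Nat.le_add_left 1 m), equivFunOnFinite_symm_cons]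

lemma evalY_nPointY (ε : ℤ) (e : Fin m ↪ Fin n) (g : ℕ) :
    evalY n (nPointY ε e g) =
      aeval (Fin.cons ((ε : LaurentSeries (K n)) * yVar (K n))
        (fun i => HahnSeries.C (fracX n (e i))) : Fin (m + 1) → LaurentSeries (K n))
        (nPoint (m + 1) g) := by
  have h : (((evalY n).comp (Polynomial.compRingHom (Polynomial.C (ε : R n) * Polynomial.X))).comp
      (Polynomial.mapRingHom (rename e : R m →ₐ[ℚ] R n).toRingHom)).comp
      (finSuccEquiv ℚ m).toRingEquiv.toRingHom =
      (aeval (Fin.cons ((ε : LaurentSeries (K n)) * yVar (K n))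
        (fun i => HahnSeries.C (fracX n (e i))) : Fin (m + 1) → LaurentSeries (K n)) :
          R (m + 1) →ₐ[ℚ] LaurentSeries (K n)).toRingHom := by
    refine MvPolynomial.ringHom_ext (fun r => ?_) (fun i => ?_)
    · rw [← RingHom.comp_apply _ C, ← RingHom.comp_apply _ C]
      exact DFunLike.congr_fun (Subsingleton.elim _ _) r
    · refine Fin.cases ?_ (fun i => ?_) i
      · have h1 : (evalY n) (ε : Polynomial (R n)) = (ε : LaurentSeries (K n)) := map_intCast _ _
        have h2 : evalY n Polynomial.X = yVar (K n) := by simp [evalY]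
        simp [finSuccEquiv_X_zero, h1, h2]
      · simp [evalY, finSuccEquiv_X_succ, fracX]
  exact DFunLike.congr_fun h (nPoint (m + 1) g)

end NPointY

section PointY

variable {n m : ℕ}

lemma neg_one_cast_mul_yVar (k : Type*) [Field k] :
    ((-1 : ℤ) : LaurentSeries k) * yVar k = -yVar k := by simp

lemma one_cast_mul_yVar (k : Type*) [Field k] :
    ((1 : ℤ) : LaurentSeries k) * yVar k = yVar k := by simp

lemma eps_yVar_add_C_ne_zero {k : Type*} [Field k] {ε : ℤ} (hε : ε = 1 ∨ ε = -1) (c : k) :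
    (ε : LaurentSeries k) * yVar k + HahnSeries.C c ≠ 0 := by
  rcases hε with rfl | rfl
  · simpa using yVar_add_C_ne_zero c
  · simpa using neg_yVar_add_C_ne_zero c

/-- The variables `x_1, …, x_n` placed at the nonzero indices of `Fin (n + 1)`. -/
def shiftX (n : ℕ) : Fin (n + 1) → K n := Fin.cons 0 (fracX n)

/-- The rational function `F_g(ε y, x_I)`, expanded at `y = ∞`. -/
def pointY (ε : ℤ) (g : ℕ) (I : Finset (Fin n)) : LaurentSeries (K n) :=
  ((ε : LaurentSeries (K n)) * yVar (K n) + HahnSeries.C (varSum (fracX n) I)) ^ (-2 : ℤ) *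
    secondDer (Function.update (fun i => HahnSeries.C (shiftX n i)) 0
      ((ε : LaurentSeries (K n)) * yVar (K n))) g (insert 0 (I.map (Fin.succEmb n)))

lemma zero_notMem_map_succEmb (I : Finset (Fin n)) : (0 : Fin (n + 1)) ∉ I.map (Fin.succEmb n) := by
  simp

lemma varSum_shiftX (I : Finset (Fin n)) :
    varSum (shiftX n) (I.map (Fin.succEmb n)) = varSum (fracX n) I := by
  simp [varSum, shiftX]

lemma varSum_update_shiftX (y : LaurentSeries (K n)) (I : Finset (Fin n)) :
    varSum (Function.update (fun i => HahnSeries.C (shiftX n i)) 0 y)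
      (insert 0 (I.map (Fin.succEmb n))) = y + HahnSeries.C (varSum (fracX n) I) := by
  rw [varSum_update_insert _ (zero_notMem_map_succEmb I), map_C_varSum, varSum_shiftX]

lemma pointY_eq_evalY {ε : ℤ} (hε : ε = 1 ∨ ε = -1) {g : ℕ} (e : Fin m ↪ Fin n)
    (h : 2 ≤ 2 * g + m) : pointY ε g (univ.map e) = evalY n (nPointY ε e g) := by
  let e' : Fin (m + 1) ↪ Fin (n + 1) := ⟨Fin.cons 0 fun i => (e i).succ, by
    rw [Fin.cons_injective_iff]
    exact ⟨by simp [Fin.succ_ne_zero], (Fin.succ_injective n).comp e.injective⟩⟩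
  have he' : univ.map e' = insert 0 ((univ.map e).map (Fin.succEmb n)) := by
    ext i
    simp [e', Fin.exists_fin_succ, eq_comm]
  rw [evalY_nPointY, pointY, ← varSum_update_shiftX, ← he', zpow_mul_secondDer _ e' (by omega)]
  · congr 2
    ext1 i
    refine Fin.cases ?_ (fun i => ?_) i <;> simp [e', shiftX]
  · rw [he', varSum_update_shiftX]
    exact eps_yVar_add_C_ne_zero hε _

lemma pairWeight_shiftX (g : ℕ) (I : Finset (Fin n)) :
    pairWeight (fun i => HahnSeries.C (shiftX n i)) 0 (yVar (K n)) g
      (univ.map (Fin.succEmb n)) (I.map (Fin.succEmb n)) =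
      ∑ p ∈ antidiagonal g, pointY 1 p.1 I * pointY (-1) p.2 Iᶜ := by
  rw [pairWeight, map_C_varSum, map_C_varSum, ← Finset.map_sdiff, varSum_shiftX, varSum_shiftX,
    ← Finset.compl_eq_univ_sdiff, Finset.mul_sum]
  refine Finset.sum_congr rfl fun p _ => ?_
  rw [pointY, pointY]
  rw [one_cast_mul_yVar, neg_one_cast_mul_yVar]
  ring

lemma pointY_zero_empty {ε : ℤ} (hε : ε = 1 ∨ ε = -1) :
    pointY ε 0 (∅ : Finset (Fin n)) = yVar (K n) ^ (-2 : ℤ) := by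
  rw [pointY, Finset.map_empty, insert_empty_eq, secondDer_zero_singleton, varSum_empty, map_zero,
    add_zero, mul_one]
  rcases hε with rfl | rfl
  · simp
  · rw [neg_one_cast_mul_yVar]
    simp only [zpow_neg, zpow_ofNat]
    ring

lemma secondDer_zero_pair {ι C : Type*} [DecidableEq ι] [CommRing C] [Algebra ℚ C] (x : ι → C)
    {i j : ι} (h : i ≠ j) : secondDer x 0 {i, j} = varSum x {i, j} := by
  have hc : ({i, j} : Finset ι).card = 2 := Finset.card_pair h
  have r := secondDer_zero_rec x {i, j}
  have h1 : ({i, j} : Finset ι) \ {i} = {j} := by ext; simp; grind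
  have h2 : ({i, j} : Finset ι) \ {j} = {i} := by ext; simp; grind
  rw [hc, Finset.sum_powerset_insert (by simpa using h), show ({j} : Finset ι).powerset = {∅, {j}} from rfl,
    Finset.sum_pair (Finset.singleton_ne_empty j).symm,
    Finset.sum_pair (Finset.singleton_ne_empty j).symm] at r
  simp only [Finset.sdiff_empty, insert_empty_eq, secondDer_empty, h1, h2, zero_mul, zero_add,
    secondDer_zero_singleton, mul_one, Finset.sdiff_self, mul_zero, add_zero] at r
  have h7 := algebraMap_half_mul_two (C := C)
  push_cast at r
  linear_combination r + varSum x {i, j} * h7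

lemma pointY_zero_singleton {ε : ℤ} (hε : ε = 1 ∨ ε = -1) (i : Fin n) :
    pointY ε 0 {i} = ((ε : LaurentSeries (K n)) * yVar (K n) + HahnSeries.C (fracX n i))⁻¹ := by
  have h0 := eps_yVar_add_C_ne_zero hε (fracX n i)
  have hv : varSum (fracX n) {i} = fracX n i := by simp [varSum]
  have h1 := varSum_update_shiftX ((ε : LaurentSeries (K n)) * yVar (K n)) {i}
  rw [pointY, Finset.map_singleton, secondDer_zero_pair _ (by simp [(Fin.succ_ne_zero i).symm])]
  rw [Finset.map_singleton, hv] at h1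
  rw [h1, hv, ← zpow_add_one₀ h0]
  simp

end PointY

section Expansion

variable {k : Type*} [Field k]

lemma coeff_yVar_add_C_inv_of_nonpos (c : k) {j : ℤ} (hj : j ≤ 0) :
    (yVar k + HahnSeries.C c)⁻¹.coeff j = 0 :=
  yVar_add_C_inv_mem c j (by omega)

lemma coeff_yVar_add_C_inv (c : k) (r : ℕ) :
    (yVar k + HahnSeries.C c)⁻¹.coeff (r + 1) = (-c) ^ r := by
  have h0 := mul_inv_cancel₀ (yVar_add_C_ne_zero c)
  have h : ∀ j : ℤ, (yVar k + HahnSeries.C c)⁻¹.coeff (j + 1) =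
      (if j = 0 then 1 else 0) - c * (yVar k + HahnSeries.C c)⁻¹.coeff j := by
    intro j
    have h1 := congrArg (fun f => f.coeff j) h0
    simp only [add_mul, HahnSeries.coeff_add, HahnSeries.C_mul_eq_smul, HahnSeries.coeff_smul,
      smul_eq_mul, HahnSeries.coeff_one] at h1
    have h2 := HahnSeries.coeff_single_mul_add (r := (1 : k))
      (x := (yVar k + HahnSeries.C c)⁻¹) (a := j + 1) (b := -1)
    rw [add_neg_cancel_right, one_mul] at h2
    rw [show HahnSeries.single (-1 : ℤ) (1 : k) = yVar k from rfl] at h2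
    rw [h2] at h1
    exact eq_sub_of_add_eq (h1.trans (by congr))
  induction r with
  | zero =>
    rw [Nat.cast_zero, h, coeff_yVar_add_C_inv_of_nonpos c le_rfl]
    simp
  | succ r ih =>
    rw [h, if_neg (by omega), Nat.cast_succ, ih]
    ring

lemma eps_yVar_add_C_inv {ε : ℤ} (hε : ε = 1 ∨ ε = -1) (c : k) :
    ((ε : LaurentSeries k) * yVar k + HahnSeries.C c)⁻¹ =
      HahnSeries.C (ε : k) * (yVar k + HahnSeries.C ((ε : k) * c))⁻¹ := by
  rw [inv_eq_iff_eq_inv, mul_inv, inv_inv]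
  rcases hε with rfl | rfl
  · simp
  · have : ((HahnSeries.C (-1 : k))⁻¹ : LaurentSeries k) = -1 := by
      rw [map_neg, map_one, inv_neg, inv_one]
    rw [neg_one_cast_mul_yVar, Int.cast_neg, Int.cast_one, this, neg_one_mul c, map_neg]
    ring

lemma coeff_eps_yVar_add_C_inv {ε : ℤ} (hε : ε = 1 ∨ ε = -1) (c : k) (r : ℕ) :
    ((ε : LaurentSeries k) * yVar k + HahnSeries.C c)⁻¹.coeff (r + 1) =
      (ε : k) ^ (r + 1) * (-c) ^ r := by
  rw [eps_yVar_add_C_inv hε, HahnSeries.C_mul_eq_smul, HahnSeries.coeff_smul, smul_eq_mul,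
    coeff_yVar_add_C_inv]
  ring

lemma coeff_eps_yVar_add_C_inv_of_nonpos {ε : ℤ} (hε : ε = 1 ∨ ε = -1) (c : k) {j : ℤ}
    (hj : j ≤ 0) : ((ε : LaurentSeries k) * yVar k + HahnSeries.C c)⁻¹.coeff j = 0 := by
  rw [eps_yVar_add_C_inv hε, HahnSeries.C_mul_eq_smul, HahnSeries.coeff_smul,
    coeff_yVar_add_C_inv_of_nonpos _ hj, smul_zero]

end Expansion

section Terms

variable {n : ℕ}

lemma map_orderEmbOfFin_univ (I : Finset (Fin n)) :
    univ.map (I.orderEmbOfFin rfl).toEmbedding = I := by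
  simp

lemma hasCoeff_pointY_mul_pointY {g₁ g₂ : ℕ} {I : Finset (Fin n)} (h₁ : 2 ≤ 2 * g₁ + I.card)
    (h₂ : 2 ≤ 2 * g₂ + Iᶜ.card) {M : ℕ} (hM : Even M) (D : Fin n →₀ ℕ) :
    HasCoeff M D (pointY 1 g₁ I * pointY (-1) g₂ Iᶜ)
      (∑ j ∈ range (M + 1), (-1) ^ j * bracketI g₁ j I D * bracketI g₂ (M - j) Iᶜ D) := by
  have e₁ := pointY_eq_evalY (Or.inl rfl) (I.orderEmbOfFin rfl).toEmbedding h₁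
  have e₂ := pointY_eq_evalY (Or.inr rfl) (Iᶜ.orderEmbOfFin rfl).toEmbedding h₂
  rw [map_orderEmbOfFin_univ] at e₁ e₂
  rw [e₁, e₂, ← map_mul]
  refine ⟨_, coeff_evalY _ M, ?_⟩
  rw [Polynomial.coeff_mul, coeff_sum, Finset.Nat.sum_antidiagonal_eq_sum_range_succ_mk]
  refine Finset.sum_congr rfl fun j hj => ?_
  have hj' : j ≤ M := Nat.lt_succ_iff.1 (mem_range.1 hj)
  have s₁ := nPointY_coeff_mem_supported 1 (I.orderEmbOfFin rfl).toEmbedding g₁ j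
  have s₂ := nPointY_coeff_mem_supported (-1) (Iᶜ.orderEmbOfFin rfl).toEmbedding g₂ (M - j)
  have c₁ := coeff_nPointY 1 (I.orderEmbOfFin rfl).toEmbedding g₁ j D
  have c₂ := coeff_nPointY (-1) (Iᶜ.orderEmbOfFin rfl).toEmbedding g₂ (M - j) D
  rw [map_orderEmbOfFin_univ] at s₁ s₂ c₁ c₂
  have hs : ((-1 : ℤ) : ℚ) ^ (M - j) = (-1) ^ j := by
    push_cast
    exact neg_one_pow_congr (by rw [Nat.even_sub hj']; simp [hM])
  simp only [Finset.mem_compl] at c₂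
  rw [coeff_mul_of_supported disjoint_compl_right s₁ s₂, c₁, c₂, hs, Int.cast_one, one_pow]
  change 1 * bracketI g₁ j I D * ((-1) ^ j * bracketI g₂ (M - j) Iᶜ D) = _
  ring

lemma hasCoeff_pointY_empty {ε : ℤ} (hε : ε = 1 ∨ ε = -1) {g : ℕ} (h : 2 ≤ 2 * g + n) {M : ℕ}
    (hM : Even M) (D : Fin n →₀ ℕ) :
    HasCoeff M D (pointY ε 0 ∅ * pointY (-ε) g univ)
      (bracket g (Fin.cons (M + 2) D : Fin (n + 1) → ℕ)) := by
  have hε' : -ε = 1 ∨ -ε = -1 := by omega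
  have e := pointY_eq_evalY hε' (Function.Embedding.refl (Fin n)) h
  rw [Finset.map_refl] at e
  have c := coeff_nPointY (-ε) (Function.Embedding.refl (Fin n)) g (M + 2) D
  have hs : (((-ε : ℤ) : ℚ)) ^ (M + 2) = 1 := by
    have h2 : Even (M + 2) := hM.add (by decide)
    rcases hε with rfl | rfl <;> simp [h2]
  have hD : D.filter (· ∈ (univ : Finset (Fin n))) = D := by
    ext i
    simp
  rw [Finset.map_refl, hD, hs, one_mul] at c
  refine ⟨_, ?_, c⟩
  rw [pointY_zero_empty hε, e, yVar_zpow, ← coeff_evalY]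
  have := HahnSeries.coeff_single_mul_add (r := (1 : K n))
    (x := evalY n (nPointY (-ε) (Function.Embedding.refl (Fin n)) g))
    (a := -((M + 2 : ℕ) : ℤ)) (b := 2)
  rw [one_mul] at this
  rw [← this]
  congr 1
  push_cast
  ring

lemma bracket_cons_succAbove {m : ℕ} (g : ℕ) (i : Fin (m + 1)) (a : ℕ) (d : Fin (m + 1) → ℕ) :
    bracket g (Fin.cons a fun j => d (i.succAbove j) : Fin (m + 1) → ℕ) =
      bracket g (Function.update d i a) := by
  rw [← bracket_comp_perm g (Nat.le_add_left 1 m) i.cycleRange.symm (Function.update d i a)]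
  congr 1
  ext j
  refine Fin.cases ?_ (fun j => ?_) j <;> simp [Fin.cycleRange_symm_zero, Fin.cycleRange_symm_succ]

lemma coeff_mul_C_mul_X_pow {ι : Type*} [Fintype ι] [DecidableEq ι] {P : MvPolynomial ι ℚ} {i : ι}
    (hP : P ∈ supported ℚ (({i}ᶜ : Finset ι) : Set ι)) (a : ℚ) (r : ℕ) (D : ι →₀ ℕ) :
    coeff D (P * (C a * X i ^ r)) =
      if r = D i then coeff (D.filter (· ∈ ({i}ᶜ : Finset ι))) P * a else 0 := by
  have hX : C a * X i ^ r ∈ supported ℚ (({i} : Finset ι) : Set ι) :=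
    mul_mem (Subalgebra.algebraMap_mem _ a) (pow_mem (X_mem_supported.2 (by simp)) r)
  have hD : D.filter (· ∉ ({i}ᶜ : Finset ι)) = Finsupp.single i (D i) := by
    ext j
    by_cases h : j = i
    · subst h
      simp
    · simp [h]
  rw [coeff_mul_of_supported (disjoint_compl_left) hP hX, hD, coeff_C_mul, coeff_X_pow]
  by_cases h : r = D i
  · rw [if_pos h, if_pos (by rw [h]), mul_one]
  · rw [if_neg h, if_neg, mul_zero, mul_zero]
    exact fun h' => h (Finsupp.single_injective i h')

lemma hasCoeff_pointY_singleton {m : ℕ} {ε : ℤ} (hε : ε = 1 ∨ ε = -1) {g : ℕ} (hg : 1 ≤ g)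
    (i : Fin (m + 1)) {M : ℕ} (hM : Even M) (D : Fin (m + 1) →₀ ℕ) :
    HasCoeff M D (pointY ε 0 {i} * pointY (-ε) g {i}ᶜ)
      (-bracket g (Function.update D i (D i + M + 1))) := by
  have hε' : -ε = 1 ∨ -ε = -1 := by omega
  have e := pointY_eq_evalY hε' i.succAboveEmb (show 2 ≤ 2 * g + m by omega)
  have hi : univ.map i.succAboveEmb = {i}ᶜ := by
    ext j
    simp [Fin.exists_succAbove_eq_iff]
  rw [hi] at e
  set Q := nPointY (-ε) i.succAboveEmb g with hQ
  set W : R (m + 1) → ℕ → R (m + 1) := fun x b =>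
    if b < M + 1 then 0 else C ((ε : ℚ) ^ (b - (M + 1) + 1) * (-1) ^ (b - (M + 1))) *
      x ^ (b - (M + 1)) with hW
  refine ⟨∑ b ∈ range (Q.natDegree + M + D i + 2), Q.coeff b * W (X i) b, ?_, ?_⟩
  · rw [pointY_zero_singleton hε, e, coeff_mul_evalY _ Q (N := Q.natDegree + M + D i + 2) (by omega),
      map_sum]
    refine Finset.sum_congr rfl fun b _ => ?_
    rw [map_mul]
    congr 1
    rw [hW]
    dsimp only
    split_ifs with hb
    · rw [coeff_eps_yVar_add_C_inv_of_nonpos hε _ (by omega), map_zero]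
    · obtain ⟨r, rfl⟩ := Nat.exists_eq_add_of_le (not_lt.1 hb)
      rw [show (-(M : ℤ) + ((M + 1 + r : ℕ) : ℤ)) = (r : ℤ) + 1 by push_cast; ring,
        coeff_eps_yVar_add_C_inv hε, Nat.add_sub_cancel_left]
      simp only [map_mul, map_pow, map_neg, map_one, map_intCast, fracX, neg_pow (algebraMap _ _ _) r]
      ring
  · have hs := fun b => nPointY_coeff_mem_supported (-ε) i.succAboveEmb g b
    have c := fun b => coeff_nPointY (-ε) i.succAboveEmb g b D
    rw [hi] at hs c
    rw [coeff_sum, Finset.sum_eq_single (M + 1 + D i)]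
    · rw [hW]
      dsimp only
      rw [if_neg (by omega), Nat.add_sub_cancel_left, coeff_mul_C_mul_X_pow (hs _), if_pos rfl, c]
      change _ * bracket g (Fin.cons _ fun j => D (i.succAbove j) : Fin (m + 1) → ℕ) * _ = _
      rw [bracket_cons_succAbove, show M + 1 + D i = D i + M + 1 by ring]
      have h1 : (((-ε : ℤ) : ℚ)) ^ (D i + M + 1) * ((ε : ℚ) ^ (D i + 1) * (-1) ^ (D i)) = -1 := by
        have h2 : (-1 : ℚ) ^ M = 1 := hM.neg_one_pow
        have h3 : (-1 : ℚ) ^ D i * (-1) ^ D i = 1 := by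
          rw [← mul_pow]
          simp
        rcases hε with rfl | rfl
        · push_cast
          rw [pow_succ, pow_add, h2, one_pow]
          linear_combination -h3
        · push_cast
          rw [one_pow, pow_succ]
          linear_combination -h3
      linear_combination bracket g (Function.update D i (D i + M + 1)) * h1
    · intro b _ hb
      rw [hW]
      dsimp only
      split_ifs with h
      · rw [mul_zero, coeff_zero]
      · rw [coeff_mul_C_mul_X_pow (hs _), if_neg (by omega)]
    · intro h
      exact absurd (mem_range.2 (by omega)) h

end Terms

section Total

variable {n : ℕ}

lemma bracketI_zero_of_card_le_one (j : ℕ) {I : Finset (Fin n)} (hI : I.card ≤ 1) (d : Fin n → ℕ) :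
    bracketI 0 j I d = 0 := by
  rw [bracketI, bracket, if_pos (by omega)]

/-- The contribution of the unstable factor `F_h(y, x_I)`, for `h = 0` and `#I ≤ 1`, where `A` and
`B i` are the contributions for `I = ∅` and `I = {i}`. -/
def unstableTerm (A : ℚ) (B : Fin n → ℚ) (h : ℕ) (I : Finset (Fin n)) : ℚ :=
  if h = 0 then (if I = ∅ then A else 0) + ∑ i, (if I = {i} then B i else 0) else 0

lemma unstableTerm_eq_zero (A : ℚ) (B : Fin n → ℚ) {h : ℕ} {I : Finset (Fin n)}
    (hI : 2 ≤ 2 * h + I.card) : unstableTerm A B h I = 0 := by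
  rw [unstableTerm]
  split_ifs with h0 h1
  · subst h1
    simp [h0] at hI
  · rw [zero_add]
    refine Finset.sum_eq_zero fun i _ => if_neg ?_
    rintro rfl
    simp [h0] at hI
  · rfl

lemma unstableTerm_zero_empty (A : ℚ) (B : Fin n → ℚ) : unstableTerm A B 0 ∅ = A := by
  simp [unstableTerm, (Finset.singleton_ne_empty _).symm]

lemma unstableTerm_zero_singleton (A : ℚ) (B : Fin n → ℚ) (i : Fin n) :
    unstableTerm A B 0 {i} = B i := by
  simp [unstableTerm]

lemma sum_unstableTerm (A : ℚ) (B : Fin n → ℚ) (g : ℕ) :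
    ∑ I, ∑ p ∈ antidiagonal g, unstableTerm A B p.1 I = A + ∑ i, B i := by
  have h : ∀ I, ∑ p ∈ antidiagonal g, unstableTerm A B p.1 I = unstableTerm A B 0 I := by
    intro I
    rw [Finset.Nat.sum_antidiagonal_eq_sum_range_succ_mk, Finset.sum_eq_single 0]
    · intro b _ hb
      rw [unstableTerm, if_neg hb]
    · simp
  simp only [h]
  simp only [unstableTerm, if_true]
  rw [Finset.sum_add_distrib, Finset.sum_comm]
  simp

lemma sum_unstableTerm_compl (A : ℚ) (B : Fin n → ℚ) (g : ℕ) :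
    ∑ I, ∑ p ∈ antidiagonal g, unstableTerm A B p.2 Iᶜ = A + ∑ i, B i := by
  rw [← sum_unstableTerm A B g]
  refine Fintype.sum_equiv compl_involutive.toPerm
    (fun I => ∑ p ∈ antidiagonal g, unstableTerm A B p.2 Iᶜ) _ fun I => ?_
  exact Finset.Nat.sum_antidiagonal_swap (f := fun p => unstableTerm A B p.1 Iᶜ)

lemma hasCoeff_unstable {ε : ℤ} (hε : ε = 1 ∨ ε = -1) {g : ℕ} (hg : 1 ≤ g) {M : ℕ}
    (hM : Even M) (D : Fin n →₀ ℕ) {I : Finset (Fin n)} (hI : I.card ≤ 1) :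
    HasCoeff M D (pointY ε 0 I * pointY (-ε) g Iᶜ)
      (unstableTerm (bracket g (Fin.cons (M + 2) D : Fin (n + 1) → ℕ))
        (fun i => -bracket g (Function.update D i (D i + M + 1))) 0 I) := by
  rcases Nat.le_one_iff_eq_zero_or_eq_one.1 hI with h | h
  · rw [Finset.card_eq_zero] at h
    subst h
    rw [unstableTerm_zero_empty, Finset.compl_empty]
    exact hasCoeff_pointY_empty hε (by omega) hM D
  · obtain ⟨i, rfl⟩ := Finset.card_eq_one.1 h
    rw [unstableTerm_zero_singleton]
    obtain ⟨m, rfl⟩ : ∃ m, n = m + 1 := ⟨n - 1, by have := i.2; omega⟩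
    exact hasCoeff_pointY_singleton hε hg i hM D

lemma hasCoeff_pair {g : ℕ} (hg : 1 ≤ g) {M : ℕ} (hM : Even M) (D : Fin n →₀ ℕ)
    (I : Finset (Fin n)) {p : ℕ × ℕ} (hp : p ∈ antidiagonal g) :
    HasCoeff M D (pointY 1 p.1 I * pointY (-1) p.2 Iᶜ)
      ((∑ j ∈ range (M + 1), (-1) ^ j * bracketI p.1 j I D * bracketI p.2 (M - j) Iᶜ D) +
        unstableTerm (bracket g (Fin.cons (M + 2) D : Fin (n + 1) → ℕ))
          (fun i => -bracket g (Function.update D i (D i + M + 1))) p.1 I +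
        unstableTerm (bracket g (Fin.cons (M + 2) D : Fin (n + 1) → ℕ))
          (fun i => -bracket g (Function.update D i (D i + M + 1))) p.2 Iᶜ) := by
  obtain ⟨a, b⟩ := p
  rw [HasAntidiagonal.mem_antidiagonal] at hp
  dsimp only at hp ⊢
  by_cases h₁ : 2 ≤ 2 * a + I.card
  · by_cases h₂ : 2 ≤ 2 * b + Iᶜ.card
    · rw [unstableTerm_eq_zero _ _ h₁, unstableTerm_eq_zero _ _ h₂, add_zero, add_zero]
      exact hasCoeff_pointY_mul_pointY h₁ h₂ hM D
    · obtain rfl : b = 0 := by omega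
      obtain rfl : a = g := by omega
      have hI : Iᶜ.card ≤ 1 := by omega
      rw [unstableTerm_eq_zero _ _ h₁, add_zero, Finset.sum_eq_zero, zero_add, mul_comm]
      · have := hasCoeff_unstable (Or.inr rfl) hg hM D hI
        rwa [neg_neg, compl_compl] at this
      · intro j _
        rw [bracketI_zero_of_card_le_one _ hI, mul_zero]
  · obtain rfl : a = 0 := by omega
    obtain rfl : b = g := by omega
    have hI : I.card ≤ 1 := by omega
    rw [unstableTerm_eq_zero _ _ (show 2 ≤ 2 * b + Iᶜ.card by omega), add_zero,
      Finset.sum_eq_zero, zero_add]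
    · exact hasCoeff_unstable (Or.inl rfl) hg hM D hI
    · intro j _
      rw [bracketI_zero_of_card_le_one _ hI, mul_zero, zero_mul]

lemma hasCoeff_pairLeading {g : ℕ} (hg : 2 ≤ g) (D : Fin n →₀ ℕ) :
    HasCoeff (2 * g - 4 : ℕ) D
      (∑ I, ∑ p ∈ antidiagonal g, pointY 1 p.1 I * pointY (-1) p.2 (Iᶜ : Finset (Fin n)))
      (coeff D (pairLeading (X : Fin n → R n) ((2 * g - 3 : ℕ) : ℤ) g univ)) := by
  refine ⟨_, ?_, rfl⟩
  have h := hasLeading_pairWeight (shiftX n) g (univ.map (Fin.succEmb n))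
    (zero_notMem_map_succEmb univ) 0 (-(2 * g - 4 : ℕ)) (by omega)
  have hφ : ∀ i ∈ (univ : Finset (Fin n)), algebraMap (R n) (K n) (X i) =
      shiftX n (Fin.succEmb n i) := fun i _ => by simp [shiftX, fracX]
  rw [map_pairLeading _ (Fin.succEmb n) _ g hφ]
  have hw : ∀ f : Finset (Fin (n + 1)) → LaurentSeries (K n),
      ∑ I ∈ (univ.map (Fin.succEmb n)).powerset, f I =
        ∑ I : Finset (Fin n), f (I.map (Fin.succEmb n)) := by
    intro f
    rw [← Finset.powerset_univ]
    exact sum_powerset_map (Fin.succEmb n) univ fun I _ => f I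
  rw [hw, HahnSeries.coeff_sub, sub_eq_zero] at h
  simp only [zpow_zero, one_mul, pairWeight_shiftX] at h
  rw [h, yVar_zpow, HahnSeries.C_mul_eq_smul, HahnSeries.coeff_smul, HahnSeries.coeff_single,
    if_pos (by omega), smul_eq_mul, mul_one]
  congr 1
  omega

theorem coeff_pairLeading_eq {g : ℕ} (hg : 2 ≤ g) (D : Fin n →₀ ℕ) :
    coeff D (pairLeading (X : Fin n → R n) ((2 * g - 3 : ℕ) : ℤ) g univ) =
      2 * (bracket g (Fin.cons (2 * g - 2) D : Fin (n + 1) → ℕ) -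
        ∑ i, bracket g (Function.update D i (D i + 2 * g - 3))) +
      ∑ gp ∈ range (g + 1), ∑ I : Finset (Fin n), ∑ j ∈ range (2 * g - 3),
        (-1 : ℚ) ^ j * bracketI gp j I D * bracketI (g - gp) (2 * g - 4 - j) Iᶜ D := by
  have hM : Even (2 * g - 4) := ⟨g - 2, by omega⟩
  rw [(hasCoeff_pairLeading hg D).unique (HasCoeff.sum fun I _ => HasCoeff.sum fun p hp =>
    hasCoeff_pair (by omega) hM D I hp)]
  simp only [Finset.sum_add_distrib]
  rw [sum_unstableTerm, sum_unstableTerm_compl, Finset.sum_neg_distrib]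
  simp only [Finset.Nat.sum_antidiagonal_eq_sum_range_succ_mk]
  rw [Finset.sum_comm, show 2 * g - 4 + 1 = 2 * g - 3 by omega,
    show 2 * g - 4 + 2 = 2 * g - 2 by omega]
  have h : ∀ i, D i + (2 * g - 4) + 1 = D i + 2 * g - 3 := fun i => by omega
  simp only [h]
  ring

end Total

/-- Corollary 4.6: for `g ≥ 2`, `d_j ≥ 1` with `Σ (d_j − 1) = g`,
`(2g−3+n)!/(2^{2g+1}(2g−3)! Π (2d_j−1)!!) = ⟨τ_{2g−2}Πτ_{d_j}⟩_g
 − Σ_j ⟨τ_{d_j+2g−3}Π_{i≠j}τ_{d_i}⟩_g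
 + ½ Σ_{g'} Σ_{I⊔J} Σ_{j=0}^{2g−4} (−1)^j ⟨τ_jΠ_{i∈I}τ_{d_i}⟩_{g'}⟨τ_{2g−4−j}Π_{i∈J}τ_{d_i}⟩_{g−g'}`. -/
theorem corollary_4_6 (g n : ℕ) (hg : 2 ≤ g) (hn : 1 ≤ n) (d : Fin n → ℕ)
    (hd : ∀ j, 1 ≤ d j) (hsum : ∑ j, (d j - 1) = g) :
    ((2*g+n-3).factorial : ℚ) /
        (2^(2*g+1) * ((2*g-3).factorial : ℚ) * ∏ j, (Nat.doubleFactorial (2*(d j)-1) : ℚ))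
      = bracket g (Fin.cons (2*g-2) d)
        - ∑ j, bracket g (Function.update d j (d j + 2*g - 3))
        + (1/2) * ∑ gp ∈ Finset.range (g+1), ∑ I : Finset (Fin n),
            ∑ j ∈ Finset.range (2*g-3),
              (-1 : ℚ)^j * bracketI gp j I d * bracketI (g-gp) (2*g-4-j) Iᶜ d := by
  obtain ⟨D, rfl⟩ : ∃ D : Fin n →₀ ℕ, d = D := ⟨Finsupp.equivFunOnFinite.symm d, by simp⟩
  have hsupp : D.support = univ := by
    ext i
    simpa using Nat.one_le_iff_ne_zero.1 (hd i)
  have hex : excess D = g := by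
    rw [excess, Finsupp.sum, hsupp, hsum]
  have hodd : oddFactorialProd D = ∏ j, (Nat.doubleFactorial (2 * D j - 1) : ℚ) := by
    rw [oddFactorialProd, Finsupp.prod, hsupp]
  have key := coeffFormula (ι := Fin n) (2 * g - 3) g D hex
  have hfac := Nat.factorial_mul_ascFactorial (2 * g - 3) n
  rw [hsupp, Finset.card_univ, Fintype.card_fin, coeff_pairLeading_eq hg] at key
  rw [← hodd]
  have h0 := oddFactorialProd_ne_zero D
  have h1 : ((2 * g - 3).factorial : ℚ) ≠ 0 := by exact_mod_cast Nat.factorial_ne_zero _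
  rw [div_eq_iff (by positivity), show 2 * g + n - 3 = 2 * g - 3 + n by omega, ← hfac,
    Nat.cast_mul, ← key, pow_succ, pow_mul, show (2 : ℚ) ^ 2 = 4 by norm_num]
  ring

end
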